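/- For every countable Π^0_1 set S ⊆ {0,1}^N there exists a countable two-dimensional SFT X, deterministic in some direction and with the P-property, such that rank(X) = rank(S) + 4, where rank denotes the Cantor–Bendixson rank. -/

import Mathlib

/-- The set of non-isolated points of `A` (the derived set of `A` in the subspace topology). -/
def cbDerivedSet {X : Type*} [TopologicalSpace X] (A : Set X) : Set X :=
  {x | x ∈ A ∧ x ∈ closure (A \ {x})}

/-- Transfinite Cantor–Bendixson derivatives of the subspace `A`. -/
noncomputable def cbD {X : Type*} [TopologicalSpace X] (A : Set X) (o : Ordinal.{0}) : Set X :=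
  @Ordinal.limitRecOn (fun _ => Set X) o A (fun _ ih => cbDerivedSet ih)
    (fun o _ ih => ⋂ p : {o' : Ordinal.{0} // o' < o}, ih p.1 p.2)

/-- The Cantor–Bendixson rank of `A`: the least ordinal where the derivatives stabilize. -/
noncomputable def cbRank {X : Type*} [TopologicalSpace X] (A : Set X) : Ordinal.{0} :=
  sInf {o : Ordinal.{0} | cbD A o = cbD A (o + 1)}

/-- `A` is ranked if its derivative of order `cbRank A` is empty. -/
def Ranked {X : Type*} [TopologicalSpace X] (A : Set X) : Prop :=
  cbD A (cbRank A) = ∅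

/-- Translation of a two-dimensional configuration. -/
def shift2 {S : Type*} (n : ℤ × ℤ) (x : ℤ × ℤ → S) : ℤ × ℤ → S := fun m => x (n + m)

/-- The pattern with domain `D` and content `p` occurs in `x`. -/
def occurs2 {S : Type*} (D : Finset (ℤ × ℤ)) (p : ℤ × ℤ → S) (x : ℤ × ℤ → S) : Prop :=
  ∃ n : ℤ × ℤ, ∀ m ∈ D, x (n + m) = p m

/-- A two-dimensional subshift of finite type: the configurations in which no pattern from a
fixed finite set of forbidden finite patterns occurs. -/
def IsSFT2 {S : Type*} (X : Set (ℤ × ℤ → S)) : Prop :=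
  ∃ F : Set (Finset (ℤ × ℤ) × (ℤ × ℤ → S)), F.Finite ∧
    X = {x | ∀ P ∈ F, ¬ occurs2 P.1 P.2 x}

/-- `x ≤ y` in the subpattern preorder: every finite pattern occurring in `x` occurs in `y`. -/
def patLE2 {S : Type*} (x y : ℤ × ℤ → S) : Prop :=
  ∀ (D : Finset (ℤ × ℤ)) (n : ℤ × ℤ), ∃ n' : ℤ × ℤ, ∀ m ∈ D, y (n' + m) = x (n + m)

/-- `x < y` in the subpattern preorder. -/
def patLT2 {S : Type*} (x y : ℤ × ℤ → S) : Prop := patLE2 x y ∧ ¬ patLE2 y x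

/-- The `i`-th row of a two-dimensional configuration. -/
def row {S : Type*} (x : ℤ × ℤ → S) (i : ℤ) : ℤ → S := fun j => x (j, i)

/-- The (horizontal) projective subdynamics of `X`: its set of rows at height `0`. -/
def PS2 {S : Type*} (X : Set (ℤ × ℤ → S)) : Set (ℤ → S) := (fun x => row x 0) '' X

/-- The shift map on bi-infinite configurations. -/
def shift1 {S : Type*} (x : ℤ → S) : ℤ → S := fun m => x (m + 1)

/-- The word `u` occurs in `x` at position `n`. -/
def occursAtW {S : Type*} (u : List S) (x : ℤ → S) (n : ℤ) : Prop :=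
  ∀ i : Fin u.length, x (n + ((i : ℕ) : ℤ)) = u.get i

/-- The word `u` occurs in the configuration `x`. -/
def occursW {S : Type*} (u : List S) (x : ℤ → S) : Prop := ∃ n : ℤ, occursAtW u x n

/-- The word `u` occurs in some configuration of `X`. -/
def occursWIn {S : Type*} (X : Set (ℤ → S)) (u : List S) : Prop := ∃ x ∈ X, occursW u x

/-- A one-dimensional subshift of finite type: the configurations avoiding a finite set of
forbidden words. -/
def IsSFT1 {S : Type*} (X : Set (ℤ → S)) : Prop :=
  ∃ F : Set (List S), F.Finite ∧ X = {x | ∀ u ∈ F, ¬ occursW u x}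

/-- `X` is southward deterministic: two configurations of `X` agreeing on the upper half-plane
`{(a,b) : b ≥ 1}` are equal. -/
def SouthDet {S : Type*} (X : Set (ℤ × ℤ → S)) : Prop :=
  ∀ x ∈ X, ∀ y ∈ X, (∀ a b : ℤ, 1 ≤ b → x (a, b) = y (a, b)) → x = y

/-- Counterclockwise rotation by 90 degrees. -/
def rot90 (v : ℤ × ℤ) : ℤ × ℤ := (-v.2, v.1)

/-- The action of an element of `SL₂(ℤ)` on integer vectors. -/
def sl2Vec (A : Matrix.SpecialLinearGroup (Fin 2) ℤ) (v : ℤ × ℤ) : ℤ × ℤ :=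
  ((A : Matrix (Fin 2) (Fin 2) ℤ) 0 0 * v.1 + (A : Matrix (Fin 2) (Fin 2) ℤ) 0 1 * v.2,
   (A : Matrix (Fin 2) (Fin 2) ℤ) 1 0 * v.1 + (A : Matrix (Fin 2) (Fin 2) ℤ) 1 1 * v.2)

/-- The action of `SL₂(ℤ)` on configurations: `A(x)_n = x_{A⁻¹ n}`. -/
def confAct {S : Type*} (A : Matrix.SpecialLinearGroup (Fin 2) ℤ) (x : ℤ × ℤ → S) :
    ℤ × ℤ → S := fun n => x (sl2Vec A⁻¹ n)

/-- `X` is deterministic in the direction `d`: the image of `X` under the element of `SL₂(ℤ)`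
taking the 90°-counterclockwise rotation of `d` to `(1,0)` is southward deterministic. -/
def DetInDir {S : Type*} (d : ℤ × ℤ) (X : Set (ℤ × ℤ → S)) : Prop :=
  ∃ A : Matrix.SpecialLinearGroup (Fin 2) ℤ,
    sl2Vec A (rot90 d) = (1, 0) ∧ SouthDet ((confAct A) '' X)

/-- `X` is deterministic in some direction. -/
def DetSomeDir {S : Type*} (X : Set (ℤ × ℤ → S)) : Prop :=
  ∃ d : ℤ × ℤ, IsCoprime d.1 d.2 ∧ DetInDir d X

/-- The P-property: some subshift conjugate to `X` (via a bijective block map, i.e. a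
shift-commuting homeomorphism) has its projective subdynamics contained in a countable
one-dimensional SFT. All alphabets carry the discrete topology. -/
def PProperty {S : Type*} (X : Set (ℤ × ℤ → S)) : Prop :=
  ∃ (T : Type) (_ : Fintype T) (X' : Set (ℤ × ℤ → T))
    (f : (ℤ × ℤ → S) → (ℤ × ℤ → T)) (g : (ℤ × ℤ → T) → (ℤ × ℤ → S)),
    (letI : TopologicalSpace S := ⊥
     letI : TopologicalSpace T := ⊥
     Continuous f ∧ Continuous g) ∧
    (∀ (n : ℤ × ℤ) x, f (shift2 n x) = shift2 n (f x)) ∧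
    (∀ (n : ℤ × ℤ) x, g (shift2 n x) = shift2 n (g x)) ∧
    (∀ x ∈ X, f x ∈ X') ∧ (∀ y ∈ X', g y ∈ X) ∧
    (∀ x ∈ X, g (f x) = x) ∧ (∀ y ∈ X', f (g y) = y) ∧
    ∃ Y : Set (ℤ → T), IsSFT1 Y ∧ Y.Countable ∧ PS2 X' ⊆ Y

section CantorBendixson

open Set Topology

variable {X Y : Type*} [TopologicalSpace X] [TopologicalSpace Y]

theorem cbD_zero (A : Set X) : cbD A 0 = A := by
  unfold cbD; exact Ordinal.limitRecOn_zero ..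

theorem cbD_add_one (A : Set X) (o : Ordinal.{0}) : cbD A (o + 1) = cbDerivedSet (cbD A o) := by
  unfold cbD; exact Ordinal.limitRecOn_add_one ..

theorem cbD_limit (A : Set X) {o : Ordinal.{0}} (h : Order.IsSuccLimit o) :
    cbD A o = ⋂ p : {o' : Ordinal.{0} // o' < o}, cbD A p.1 := by
  unfold cbD; exact Ordinal.limitRecOn_limit (h := h) ..

theorem mem_cbD_limit {A : Set X} {o : Ordinal.{0}} (h : Order.IsSuccLimit o) {x : X} :
    x ∈ cbD A o ↔ ∀ o' < o, x ∈ cbD A o' := by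
  rw [cbD_limit A h]; simp

theorem cbDerivedSet_subset (A : Set X) : cbDerivedSet A ⊆ A := fun _ h => h.1

theorem cbD_antitone (A : Set X) {o o' : Ordinal.{0}} (h : o ≤ o') : cbD A o' ⊆ cbD A o := by
  induction o' using Ordinal.limitRecOn with
  | zero => rw [nonpos_iff_eq_zero.1 h]
  | add_one b ih =>
    rcases h.lt_or_eq with h | h
    · rw [cbD_add_one]
      exact (cbDerivedSet_subset _).trans (ih (Order.lt_add_one_iff.1 h))
    · rw [h]
  | limit b hb ih =>
    rcases h.lt_or_eq with h | h
    · exact fun x hx => (mem_cbD_limit hb).1 hx o h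
    · rw [h]

theorem cbD_const_of_stable {A : Set X} {o : Ordinal.{0}} (hs : cbD A o = cbD A (o + 1))
    {o' : Ordinal.{0}} (h : o ≤ o') : cbD A o' = cbD A o := by
  induction o' using Ordinal.limitRecOn with
  | zero => rw [nonpos_iff_eq_zero.1 h]
  | add_one b ih =>
    rcases h.lt_or_eq with h | h
    · rw [cbD_add_one, ih (Order.lt_add_one_iff.1 h), ← cbD_add_one, ← hs]
    · rw [h]
  | limit b hb ih =>
    rcases h.lt_or_eq with h | h
    · refine (cbD_antitone A h.le).antisymm fun x hx => (mem_cbD_limit hb).2 fun c hc => ?_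
      rcases le_total o c with hoc | hco
      · rw [ih c hc hoc]; exact hx
      · exact cbD_antitone A hco hx
    · rw [h]

theorem cbRank_eq_add_one {A : Set X} {o : Ordinal.{0}} (h1 : (cbD A o).Nonempty)
    (h2 : cbD A (o + 1) = ∅) : cbRank A = o + 1 := by
  have hmem : o + 1 ∈ {o : Ordinal.{0} | cbD A o = cbD A (o + 1)} := by
    have := cbD_antitone A (le_self_add : o + 1 ≤ o + 1 + 1)
    rw [h2] at this
    simp only [mem_ofPred_eq, h2]
    exact (subset_empty_iff.1 this).symm
  refine le_antisymm (csInf_le' hmem) (le_csInf ⟨_, hmem⟩ fun b hb => ?_)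
  by_contra hlt
  have hbo : b ≤ o := Order.lt_add_one_iff.1 (not_le.1 hlt)
  have e1 := cbD_const_of_stable hb hbo
  have e2 := cbD_const_of_stable hb (hbo.trans le_self_add : b ≤ o + 1)
  rw [← e1, h2] at e2
  exact h1.ne_empty e2.symm

theorem isClosed_cbDerivedSet [T1Space X] {A : Set X} (hA : IsClosed A) :
    IsClosed (cbDerivedSet A) := by
  have : cbDerivedSet A = A ∩ derivedSet A := by
    ext x
    simp [cbDerivedSet, mem_derivedSet, accPt_principal_iff_clusterPt, mem_closure_iff_clusterPt]
  rw [this]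
  exact hA.inter (isClosed_derivedSet A)

theorem isClosed_cbD [T1Space X] {A : Set X} (hA : IsClosed A) (o : Ordinal.{0}) :
    IsClosed (cbD A o) := by
  induction o using Ordinal.limitRecOn with
  | zero => rwa [cbD_zero]
  | add_one b ih => rw [cbD_add_one]; exact isClosed_cbDerivedSet ih
  | limit b hb ih => rw [cbD_limit A hb]; exact isClosed_iInter fun p => ih p.1 p.2

theorem cbD_inter_open (A : Set X) {U : Set X} (hU : IsOpen U) (o : Ordinal.{0}) :
    cbD (A ∩ U) o = cbD A o ∩ U := by
  induction o using Ordinal.limitRecOn with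
  | zero => simp [cbD_zero]
  | add_one b ih =>
    rw [cbD_add_one, cbD_add_one, ih]
    ext x
    refine ⟨fun h => ⟨⟨h.1.1, closure_mono (by gcongr; exact inter_subset_left) h.2⟩, h.1.2⟩,
      fun ⟨h, hx⟩ => ⟨⟨h.1, hx⟩, ?_⟩⟩
    rw [mem_closure_iff] at *
    have := (mem_closure_iff.1 h.2)
    intro V hV hxV
    obtain ⟨y, hy, hy'⟩ := this (V ∩ U) (hV.inter hU) ⟨hxV, hx⟩
    exact ⟨y, hy.1, ⟨hy'.1, hy.2⟩, hy'.2⟩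
  | limit b hb ih =>
    ext x
    simp only [mem_inter_iff, mem_cbD_limit hb]
    constructor
    · intro h
      exact ⟨fun o' ho' => ((ih o' ho').subset (h o' ho')).1,
        ((ih 0 hb.bot_lt).subset (h 0 hb.bot_lt)).2⟩
    · rintro ⟨h, hx⟩ o' ho'
      rw [ih o' ho']
      exact ⟨h o' ho', hx⟩

theorem cbD_image {A : Set Y} {f : Y → X} (hinj : InjOn f A)
    (hcl : ∀ B ⊆ A, ∀ x ∈ A, x ∈ closure B ↔ f x ∈ closure (f '' B)) (o : Ordinal.{0}) :
    cbD (f '' A) o = f '' cbD A o := by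
  have hsub : ∀ o, cbD A o ⊆ A := fun o => by
    simpa [cbD_zero] using cbD_antitone A zero_le
  induction o using Ordinal.limitRecOn with
  | zero => simp [cbD_zero]
  | add_one b ih =>
    rw [cbD_add_one, cbD_add_one, ih]
    have key : ∀ x ∈ cbD A b, f '' cbD A b \ {f x} = f '' (cbD A b \ {x}) := by
      intro x hx
      rw [← image_singleton, (hinj.mono (hsub b)).image_sdiff_subset (by simpa using hx)]
    ext y
    constructor
    · rintro ⟨⟨x, hx, rfl⟩, h⟩
      rw [key x hx] at h
      exact ⟨x, ⟨hx, (hcl _ (sdiff_subset.trans (hsub b)) x (hsub b hx)).2 h⟩, rfl⟩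
    · rintro ⟨x, hx, rfl⟩
      refine ⟨⟨x, hx.1, rfl⟩, ?_⟩
      rw [key x hx.1]
      exact (hcl _ (sdiff_subset.trans (hsub b)) x (hsub b hx.1)).1 hx.2
  | limit b hb ih =>
    have : Nonempty {o' : Ordinal.{0} // o' < b} := ⟨⟨0, hb.bot_lt⟩⟩
    have e := InjOn.image_iInter_eq (s := fun p : {o' : Ordinal.{0} // o' < b} => cbD A p.1)
      (f := f) (hinj.mono (iUnion_subset fun p => hsub p.1))
    rw [cbD_limit _ hb, cbD_limit _ hb, e]
    exact iInter_congr fun p => ih p.1 p.2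

theorem cbD_image_of_isCompact [T2Space X] {A : Set Y} (hA : IsCompact A) {f : Y → X}
    (hinj : InjOn f A) (hf : ContinuousOn f A) (o : Ordinal.{0}) :
    cbD (f '' A) o = f '' cbD A o := by
  refine cbD_image hinj (fun B hB x hx => ⟨fun h => ?_, fun h => ?_⟩) o
  · have := (hf x hx).mono hB
    exact this.mem_closure_image h
  · have hK : IsCompact (closure B ∩ A) := hA.inter_left isClosed_closure
    have hc : IsClosed (f '' (closure B ∩ A)) :=
      (hK.image_of_continuousOn (hf.mono inter_subset_right)).isClosed
    have : f x ∈ f '' (closure B ∩ A) :=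
      closure_minimal (image_mono (subset_inter subset_closure hB)) hc h
    obtain ⟨z, hz, hzx⟩ := this
    rw [← hinj hz.2 hx hzx]
    exact hz.1

theorem cbD_image_homeomorph (e : Y ≃ₜ X) (A : Set Y) (o : Ordinal.{0}) :
    cbD (e '' A) o = e '' cbD A o :=
  cbD_image e.injective.injOn (fun B _ x _ => by
    rw [← e.image_closure, e.injective.mem_set_image]) o

/-- A set whose derivatives vanish eventually is countable. -/
theorem countable_of_cbD_eq_empty [SecondCountableTopology X] {A : Set X} {o : Ordinal.{0}}
    (h : cbD A o = ∅) : A.Countable := by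
  let B := TopologicalSpace.countableBasis X
  have key : ∀ x ∈ A, ∃ U ∈ B, ∃ b, cbD A b ∩ U = {x} := by
    intro x hx
    have hne : {c | x ∉ cbD A c}.Nonempty := ⟨o, by simp [h]⟩
    set c := sInf {c | x ∉ cbD A c} with hc
    have hcm : x ∉ cbD A c := csInf_mem hne
    have hlt : ∀ b < c, x ∈ cbD A b := fun b hb => by
      by_contra hcon
      exact (not_le.2 hb) (csInf_le' hcon)
    clear_value c
    induction c using Ordinal.limitRecOn with
    | zero => rw [cbD_zero] at hcm; exact absurd hx hcm
    | limit b hb _ => exact absurd ((mem_cbD_limit hb).2 hlt) hcm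
    | add_one b _ =>
      have hxb := hlt b (Order.lt_add_one_iff.2 le_rfl)
      rw [cbD_add_one] at hcm
      have : x ∉ closure (cbD A b \ {x}) := fun hh => hcm ⟨hxb, hh⟩
      obtain ⟨U, hU, hxU, hUs⟩ := (TopologicalSpace.isBasis_countableBasis X).exists_subset_of_mem_open
        (mem_compl this) isClosed_closure.isOpen_compl
      refine ⟨U, hU, b, ?_⟩
      ext y
      constructor
      · rintro ⟨hy, hyU⟩
        by_contra hne
        exact hUs hyU (subset_closure ⟨hy, hne⟩)
      · rintro rfl; exact ⟨hxb, hxU⟩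
  have hsub : A ⊆ ⋃ U ∈ B, {x | ∃ b, cbD A b ∩ U = {x}} := fun x hx => by
    obtain ⟨U, hU, hb⟩ := key x hx
    exact mem_biUnion hU hb
  refine Countable.mono hsub ((TopologicalSpace.countable_countableBasis X).biUnion fun U _ => ?_)
  refine Set.Subsingleton.countable ?_
  rintro x ⟨b, hb⟩ y ⟨c, hc⟩
  have hx : x ∈ cbD A b ∩ U := by simp [hb]
  have hy : y ∈ cbD A c ∩ U := by simp [hc]
  rcases le_total b c with hbc | hbc
  · have : y ∈ cbD A b ∩ U := ⟨cbD_antitone A hbc hy.1, hy.2⟩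
    rw [hb] at this; exact this.symm
  · have : x ∈ cbD A c ∩ U := ⟨cbD_antitone A hbc hx.1, hx.2⟩
    rw [hc] at this; exact this

theorem cbD_cbRank_stable {X : Type} [TopologicalSpace X] (A : Set X) : cbD A (cbRank A) = cbD A (cbRank A + 1) := by
  have : {o : Ordinal.{0} | cbD A o = cbD A (o + 1)}.Nonempty := by
    by_contra hne
    refine not_injective_of_ordinal (cbD A) fun a b hab => ?_
    by_contra hab'
    wlog hlt : a < b generalizing a b
    · exact this b a hab.symm (Ne.symm hab') (lt_of_le_of_ne (not_lt.1 hlt) (Ne.symm hab'))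
    refine hne ⟨a, (cbD_antitone A le_self_add).antisymm' ?_⟩
    rw [hab]
    exact cbD_antitone A (Order.add_one_le_of_lt hlt)
  exact csInf_mem this

theorem cbD_cbRank_eq_empty {S : Set (ℕ → Bool)} (hc : S.Countable) (hcl : IsClosed S) :
    cbD S (cbRank S) = ∅ := by
  by_contra hne
  set C := cbD S (cbRank S) with hC
  have hst : C = cbDerivedSet C := by rw [hC, ← cbD_add_one]; exact cbD_cbRank_stable S
  let := TopologicalSpace.upgradeIsCompletelyMetrizable (ℕ → Bool)
  have hp : Perfect C := by
    refine ⟨isClosed_cbD hcl _, fun x hx => ?_⟩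
    rw [hst] at hx
    rw [accPt_principal_iff_clusterPt, ← mem_closure_iff_clusterPt]
    exact hx.2
  obtain ⟨f, hf, -, hinj⟩ := hp.exists_nat_bool_injection (nonempty_iff_ne_empty.2 hne)
  have hCS : C ⊆ S := by simpa [cbD_zero] using cbD_antitone S zero_le
  have : (range f).Countable := hc.mono (hf.trans hCS)
  have h2 : Countable (ℕ → Bool) := by
    have := this.to_subtype
    exact (Equiv.ofInjective f hinj).countable_iff.2 this
  refine absurd (Cardinal.mk_le_aleph0_iff.2 h2) (not_le.2 ?_)
  have e : Cardinal.mk (ℕ → Bool) = Cardinal.continuum := by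
    rw [← Cardinal.power_def]; simp
  rw [e]
  exact Cardinal.aleph0_lt_continuum

end CantorBendixson

section Prepend

open Set Topology

/-- The sequence `0^n 1 x`. -/
def prepend (n : ℕ) (x : ℕ → Bool) : ℕ → Bool := fun i =>
  if i < n then false else if i = n then true else x (i - (n + 1))

/-- The sequences avoiding all words of a family. -/
def avoids (e : ℕ → Option (List Bool)) : Set (ℕ → Bool) :=
  {x | ∀ l : List Bool, (∃ k, e k = some l) → ¬ ∀ i : Fin l.length, x (i : ℕ) = l.get i}

theorem isClosed_avoids (e : ℕ → Option (List Bool)) : IsClosed (avoids e) := by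
  have : avoids e = ⋂ (l : List Bool) (_ : ∃ k, e k = some l),
      {x : ℕ → Bool | ∀ i : Fin l.length, x (i : ℕ) = l.get i}ᶜ := by
    ext x; simp [avoids]
  rw [this]
  refine isClosed_iInter fun l => isClosed_iInter fun _ => IsOpen.isClosed_compl ?_
  simp only [ofPred_forall]
  refine isOpen_iInter_of_finite fun i => ?_
  exact (isOpen_discrete {l.get i}).preimage (continuous_apply (A := fun _ : ℕ => Bool) (i : ℕ))

theorem prepend_injective (n : ℕ) : Function.Injective (prepend n) := by
  intro x y h
  funext i
  have := congrFun h (n + 1 + i)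
  simpa [prepend, show ¬ n + 1 + i < n by omega, show n + 1 + i ≠ n by omega] using this

theorem continuous_prepend (n : ℕ) : Continuous (prepend n) := by
  refine continuous_pi fun i => ?_
  unfold prepend
  split_ifs
  · exact continuous_const
  · exact continuous_const
  · exact continuous_apply _

/-- The sequences whose first `true` is at position `n`. -/
def firstAt (n : ℕ) : Set (ℕ → Bool) := {x | (∀ i : Fin n, x i = false) ∧ x n = true}

theorem isOpen_firstAt (n : ℕ) : IsOpen (firstAt n) := by
  have : firstAt n = (⋂ i : Fin n, (fun x : ℕ → Bool => x i) ⁻¹' {false}) ∩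
      (fun x : ℕ → Bool => x n) ⁻¹' {true} := by
    ext x; simp [firstAt]
  rw [this]
  refine (isOpen_iInter_of_finite fun i : Fin n => (isOpen_discrete _).preimage (continuous_apply (A := fun _ : ℕ => Bool) (i : ℕ))).inter
    ((isOpen_discrete _).preimage (continuous_apply n))

theorem prepend_mem_firstAt (n : ℕ) (x : ℕ → Bool) : prepend n x ∈ firstAt n := by
  refine ⟨fun i => ?_, ?_⟩ <;> simp [prepend]

theorem exists_firstAt {x : ℕ → Bool} (hx : x ≠ fun _ => false) : ∃ n, x ∈ firstAt n := by
  have : ∃ n, x n = true := by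
    by_contra h
    push Not at h
    exact hx (funext fun n => by simpa using h n)
  classical
  refine ⟨Nat.find this, fun i => ?_, Nat.find_spec this⟩
  simpa using Nat.find_min this i.2

theorem firstAt_unique {x : ℕ → Bool} {m n : ℕ} (hm : x ∈ firstAt m) (hn : x ∈ firstAt n) :
    m = n := by
  rcases lt_trichotomy m n with h | h | h
  · have := hn.1 ⟨m, h⟩; simp [hm.2] at this
  · exact h
  · have := hm.1 ⟨n, h⟩; simp [hn.2] at this

theorem exists_prepend {x : ℕ → Bool} {n : ℕ} (hx : x ∈ firstAt n) : ∃ y, x = prepend n y := by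
  refine ⟨fun i => x (i + (n + 1)), funext fun i => ?_⟩
  unfold prepend
  split_ifs with h1 h2
  · exact hx.1 ⟨i, h1⟩
  · subst h2; exact hx.2
  · congr 1; omega

/-- The family of forbidden words `0^n 1 w`. -/
def prependWords (e : ℕ → Option (List Bool)) : ℕ → Option (List Bool) := fun m =>
  (e m.unpair.2).map fun w => (List.range m.unpair.1).map (fun _ => false) ++ true :: w

theorem computable_prependWords {e : ℕ → Option (List Bool)} (he : Computable e) :
    Computable (prependWords e) := by
  unfold prependWords
  refine Computable.option_map (he.comp (Computable.snd.comp Computable.unpair)) ?_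
  refine Primrec.to_comp ?_
  refine Primrec.list_append.comp ?_ (Primrec.list_cons.comp (Primrec.const true) Primrec.snd)
  exact Primrec.list_map (Primrec.list_range.comp
    (Primrec.fst.comp (Primrec.unpair.comp Primrec.fst))) (Primrec.const false).to₂

theorem prefix_prepend_iff (n : ℕ) (y : ℕ → Bool) (w : List Bool) :
    (∀ i : Fin ((List.range n).map (fun _ => false) ++ true :: w).length,
      prepend n y i = ((List.range n).map (fun _ => false) ++ true :: w).get i) ↔
    ∀ i : Fin w.length, y i = w.get i := by
  constructor
  · intro h i
    have := h ⟨n + 1 + i, by simp; omega⟩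
    simpa [prepend, List.getElem_append, show ¬ n + 1 + (i : ℕ) < n by omega,
      show n + 1 + (i : ℕ) ≠ n by omega, show n + 1 + (i : ℕ) - n = i + 1 by omega] using this
  · rintro h ⟨i, hi⟩
    simp only [List.length_append, List.length_map, List.length_range, List.length_cons] at hi
    simp only [prepend, List.get_eq_getElem, List.getElem_append, List.length_map, List.length_range]
    split_ifs with h1 h2
    · simp
    · subst h2; simp
    · obtain ⟨j, rfl⟩ : ∃ j, i = n + 1 + j := ⟨i - (n + 1), by omega⟩
      have := h ⟨j, by omega⟩
      simpa [show n + 1 + j - n = j + 1 by omega] using this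

theorem prefix_firstAt {n m : ℕ} {x : ℕ → Bool} (hx : x ∈ firstAt n) {w : List Bool}
    (h : ∀ i : Fin ((List.range m).map (fun _ => false) ++ true :: w).length,
      x i = ((List.range m).map (fun _ => false) ++ true :: w).get i) : n = m := by
  refine firstAt_unique hx ⟨fun i => ?_, ?_⟩
  · have := h ⟨i, by simp; omega⟩
    simpa [List.getElem_append] using this
  · have := h ⟨m, by simp⟩
    simpa [List.getElem_append] using this

theorem prepend_mem_avoids (e : ℕ → Option (List Bool)) (n : ℕ) (y : ℕ → Bool) :
    prepend n y ∈ avoids (prependWords e) ↔ y ∈ avoids e := by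
  constructor
  · rintro h w ⟨k, hk⟩ hw
    exact h _ ⟨Nat.pair n k, by simp [prependWords, hk]⟩ ((prefix_prepend_iff n y w).2 hw)
  · rintro h l ⟨m, hm⟩ hl
    simp only [prependWords, Option.map_eq_some_iff] at hm
    obtain ⟨w, hw, rfl⟩ := hm
    obtain rfl := prefix_firstAt (prepend_mem_firstAt n y) hl
    exact h w ⟨_, hw⟩ ((prefix_prepend_iff _ y w).1 hl)

theorem zero_mem_avoids (e : ℕ → Option (List Bool)) :
    (fun _ => false) ∈ avoids (prependWords e) := by
  rintro l ⟨m, hm⟩ hl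
  simp only [prependWords, Option.map_eq_some_iff] at hm
  obtain ⟨w, hw, rfl⟩ := hm
  have := hl ⟨m.unpair.1, by simp⟩
  simp at this

theorem cbD_prependWords_inter (e : ℕ → Option (List Bool)) (n : ℕ) (o : Ordinal.{0}) :
    cbD (avoids (prependWords e)) o ∩ firstAt n = prepend n '' cbD (avoids e) o := by
  rw [← cbD_inter_open _ (isOpen_firstAt n), ← cbD_image_of_isCompact
    (isClosed_avoids e).isCompact (prepend_injective n).injOn (continuous_prepend n).continuousOn]
  congr 1
  ext x
  constructor
  · rintro ⟨h1, h2⟩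
    obtain ⟨y, rfl⟩ := exists_prepend h2
    exact ⟨y, (prepend_mem_avoids e n y).1 h1, rfl⟩
  · rintro ⟨y, hy, rfl⟩
    exact ⟨(prepend_mem_avoids e n y).2 hy, prepend_mem_firstAt n y⟩

theorem tendsto_prepend (y : ℕ → ℕ → Bool) :
    Filter.Tendsto (fun n => prepend n (y n)) Filter.atTop (𝓝 fun _ => false) := by
  refine tendsto_pi_nhds.2 fun i => tendsto_const_nhds.congr' ?_
  filter_upwards [Filter.eventually_gt_atTop i] with n hn
  simp [prepend, hn]

theorem zero_mem_cbD_prependWords (e : ℕ → Option (List Bool)) {o : Ordinal.{0}}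
    (ho : o ≤ cbRank (avoids e)) : (fun _ => false) ∈ cbD (avoids (prependWords e)) o := by
  induction o using Ordinal.limitRecOn with
  | zero => rw [cbD_zero]; exact zero_mem_avoids e
  | limit b hb ih => exact (mem_cbD_limit hb).2 fun c hc => ih c hc (hc.le.trans ho)
  | add_one b ih =>
    have hb : b < cbRank (avoids e) := Order.add_one_le_iff.1 ho
    have hne : (cbD (avoids e) b).Nonempty := by
      rw [nonempty_iff_ne_empty]
      intro h0
      refine (not_le.2 hb) (csInf_le' ?_)
      have := cbD_antitone (avoids e) (le_self_add : b ≤ b + 1)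
      rw [h0] at this
      simp only [mem_ofPred_eq, h0]
      exact (subset_empty_iff.1 this).symm
    obtain ⟨y, hy⟩ := hne
    rw [cbD_add_one]
    refine ⟨ih hb.le, mem_closure_of_tendsto (tendsto_prepend fun _ => y)
      (Filter.Eventually.of_forall fun n => ⟨?_, fun h => ?_⟩)⟩
    · exact ((cbD_prependWords_inter e n b).symm.subset ⟨y, hy, rfl⟩).1
    · have := congrFun h n
      simp [prepend] at this

theorem cbD_prependWords_add_one (e : ℕ → Option (List Bool)) (hc : (avoids e).Countable) :
    cbD (avoids (prependWords e)) (cbRank (avoids e) + 1) = ∅ := by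
  have h0 : cbD (avoids (prependWords e)) (cbRank (avoids e)) ⊆ {fun _ => false} := by
    intro x hx
    by_contra hne
    obtain ⟨n, hn⟩ := exists_firstAt hne
    have := (cbD_prependWords_inter e n (cbRank (avoids e))).subset ⟨hx, hn⟩
    rw [cbD_cbRank_eq_empty hc (isClosed_avoids e)] at this
    simp at this
  rw [cbD_add_one, eq_empty_iff_forall_notMem]
  rintro x ⟨hx, hx'⟩
  rw [h0 hx, sdiff_eq_empty.2 h0] at hx'
  simp at hx'

end Prepend

section PrimrecTest

open Set Topology

/-- Binary code (with leading digit `1`) of the initial word of length `k`. -/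
def prefixCode (x : ℕ → Bool) : ℕ → ℕ
  | 0 => 1
  | k + 1 => 2 * prefixCode x k + (x k).toNat

/-- Binary code of a word, with leading digit `1`. -/
def wordCode (l : List Bool) : ℕ := l.foldl (fun z b => 2 * z + b.toNat) 1

theorem wordCode_append (l : List Bool) (b : Bool) :
    wordCode (l ++ [b]) = 2 * wordCode l + b.toNat := by
  simp [wordCode]

theorem wordCode_pos (l : List Bool) : 0 < wordCode l := by
  induction l using List.reverseRecOn with
  | nil => simp [wordCode]
  | append_singleton l b ih => rw [wordCode_append]; omega

theorem wordCode_injective : Function.Injective wordCode := by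
  intro l
  induction l using List.reverseRecOn with
  | nil =>
    intro m h
    rcases List.eq_nil_or_concat' m with rfl | ⟨m, b, rfl⟩
    · rfl
    · have := wordCode_pos m
      rw [wordCode_append] at h
      simp only [wordCode, List.foldl_nil] at h this
      omega
  | append_singleton l b ih =>
    intro m h
    rcases List.eq_nil_or_concat' m with rfl | ⟨m, c, rfl⟩
    · have := wordCode_pos l
      rw [wordCode_append] at h
      simp only [wordCode, List.foldl_nil] at h this
      omega
    · rw [wordCode_append, wordCode_append] at h
      have hbc : b = c ∧ wordCode l = wordCode m := by
        cases b <;> cases c <;> simp at h ⊢ <;> omega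
      rw [ih hbc.2, hbc.1]

theorem prefixCode_eq (x : ℕ → Bool) (k : ℕ) :
    prefixCode x k = wordCode ((List.range k).map x) := by
  induction k with
  | zero => rfl
  | succ k ih => rw [List.range_succ, List.map_append, List.map_singleton, wordCode_append, ← ih]; rfl

theorem wordCode_eq_prefixCode_iff (l : List Bool) (x : ℕ → Bool) (k : ℕ) :
    wordCode l = prefixCode x k ↔ l.length = k ∧ ∀ i : Fin l.length, x (i : ℕ) = l.get i := by
  rw [prefixCode_eq, wordCode_injective.eq_iff]
  constructor
  · rintro rfl; simp
  · rintro ⟨rfl, h⟩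
    refine List.ext_getElem (by simp) fun i h1 h2 => ?_
    simpa using (h ⟨i, h1⟩).symm

theorem le_prefixCode (x : ℕ → Bool) (k : ℕ) : k < prefixCode x k := by
  induction k with
  | zero => simp [prefixCode]
  | succ k ih => simp only [prefixCode]; omega

theorem iterate_div2_prefixCode (x : ℕ → Bool) (k j : ℕ) :
    Nat.div2^[j] (prefixCode x (k + j)) = prefixCode x k := by
  induction j with
  | zero => rfl
  | succ j ih =>
    rw [Function.iterate_succ_apply, ← ih]
    congr 1
    rw [← add_assoc, prefixCode, Nat.div2_val]
    cases x (k + j)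
    · simp
    · simp; omega

theorem iterate_div2_zero (j : ℕ) : Nat.div2^[j] 0 = 0 := by
  induction j with
  | zero => rfl
  | succ j ih => rw [Function.iterate_succ_apply]; exact ih

theorem computable_wordCode : Computable wordCode := by
  refine Primrec.to_comp ?_
  unfold wordCode
  refine Primrec.list_foldl (f := fun l : List Bool => l)
    (h := fun _ (p : ℕ × Bool) => 2 * p.1 + p.2.toNat) .id (.const 1) ?_
  refine Primrec.nat_add.comp (Primrec.nat_mul.comp (.const 2) (Primrec.fst.comp .snd)) ?_
  exact (Primrec.dom_finite Bool.toNat).comp (Primrec.snd.comp .snd)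

theorem exists_eval_dom_iff {e : ℕ → Option (List Bool)} (he : Computable e) :
    ∃ c : Nat.Partrec.Code, ∀ z, (c.eval z).Dom ↔ ∃ k l, e k = some l ∧ wordCode l = z := by
  let p : ℕ → ℕ → Bool := fun z k => decide ((e k).map wordCode = some z)
  have hp : Computable₂ p := by
    refine (Primrec.eq (α := Option ℕ)).decide.to_comp.comp ?_ ?_
    · exact Computable.option_map (he.comp .snd) (computable_wordCode.comp .snd)
    · exact Computable.option_some.comp .fst
  have hg : Partrec fun z => Nat.rfind (fun k => Part.some (p z k) : ℕ →. Bool) :=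
    Partrec.rfind hp.partrec₂
  obtain ⟨c, hc⟩ := Nat.Partrec.Code.exists_code.1 (Partrec.nat_iff.1 hg)
  refine ⟨c, fun z => ?_⟩
  rw [hc]
  refine Nat.rfind_dom.trans ?_
  simp [p]

/-- The words avoided by a `Π⁰₁` set can be detected by a primitive recursive test. -/
theorem exists_primrec_test {e : ℕ → Option (List Bool)} (he : Computable e) :
    ∃ χ : ℕ → ℕ, Primrec χ ∧ ∀ x, x ∈ avoids e ↔ ∀ k, χ (prefixCode x k) = 0 := by
  obtain ⟨c, hc⟩ := exists_eval_dom_iff he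
  let R : ℕ → ℕ → Prop := fun j z => (c.evaln z (Nat.div2^[j] z)).isSome = true
  have hR : PrimrecRel R := by
    have : Primrec fun a : ℕ × ℕ => Nat.Partrec.Code.evaln a.2 c (Nat.div2^[a.1] a.2) :=
      Nat.Partrec.Code.primrec_evaln.comp (((Primrec.snd).pair (.const c)).pair
        (Primrec.nat_iterate Primrec.fst Primrec.snd (Primrec.nat_div2.comp .snd).to₂))
    exact Primrec.primrecPred (p := fun a : ℕ × ℕ => R a.1 a.2) (by simpa [R] using Primrec.option_isSome.comp this)
  classical
  have hE : PrimrecPred fun z => ∃ j < z, R j z :=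
    hR.exists_lt.comp Primrec.id Primrec.id
  refine ⟨fun z => if ∃ j < z, R j z then 1 else 0, Primrec.ite hE (.const 1) (.const 0), fun x => ?_⟩
  simp only [ite_eq_right_iff, one_ne_zero, imp_false]
  constructor
  · rintro hx k ⟨j, hj, hR⟩
    obtain ⟨y, hy⟩ := Option.isSome_iff_exists.1 hR
    obtain ⟨m, l, hl, hlz⟩ := (hc _).1 (Part.dom_iff_mem.2 ⟨y, Nat.Partrec.Code.evaln_sound hy⟩)
    rcases le_total j k with hjk | hjk
    · obtain ⟨i, rfl⟩ := Nat.exists_eq_add_of_le' hjk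
      rw [iterate_div2_prefixCode, wordCode_eq_prefixCode_iff] at hlz
      exact hx l ⟨m, hl⟩ hlz.2
    · obtain ⟨i, rfl⟩ := Nat.exists_eq_add_of_le' hjk
      have e1 := iterate_div2_prefixCode x 0 k
      rw [zero_add] at e1
      have := wordCode_pos l
      have h2 : prefixCode x 0 = 1 := rfl
      rw [Function.iterate_add_apply, e1, h2] at hlz
      rcases i with _ | i
      · have h3 : l.length = 0 ∧ _ := (wordCode_eq_prefixCode_iff l x 0).1 hlz
        exact hx l ⟨m, hl⟩ h3.2
      · rw [Function.iterate_succ_apply, show Nat.div2 1 = 0 by decide, iterate_div2_zero] at hlz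
        omega
  · rintro h l ⟨m, hl⟩ hpre
    obtain ⟨y, hy⟩ := Part.dom_iff_mem.1 ((hc _).2 ⟨m, l, hl, rfl⟩)
    obtain ⟨t, ht⟩ := Nat.Partrec.Code.evaln_complete.1 hy
    have h1 := le_prefixCode x (l.length + t)
    refine h (l.length + t) ⟨t, by omega, ?_⟩
    simp only [R]
    rw [iterate_div2_prefixCode, ← (wordCode_eq_prefixCode_iff l x l.length).2 ⟨rfl, hpre⟩]
    exact Option.isSome_iff_exists.2 ⟨y, Nat.Partrec.Code.evaln_mono (by omega) ht⟩

end PrimrecTest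

section LoopPrograms

open Function

/-- Programs over natural number registers: `loop r p` repeats `r -= 1; p` while `r > 0`. -/
inductive Prog : Type
  | skip : Prog
  | inc (r : ℕ) : Prog
  | seq (p q : Prog) : Prog
  | loop (r : ℕ) (p : Prog) : Prog

noncomputable instance : DecidableEq Prog := Classical.decEq _

/-- Big-step semantics of programs. -/
inductive Big : Prog → (ℕ → ℕ) → (ℕ → ℕ) → Prop
  | skip (v) : Big .skip v v
  | inc (r v) : Big (.inc r) v (update v r (v r + 1))
  | seq {p q v v' v''} : Big p v v' → Big q v' v'' → Big (.seq p q) v v''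
  | loop_zero {r p v} : v r = 0 → Big (.loop r p) v v
  | loop_succ {r p v k v' v''} : v r = k + 1 → Big p (update v r k) v' →
      Big (.loop r p) v' v'' → Big (.loop r p) v v''

theorem Big.congr {p : Prog} {v v' v'' : ℕ → ℕ} (h : Big p v v') (e : v' = v'') : Big p v v'' :=
  e ▸ h

theorem Big.loop_of_invariant {r : ℕ} {p : Prog} {n : ℕ} (I : ℕ → ℕ → ℕ)
    (hr : ∀ k ≤ n, I k r = k) (hp : ∀ k < n, Big p (update (I (k + 1)) r k) (I k)) :
    Big (.loop r p) (I n) (I 0) := by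
  induction n with
  | zero => exact .loop_zero (hr 0 le_rfl)
  | succ n ih =>
    exact .loop_succ (hr (n + 1) le_rfl) (hp n (Nat.lt_succ_self n))
      (ih (fun k hk => hr k (by omega)) fun k hk => hp k (by omega))

theorem big_clear (r : ℕ) (v : ℕ → ℕ) : Big (.loop r .skip) v (update v r 0) := by
  have := Big.loop_of_invariant (r := r) (p := .skip) (n := v r) (fun k => update v r k)
    (by simp) (fun k _ => (Big.skip _).congr (by simp))
  simpa using this

theorem big_move {a b : ℕ} (hab : a ≠ b) (v : ℕ → ℕ) :
    Big (.loop a (.inc b)) v (update (update v a 0) b (v b + v a)) := by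
  have := Big.loop_of_invariant (r := a) (p := .inc b) (n := v a)
    (fun k => update (update v a k) b (v b + (v a - k)))
    (by simp [hab]) (fun k hk => (Big.inc _ _).congr (by
      funext i
      simp only [update_apply]
      split_ifs <;> simp_all
      omega))
  simpa using this

theorem big_move_two {a b c : ℕ} (hab : a ≠ b) (hac : a ≠ c) (hbc : b ≠ c) (v : ℕ → ℕ) :
    Big (.loop a (.seq (.inc b) (.inc c))) v
      (update (update (update v a 0) b (v b + v a)) c (v c + v a)) := by
  have := Big.loop_of_invariant (r := a) (p := .seq (.inc b) (.inc c)) (n := v a)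
    (fun k => update (update (update v a k) b (v b + (v a - k))) c (v c + (v a - k)))
    (by simp [hab, hac]) (fun k hk => (Big.seq (Big.inc _ _) (Big.inc _ _)).congr (by
      funext i
      simp only [update_apply]
      split_ifs <;> simp_all <;> omega))
  simpa using this

/-- The program adding register `a` to register `b`, with `t` as an auxiliary register. -/
def Prog.copy (a b t : ℕ) : Prog := .seq (.loop a (.seq (.inc b) (.inc t))) (.loop t (.inc a))

theorem big_copy {a b t : ℕ} (hab : a ≠ b) (hat : a ≠ t) (hbt : b ≠ t) {v : ℕ → ℕ}
    (ht : v t = 0) : Big (.copy a b t) v (update v b (v b + v a)) := by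
  refine (Big.seq (big_move_two hab hat hbt v) (big_move hat.symm _)).congr ?_
  funext i
  simp only [update_apply]
  split_ifs <;> simp_all

/-- `f` can be computed by programs that leave all registers but the output unchanged. -/
def LoopComputes {n : ℕ} (f : List.Vector ℕ n → ℕ) : Prop :=
  ∀ (inp : Fin n → ℕ) (o s : ℕ), (∀ i, inp i < s) → o < s → (∀ i, inp i ≠ o) →
    ∃ p, ∀ v : ℕ → ℕ, (∀ r ≥ s, v r = 0) → v o = 0 →
      Big p v (update v o (f (List.Vector.ofFn fun i => v (inp i))))

theorem exists_clear_range (s n : ℕ) :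
    ∃ p, ∀ v : ℕ → ℕ, Big p v (fun r => if s ≤ r ∧ r < s + n then 0 else v r) := by
  induction n with
  | zero =>
    exact ⟨.skip, fun v => (Big.skip v).congr (by
      funext r; rw [if_neg (by omega)])⟩
  | succ n ih =>
    obtain ⟨p, hp⟩ := ih
    refine ⟨.seq p (.loop (s + n) .skip), fun v => ((hp v).seq (big_clear _ _)).congr ?_⟩
    funext r
    simp only [update_apply]
    split_ifs <;> first | rfl | omega

theorem LoopComputes.comp {m n : ℕ} {f : List.Vector ℕ n → ℕ} (g : Fin n → List.Vector ℕ m → ℕ)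
    (hf : LoopComputes f) (hg : ∀ i, LoopComputes (g i)) :
    LoopComputes fun a => f (List.Vector.ofFn fun i => g i a) := by
  intro inp o s hinp ho hne
  let val (v : ℕ → ℕ) (i : ℕ) : ℕ :=
    if h : i < n then g ⟨i, h⟩ (List.Vector.ofFn fun i => v (inp i)) else 0
  have step : ∀ j ≤ n, ∃ p, ∀ v : ℕ → ℕ, (∀ r ≥ s, v r = 0) →
      Big p v (fun r => if s ≤ r ∧ r < s + j then val v (r - s) else v r) := by
    intro j
    induction j with
    | zero =>
      exact fun _ => ⟨.skip, fun v _ => (Big.skip v).congr (by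
        funext r; rw [if_neg (by omega)])⟩
    | succ j ih =>
      intro hj
      obtain ⟨p, hp⟩ := ih (by omega)
      obtain ⟨q, hq⟩ := hg ⟨j, hj⟩ inp (s + j) (s + n) (fun i => (hinp i).trans_le (by omega))
        (by omega) (fun i => by have := hinp i; omega)
      refine ⟨.seq p q, fun v hv => ((hp v hv).seq (hq _ (fun r hr => ?_) ?_)).congr ?_⟩
      · rw [if_neg (by omega)]; exact hv r (by omega)
      · rw [if_neg (by omega)]; exact hv _ (by omega)
      · funext r
        have e : ∀ i, (if s ≤ inp i ∧ inp i < s + j then val v (inp i - s) else v (inp i)) =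
            v (inp i) := fun i => if_neg (by have := hinp i; omega)
        simp only [e, update_apply]
        split_ifs <;> first | rfl | omega | skip
        subst r
        simp [val, show j < n by omega]
  obtain ⟨p, hp⟩ := step n le_rfl
  obtain ⟨q, hq⟩ := hf (fun i => s + i) o (s + n) (fun i => by omega) (by omega) (fun i => by omega)
  obtain ⟨c, hc⟩ := exists_clear_range s n
  refine ⟨.seq p (.seq q c), fun v hv hvo =>
    ((hp v hv).seq ((hq _ (fun r hr => ?_) ?_).seq (hc _))).congr ?_⟩
  · rw [if_neg (by omega)]; exact hv r (by omega)
  · rw [if_neg (by omega)]; exact hvo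
  · funext r
    have e : ∀ i : Fin n, (if s ≤ s + (i : ℕ) ∧ s + (i : ℕ) < s + n then val v (s + i - s)
        else v (s + i)) = g i (List.Vector.ofFn fun i => v (inp i)) := fun i => by
      rw [if_pos (by omega)]; simp [val]
    simp only [e, update_apply]
    split_ifs with h1 h2 h3 <;> first | rfl | omega | skip
    exact (hv r h1.1).symm

theorem LoopComputes.prec {n : ℕ} {f : List.Vector ℕ n → ℕ} {g : List.Vector ℕ (n + 2) → ℕ}
    (hf : LoopComputes f) (hg : LoopComputes g) :
    LoopComputes fun v : List.Vector ℕ (n + 1) =>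
      v.head.rec (f v.tail) fun y IH => g (y ::ᵥ IH ::ᵥ v.tail) := by
  intro inp o s hinp ho hne
  obtain ⟨p, hp⟩ := hf (fun i => inp i.succ) o (s + 3) (fun i => (hinp _).trans (by omega))
    (by omega) (fun i => hne _)
  obtain ⟨q, hq⟩ := hg (Fin.cons (s + 1) (Fin.cons o fun i => inp i.succ)) (s + 2) (s + 3)
    (fun i => by
      refine Fin.cases ?_ (fun i => Fin.cases ?_ (fun i => ?_) i) i
      · simp
      · simp only [Fin.cons_succ, Fin.cons_zero]; omega
      · simp only [Fin.cons_succ]; have := hinp i.succ; omega)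
    (by omega)
    (fun i => by
      refine Fin.cases ?_ (fun i => Fin.cases ?_ (fun i => ?_) i) i
      · simp
      · simp only [Fin.cons_succ, Fin.cons_zero]; omega
      · simp only [Fin.cons_succ]; have := hinp i.succ; omega)
  let body : Prog := .seq q (.seq (.loop o .skip) (.seq (.loop (s + 2) (.inc o)) (.inc (s + 1))))
  refine ⟨.seq (.copy (inp 0) s (s + 3)) (.seq p (.seq (.loop s body) (.loop (s + 1) .skip))),
    fun v hv hvo => ?_⟩
  set x := v (inp 0) with hx
  let F : ℕ → ℕ := fun k => Nat.rec (f (List.Vector.ofFn fun i => v (inp i.succ)))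
    (fun y IH => g (y ::ᵥ IH ::ᵥ (List.Vector.ofFn fun i => v (inp i.succ)))) k
  let I : ℕ → ℕ → ℕ := fun k => update (update (update v s k) (s + 1) (x - k)) o (F (x - k))
  have hlt : ∀ i, inp i ≠ s ∧ inp i ≠ s + 1 ∧ inp i ≠ s + 2 ∧ inp i ≠ s + 3 ∧ inp i ≠ o := fun i => by
    have := hinp i; have := hne i; omega
  have h1 : Big (.copy (inp 0) s (s + 3)) v (update v s x) :=
    (big_copy (hlt 0).1 (hlt 0).2.2.2.1 (by omega) (hv _ (by omega))).congr (by
      rw [hv s le_rfl, zero_add])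
  have h2 : Big p (update v s x) (I x) := by
    refine (hp _ (fun r hr => ?_) ?_).congr ?_
    · rw [update_of_ne (by omega)]; exact hv r (by omega)
    · rw [update_of_ne (by omega)]; exact hvo
    · funext r
      simp only [I, update_apply, (hlt _).1, F, Nat.sub_self, if_false]
      split_ifs <;> first | rfl | omega | skip
      subst r; exact hv _ (by omega)
  have h3 : Big (.loop s body) (I x) (I 0) := by
    refine Big.loop_of_invariant I (fun k _ => ?_) fun k hk => ?_
    · simp only [I]; rw [update_of_ne (by omega), update_of_ne (by omega), update_self]
    · have hq' := hq (update (I (k + 1)) s k) (fun r hr => ?_) ?_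
      · refine (hq'.seq ((big_clear o _).seq
          ((big_move (by omega : s + 2 ≠ o) _).seq (Big.inc (s + 1) _)))).congr ?_
        have e : (List.Vector.ofFn fun i => update (I (k + 1)) s k ((Fin.cons (s + 1)
            (Fin.cons o fun i => inp i.succ) : Fin (n + 2) → ℕ) i)) =
            (x - (k + 1)) ::ᵥ F (x - (k + 1)) ::ᵥ (List.Vector.ofFn fun i => v (inp i.succ)) := by
          rw [List.Vector.ofFn, List.Vector.ofFn]
          simp only [Fin.cons_zero, Fin.cons_succ, I]
          congr 1
          · rw [update_of_ne (by omega), update_of_ne (by omega), update_self]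
          · congr 1
            · rw [update_of_ne (by omega), update_self]
            · congr 1
              funext i
              simp only [update_apply, hlt, if_false]
        rw [e]
        have e2 : g ((x - (k + 1)) ::ᵥ F (x - (k + 1)) ::ᵥ
            (List.Vector.ofFn fun i => v (inp i.succ))) = F (x - k) := by
          rw [show x - k = x - (k + 1) + 1 by omega]
        rw [e2]
        funext r
        simp only [I, update_apply]
        split_ifs <;> first | omega | rfl | skip
        subst r; exact (hv _ (by omega)).symm
      · simp only [I, update_apply]
        rw [if_neg (by omega), if_neg (by omega), if_neg (by omega), if_neg (by omega)]
        exact hv r (by omega)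
      · simp only [I, update_apply]
        rw [if_neg (by omega), if_neg (by omega), if_neg (by omega), if_neg (by omega)]
        exact hv _ (by omega)
  refine (h1.seq (h2.seq (h3.seq (big_clear _ _)))).congr ?_
  funext r
  simp only [I, update_apply]
  split_ifs with h4 h5 h6 <;> first | omega | skip
  · subst r; exact (hv _ (by omega)).symm
  · simp only [F, Nat.sub_zero, List.Vector.ofFn]; rfl
  · subst r; exact (hv _ (by omega)).symm

theorem loopComputes_of_primrec {n : ℕ} {f : List.Vector ℕ n → ℕ} (hf : Nat.Primrec' f) :
    LoopComputes f := by
  induction hf with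
  | zero =>
    intro inp o s hinp ho hne
    exact ⟨.skip, fun v _ hvo => (Big.skip v).congr (update_eq_self_iff.2 hvo.symm).symm⟩
  | succ =>
    intro inp o s hinp ho hne
    have := hinp 0
    refine ⟨.seq (.copy (inp 0) o s) (.inc o), fun v hv hvo =>
      ((big_copy (hne 0) (by omega) (by omega) (hv s le_rfl)).seq (Big.inc _ _)).congr ?_⟩
    simp [hvo, List.Vector.ofFn]
  | @get n i =>
    intro inp o s hinp ho hne
    have := hinp i
    refine ⟨.copy (inp i) o s, fun v hv hvo =>
      (big_copy (hne i) (by omega) (by omega) (hv s le_rfl)).congr ?_⟩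
    simp [hvo]
  | comp g _ _ hf hg => exact hf.comp g hg
  | prec _ _ hf hg => exact hf.prec hg

/-- A program reading a bit `b` (replacing `z` by `2 z + b`) and running a test on the result. -/
theorem exists_test_prog {χ : ℕ → ℕ} (hχ : Primrec χ) (b : Bool) :
    ∃ p, ∀ z, Big p (update 0 0 z) (update (update 0 0 (2 * z + b.toNat)) 1 (χ (2 * z + b.toNat))) := by
  obtain ⟨p, hp⟩ := loopComputes_of_primrec (Nat.Primrec'.prim_iff₁.2 hχ) (fun _ => 0) 1 2
    (by simp) (by simp) (by simp)
  obtain ⟨u, hu⟩ : ∃ u, ∀ v, Big u v (update v 0 (v 0 + b.toNat)) := by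
    cases b
    · exact ⟨.skip, fun v => (Big.skip v).congr (by simp)⟩
    · exact ⟨.inc 0, fun v => Big.inc 0 v⟩
  let d : Prog := .seq (.loop 0 (.seq (.inc 2) (.inc 3))) (.seq (.loop 2 (.inc 0)) (.loop 3 (.inc 0)))
  have hd : ∀ z, Big d (update 0 0 z) (update 0 0 (2 * z)) := fun z =>
    ((big_move_two (by simp) (by simp) (by simp) _).seq
      ((big_move (by simp) _).seq (big_move (by simp) _))).congr (by
        funext r
        simp only [update_apply, Pi.zero_apply]
        split_ifs <;> first | omega | simp_all)
  refine ⟨.seq d (.seq u p), fun z => (hd z).seq ((hu _).seq ((hp _ ?_ ?_).congr ?_))⟩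
  · intro r hr
    simp only [update_apply, Pi.zero_apply]
    rw [if_neg (by omega), if_neg (by omega)]
  · simp
  · simp [List.Vector.ofFn]

end LoopPrograms

section Runs

open Function Topology Filter

/-- A labelled transition system with a partial choice of a bit attached to each label. -/
structure ChoiceSystem (C ι : Type) where
  enabled : C → ι → Prop
  apply : ι → C → C
  choice : ι → Option Bool
  start : C

namespace ChoiceSystem

variable {C ι : Type} (M : ChoiceSystem C ι)

/-- Configurations augmented with the number of choices made so far. -/
def next (l : ι) (a : C × ℕ) : C × ℕ :=
  (M.apply l a.1, a.2 + if (M.choice l).isSome then 1 else 0)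

/-- The augmented configurations along a sequence of labels. -/
def trace (σ : ℕ → ι) : ℕ → C × ℕ
  | 0 => (M.start, 0)
  | k + 1 => M.next (σ k) (trace σ k)

/-- The infinite runs of the system. -/
def runs : Set (ℕ → ι) := {σ | ∀ k, M.enabled (M.trace σ k).1 (σ k)}

/-- The label is enabled and compatible with the sequence of choices `x`. -/
def Allowed (x : ℕ → Bool) (a : C × ℕ) (l : ι) : Prop :=
  M.enabled a.1 l ∧ ∀ b, M.choice l = some b → x a.2 = b

/-- One step along the sequence of choices `x`. -/
def AStep (x : ℕ → Bool) (a a' : C × ℕ) : Prop := ∃ l, M.Allowed x a l ∧ a' = M.next l a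

/-- One step involving no choice. -/
def NStep (c c' : C) : Prop := ∃ l, M.choice l = none ∧ M.enabled c l ∧ c' = M.apply l c

/-- The run follows the sequence of choices `x`. -/
def Follows (x : ℕ → Bool) (σ : ℕ → ι) : Prop := ∀ k, M.Allowed x (M.trace σ k) (σ k)

/-- At each configuration, at most one label is enabled for each choice. -/
def Deterministic : Prop := ∀ c l l', M.enabled c l → M.enabled c l' → l ≠ l' →
  ∃ b₁ b₂, M.choice l = some b₁ ∧ M.choice l' = some b₂ ∧ b₁ ≠ b₂

/-- The configurations in `Good z` are those in which the initial word with code `z` was read. -/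
def Tests (χ : ℕ → ℕ) (Good : ℕ → C → Prop) : Prop := ∀ z c b, Good z c → ∃ l d,
  M.choice l = some b ∧ M.enabled c l ∧ Relation.ReflTransGen M.NStep (M.apply l c) d ∧
  (χ (2 * z + b.toNat) = 0 → Good (2 * z + b.toNat) d) ∧
  (χ (2 * z + b.toNat) ≠ 0 → ∀ l, ¬ M.enabled d l)

variable {M}

theorem Deterministic.allowed_unique (h : M.Deterministic) {x : ℕ → Bool} {a : C × ℕ} {l l' : ι}
    (hl : M.Allowed x a l) (hl' : M.Allowed x a l') : l = l' := by
  by_contra hne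
  obtain ⟨b, b', hb, hb', hbb⟩ := h _ l l' hl.1 hl'.1 hne
  exact hbb ((hl.2 b hb).symm.trans (hl'.2 b' hb'))

theorem lift_nStep (x : ℕ → Bool) {c d : C} (m : ℕ) (h : Relation.ReflTransGen M.NStep c d) :
    Relation.ReflTransGen (M.AStep x) (c, m) (d, m) := by
  induction h with
  | refl => exact .refl
  | tail _ hs ih =>
    obtain ⟨l, hl, hen, rfl⟩ := hs
    exact ih.tail ⟨l, ⟨hen, by simp [hl]⟩, by simp [next, hl]⟩

theorem trace_congr {σ τ : ℕ → ι} {k : ℕ} (h : ∀ i < k, σ i = τ i) :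
    M.trace σ k = M.trace τ k := by
  induction k with
  | zero => rfl
  | succ k ih => rw [trace, trace, ih fun i hi => h i (by omega), h k (by omega)]

theorem Follows.unique (h : M.Deterministic) {x y : ℕ → Bool} {σ τ : ℕ → ι}
    (hσ : M.Follows x σ) (hτ : M.Follows y τ) {k : ℕ} (hxy : ∀ i ≤ k, x i = y i) : σ k = τ k := by
  have hle : ∀ j, (M.trace σ j).2 ≤ j := by
    intro j
    induction j with
    | zero => exact le_rfl
    | succ j ih => simp only [trace, next]; split_ifs <;> omega
  induction k using Nat.strong_induction_on with
  | _ k ih =>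
    have e : M.trace σ k = M.trace τ k :=
      trace_congr fun i hi => ih i hi fun j hj => hxy j (by omega)
    have h2 := hτ k
    rw [← e] at h2
    exact h.allowed_unique (hσ k) ⟨h2.1, fun b hb => (hxy _ (hle k)).trans (h2.2 b hb)⟩

theorem Follows.exists_trace_eq (h : M.Deterministic) {x : ℕ → Bool} {σ : ℕ → ι}
    (hσ : M.Follows x σ) {k : ℕ} {a : C × ℕ}
    (ha : Relation.ReflTransGen (M.AStep x) (M.trace σ k) a) : ∃ k', M.trace σ k' = a := by
  induction ha with
  | refl => exact ⟨k, rfl⟩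
  | tail _ hs ih =>
    obtain ⟨k', rfl⟩ := ih
    obtain ⟨l, hl, rfl⟩ := hs
    exact ⟨k' + 1, by rw [trace, h.allowed_unique hl (hσ k')]⟩

variable {χ : ℕ → ℕ} {Good : ℕ → C → Prop}

theorem Follows.exists_good (h : M.Deterministic) (ht : M.Tests χ Good) (h0 : Good 1 M.start)
    (hχ : χ 1 = 0) {x : ℕ → Bool} {σ : ℕ → ι} (hσ : M.Follows x σ) (m : ℕ) :
    χ (prefixCode x m) = 0 ∧ ∃ k d, M.trace σ k = (d, m) ∧ Good (prefixCode x m) d := by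
  induction m with
  | zero => exact ⟨hχ, 0, M.start, rfl, h0⟩
  | succ m ih =>
    obtain ⟨-, k, d, hk, hd⟩ := ih
    obtain ⟨l, d', hl, hen, hpath, hg, hdead⟩ := ht _ d (x m) hd
    have hall : M.Allowed x (M.trace σ k) l := by
      rw [hk]; exact ⟨hen, fun b hb => by simpa [hl] using hb⟩
    have e := h.allowed_unique hall (hσ k)
    have e2 : M.trace σ (k + 1) = (M.apply l d, m + 1) := by
      rw [trace, ← e, hk]; simp [next, hl]
    have hp := lift_nStep x (m + 1) hpath
    rw [← e2] at hp
    obtain ⟨k', hk'⟩ := hσ.exists_trace_eq h hp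
    have hz : χ (prefixCode x (m + 1)) = 0 := by
      by_contra hne
      have := (hσ k').1
      rw [hk'] at this
      exact hdead hne _ this
    exact ⟨hz, k', d', hk', hg hz⟩

theorem exists_follows (ht : M.Tests χ Good) (h0 : Good 1 M.start)
    {x : ℕ → Bool} (hx : ∀ k, χ (prefixCode x k) = 0) : ∃ σ, M.Follows x σ := by
  let P : C × ℕ → Prop := fun a =>
    ∃ d m, Good (prefixCode x m) d ∧ Relation.ReflTransGen (M.AStep x) a (d, m)
  have hP : ∀ a, P a → ∃ l, M.Allowed x a l ∧ P (M.next l a) := by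
    rintro a ⟨d, m, hd, hpath⟩
    rcases Relation.ReflTransGen.cases_head hpath with rfl | ⟨a', ⟨l, hl, rfl⟩, hpath'⟩
    · obtain ⟨l, d', hl, hen, hpath, hg, -⟩ := ht _ d (x m) hd
      refine ⟨l, ⟨hen, fun b hb => by simpa [hl] using hb⟩, d', m + 1, hg (hx (m + 1)), ?_⟩
      have := lift_nStep x (m + 1) hpath
      simpa [next, hl] using this
    · exact ⟨l, hl, d, m, hd, hpath'⟩
  have : Nonempty ι := ⟨(ht _ _ true h0).choose⟩
  choose! f hf hf' using hP
  let s : ℕ → C × ℕ := fun k => Nat.rec (M.start, 0) (fun _ a => M.next (f a) a) k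
  have hs : ∀ k, P (s k) := by
    intro k
    induction k with
    | zero => exact ⟨M.start, 0, h0, .refl⟩
    | succ k ih => exact hf' _ ih
  have e : ∀ k, M.trace (fun k => f (s k)) k = s k := by
    intro k
    induction k with
    | zero => rfl
    | succ k ih => rw [trace, ih]
  exact ⟨fun k => f (s k), fun k => by rw [e]; exact hf _ (hs k)⟩

theorem exists_choices {σ : ℕ → ι} (hσ : σ ∈ M.runs) : ∃ x, M.Follows x σ := by
  classical
  have hmono : Monotone fun k => (M.trace σ k).2 := monotone_nat_of_le_succ fun k => by
    simp only [trace, next]; omega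
  have hlt : ∀ k k', k < k' → (M.choice (σ k)).isSome → (M.trace σ k).2 < (M.trace σ k').2 := by
    intro k k' hk hc
    refine lt_of_lt_of_le ?_ (hmono (Nat.succ_le_of_lt hk))
    simp [trace, next, hc]
  refine ⟨fun n => decide (∃ k, (M.trace σ k).2 = n ∧ M.choice (σ k) = some true),
    fun k => ⟨hσ k, fun b hb => ?_⟩⟩
  cases b
  · simp only [decide_eq_false_iff_not]
    rintro ⟨k', hk', hc⟩
    rcases lt_trichotomy k k' with h | rfl | h
    · exact absurd (hlt k k' h (by simp [hb])) (by omega)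
    · simp [hb] at hc
    · exact absurd (hlt k' k h (by simp [hc])) (by omega)
  · simp only [decide_eq_true_eq]
    exact ⟨k, rfl, hb⟩

/-- The runs of a deterministic system testing its choices are parametrized by the sequences
passing the test. -/
theorem exists_parametrization [TopologicalSpace ι] (h : M.Deterministic)
    (ht : M.Tests χ Good) (h0 : Good 1 M.start) (hχ : χ 1 = 0) {S : Set (ℕ → Bool)}
    (hS : ∀ x, x ∈ S ↔ ∀ k, χ (prefixCode x k) = 0) :
    ∃ Φ : (ℕ → Bool) → ℕ → ι, ContinuousOn Φ S ∧ Set.InjOn Φ S ∧ Φ '' S = M.runs := by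
  have hex : ∀ x, x ∈ S → ∃ σ, M.Follows x σ := fun x hx => exists_follows ht h0 ((hS x).1 hx)
  have : Nonempty ι := ⟨(ht _ _ true h0).choose⟩
  choose! Φ hΦ using hex
  refine ⟨Φ, ?_, ?_, ?_⟩
  · refine continuousOn_pi.2 fun k x hx => ?_
    refine tendsto_const_nhds.congr' ?_
    have hU : {y : ℕ → Bool | ∀ i ∈ Set.Iic k, y i = x i} ∈ 𝓝 x := by
      have := set_pi_mem_nhds (Set.finite_Iic k) (s := fun i => {x i}) (x := x)
        fun i _ => (isOpen_discrete _).mem_nhds rfl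
      exact this
    filter_upwards [mem_nhdsWithin_of_mem_nhds hU, self_mem_nhdsWithin] with y hy hyS
    exact ((hΦ y hyS).unique h (hΦ x hx) hy).symm
  · intro x hx y hy hxy
    have h1 := hΦ x hx
    have h2 := hΦ y hy
    rw [← hxy] at h2
    funext m
    obtain ⟨-, k, d, hk, hd⟩ := h1.exists_good h ht h0 hχ m
    obtain ⟨l, d', hl, hen, -⟩ := ht _ d (x m) hd
    have hall : M.Allowed x (M.trace (Φ x) k) l := by
      rw [hk]; exact ⟨hen, fun b hb => by simpa [hl] using hb⟩
    have e := h.allowed_unique hall (h1 k)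
    have := (h2 k).2 (x m) (by rw [← e, hl])
    rw [hk] at this
    exact this.symm
  · ext σ
    constructor
    · rintro ⟨x, hx, rfl⟩
      exact fun k => (hΦ x hx k).1
    · intro hσ
      obtain ⟨x, hx⟩ := exists_choices hσ
      have hxS : x ∈ S := (hS x).2 fun k => (hx.exists_good h ht h0 hχ k).1
      exact ⟨x, hxS, funext fun k => (hΦ x hxS).unique h hx fun _ _ => rfl⟩

end ChoiceSystem

end Runs

section RegisterMachines

open Function Relation

/-- Register machines whose rules test registers for zero, decrement and increment them. -/
structure RegMachine (Q ι : Type) where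
  src : ι → Q
  tgt : ι → Q
  zero : ι → Finset ℕ
  dec : ι → Finset ℕ
  add : ι → ℕ →₀ ℕ

/-- The transition system of a register machine. -/
def RegMachine.system {Q ι : Type} (M : RegMachine Q ι) (choice : ι → Option Bool)
    (start : Q × (ℕ → ℕ)) : ChoiceSystem (Q × (ℕ → ℕ)) ι where
  enabled c l := M.src l = c.1 ∧ (∀ r ∈ M.zero l, c.2 r = 0) ∧ ∀ r ∈ M.dec l, 0 < c.2 r
  apply l c := (M.tgt l, fun r => c.2 r - (if r ∈ M.dec l then 1 else 0) + M.add l r)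
  choice := choice
  start := start

/-- Rules with the same target can be told apart by testing a register for zero afterwards. -/
def RegMachine.BackDet {Q ι : Type} (M : RegMachine Q ι) : Prop :=
  ∀ i j, i ≠ j → M.tgt i = M.tgt j → ∃ r, (r ∈ M.zero i ∧ M.add i r = 0 ∧ 0 < M.add j r) ∨
    (r ∈ M.zero j ∧ M.add j r = 0 ∧ 0 < M.add i r)

namespace ProgMachine

/-- The guard and the effect of a step of a program, together with the next continuation.
Registers are shifted by two. -/
structure Rule where
  zero : Finset ℕ
  dec : Finset ℕ
  add : ℕ →₀ ℕ
  next : List Prog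

/-- The two rules attached to each continuation. -/
noncomputable def rule (body : Bool → Prog) : List Prog → Bool → Rule
  | [], b => ⟨{3}, ∅, 0, [body b]⟩
  | .skip :: k, false => ⟨∅, ∅, 0, k⟩
  | .inc r :: k, false => ⟨∅, ∅, Finsupp.single (r + 2) 1, k⟩
  | .seq p q :: k, false => ⟨∅, ∅, 0, p :: q :: k⟩
  | .loop r _ :: k, false => ⟨{r + 2}, ∅, 0, k⟩
  | .loop r p :: k, true => ⟨∅, {r + 2}, 0, p :: .loop r p :: k⟩
  | _, true => ⟨{2}, {2}, 0, []⟩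

/-- The continuations met when running a program, except for the last one. -/
noncomputable def reach : Prog → List Prog → Finset (List Prog)
  | .skip, k => {.skip :: k}
  | .inc r, k => {.inc r :: k}
  | .seq p q, k => {.seq p q :: k} ∪ (reach p (q :: k) ∪ reach q k)
  | .loop r p, k => {.loop r p :: k} ∪ reach p (.loop r p :: k)

theorem cons_mem_reach (p : Prog) (k : List Prog) : p :: k ∈ reach p k := by
  cases p <;> simp [reach]

/-- All continuations met by the machine. -/
noncomputable def conts (body : Bool → Prog) : Finset (List Prog) :=
  {[]} ∪ (reach (body false) [] ∪ reach (body true) [])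

theorem nil_mem_conts (body : Bool → Prog) : [] ∈ conts body := by simp [conts]

theorem reach_subset_conts (body : Bool → Prog) (b : Bool) : reach (body b) [] ⊆ conts body := by
  intro k hk
  cases b <;> simp [conts, hk]

/-- States of the machine: `main` states, and states for recording the last step in register `0`
with the help of register `1`. -/
inductive State (K : ℕ) : Type
  | main (k : List Prog)
  | drain (k : List Prog) (b : Bool)
  | back (k : List Prog) (j : ZMod K)

/-- Rules of the machine. -/
inductive Label (D : Finset (List Prog)) (K : ℕ) : Type
  | fire (i : D × Bool)
  | drain (i : D × Bool)
  | digit (i : D × Bool)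
  | back (i : D × ZMod K)
  | done (k : D)

instance (D : Finset (List Prog)) (K : ℕ) [NeZero K] : Finite (Label D K) :=
  Finite.of_surjective (α := (D × Bool) ⊕ (D × Bool) ⊕ (D × Bool) ⊕ (D × ZMod K) ⊕ D)
    (Sum.elim .fire (Sum.elim .drain (Sum.elim .digit (Sum.elim .back .done)))) (by
      rintro (i | i | i | i | k)
      · exact ⟨.inl i, rfl⟩
      · exact ⟨.inr (.inl i), rfl⟩
      · exact ⟨.inr (.inr (.inl i)), rfl⟩
      · exact ⟨.inr (.inr (.inr (.inl i))), rfl⟩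
      · exact ⟨.inr (.inr (.inr (.inr k))), rfl⟩)

variable (body : Bool → Prog)

/-- The number of rules of the program. -/
noncomputable abbrev size : ℕ := Fintype.card (conts body × Bool)

instance : NeZero (size body) := by
  have : Nonempty (conts body × Bool) := ⟨⟨[], nil_mem_conts body⟩, true⟩
  exact ⟨Fintype.card_ne_zero⟩

/-- The digit recorded for a rule. -/
noncomputable def digit (i : conts body × Bool) : ℕ := Fintype.equivFin _ i

theorem digit_lt (i : conts body × Bool) : digit body i < size body :=
  (Fintype.equivFin (conts body × Bool) i).is_lt

theorem digit_injective {i j : conts body × Bool}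
    (h : (digit body i : ZMod (size body)) = digit body j) : i = j := by
  rw [ZMod.natCast_eq_natCast_iff', Nat.mod_eq_of_lt (digit_lt body i),
    Nat.mod_eq_of_lt (digit_lt body j)] at h
  exact (Fintype.equivFin _).injective (Fin.ext h)

/-- The register machine running the program and recording its history. -/
noncomputable def machine : RegMachine (State (size body)) (Label (conts body) (size body)) where
  src
    | .fire i => .main i.1
    | .drain i => .drain i.1 i.2
    | .digit i => .drain i.1 i.2
    | .back i => .back i.1 i.2
    | .done k => .back k 0
  tgt
    | .fire i => .drain i.1 i.2
    | .drain i => .drain i.1 i.2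
    | .digit i => .back (rule body i.1 i.2).next (digit body i)
    | .back i => .back i.1 (i.2 - 1)
    | .done k => .main k
  zero
    | .fire i => insert 1 (rule body i.1 i.2).zero
    | .drain _ => ∅
    | .digit _ => {0}
    | .back _ => ∅
    | .done _ => {1}
  dec
    | .fire i => (rule body i.1 i.2).dec
    | .drain _ => {0}
    | .digit _ => ∅
    | .back _ => {1}
    | .done _ => ∅
  add
    | .fire i => (rule body i.1 i.2).add
    | .drain _ => Finsupp.single 1 (size body)
    | .digit i => Finsupp.single 1 (digit body i)
    | .back _ => Finsupp.single 0 1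
    | .done _ => 0

/-- The bit chosen by a rule. -/
def choice : Label (conts body) (size body) → Option Bool
  | .fire (⟨[], _⟩, b) => some b
  | _ => none

/-- The transition system of the machine, starting with register `2` equal to `1`. -/
noncomputable def sys : ChoiceSystem (State (size body) × (ℕ → ℕ)) (Label (conts body) (size body)) :=
  (machine body).system (choice body) (.main [], Finsupp.single 2 1)

theorem rule_add_one (k : List Prog) (b : Bool) : (rule body k b).add 1 = 0 := by
  unfold rule
  split <;> simp

theorem exists_zero_dec (p : Prog) (k : List Prog) {a b : Bool} (hab : a ≠ b) :
    ∃ r, (r ∈ (rule body (p :: k) a).zero ∨ r ∈ (rule body (p :: k) b).zero) ∧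
      (r ∈ (rule body (p :: k) a).dec ∨ r ∈ (rule body (p :: k) b).dec) := by
  cases p with
  | loop r p =>
    refine ⟨r + 2, ?_⟩
    cases a <;> cases b <;> first | exact absurd rfl hab | simp [rule]
  | _ =>
    refine ⟨2, ?_⟩
    cases a <;> cases b <;> first | exact absurd rfl hab | simp [rule]

theorem machine_backDet : (machine body).BackDet := by
  have h1 : ∀ i j : conts body × Bool, (machine body).tgt (.fire i) = (machine body).tgt (.fire j) →
      i = j := by
    intro i j h
    simp only [machine, State.drain.injEq] at h
    exact Prod.ext (Subtype.ext h.1) h.2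
  have hK : 0 < size body := Nat.pos_of_ne_zero (NeZero.ne _)
  intro l l' hne h
  rcases l with i | i | i | i | k <;> rcases l' with j | j | j | j | k' <;>
    first
    | (simp only [machine, reduceCtorEq] at h; done)
    | skip
  · exact absurd (congrArg _ (h1 i j h)) hne
  · refine ⟨1, Or.inl ⟨by simp [machine], rule_add_one body _ _, ?_⟩⟩
    simpa [machine] using hK
  · refine ⟨1, Or.inr ⟨by simp [machine], rule_add_one body _ _, ?_⟩⟩
    simpa [machine] using hK
  · exact absurd (congrArg _ (h1 i j h)) hne
  · simp only [machine, State.back.injEq] at h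
    exact absurd (congrArg _ (digit_injective body h.2)) hne
  · exact ⟨0, Or.inl ⟨by simp [machine], by simp [machine], by simp [machine]⟩⟩
  · exact ⟨0, Or.inr ⟨by simp [machine], by simp [machine], by simp [machine]⟩⟩
  · simp only [machine, State.back.injEq, sub_left_inj] at h
    exact absurd (congrArg _ (Prod.ext (Subtype.ext h.1) h.2)) hne
  · simp only [machine, State.main.injEq] at h
    exact absurd (congrArg _ (Subtype.ext h)) hne

theorem sys_deterministic : (sys body).Deterministic := by
  rintro c l l' ⟨s1, z1, d1⟩ ⟨s2, z2, d2⟩ hne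
  have h := s1.trans s2.symm
  rcases l with i | i | i | i | k <;> rcases l' with j | j | j | j | k' <;>
    first
    | (simp only [machine, reduceCtorEq] at h; done)
    | skip
  · obtain ⟨⟨i, hi⟩, a⟩ := i
    obtain ⟨⟨j, hj⟩, b⟩ := j
    simp only [machine, State.main.injEq] at h
    subst h
    have hab : a ≠ b := by rintro rfl; exact hne rfl
    rcases i with _ | ⟨p, k⟩
    · exact ⟨a, b, rfl, rfl, hab⟩
    · obtain ⟨r, hz, hd⟩ := exists_zero_dec body p k hab
      have h0 : c.2 r = 0 := hz.elim (fun h => z1 r (Finset.mem_insert_of_mem h))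
        fun h => z2 r (Finset.mem_insert_of_mem h)
      have h1 : 0 < c.2 r := hd.elim (d1 r) (d2 r)
      omega
  · simp only [machine, State.drain.injEq] at h
    exact absurd (congrArg _ (Prod.ext (Subtype.ext h.1) h.2)) hne
  · have h0 := z2 0 (by simp [machine])
    have h1 := d1 0 (by simp [machine])
    omega
  · have h0 := z1 0 (by simp [machine])
    have h1 := d2 0 (by simp [machine])
    omega
  · simp only [machine, State.drain.injEq] at h
    exact absurd (congrArg _ (Prod.ext (Subtype.ext h.1) h.2)) hne
  · simp only [machine, State.back.injEq] at h
    exact absurd (congrArg _ (Prod.ext (Subtype.ext h.1) h.2)) hne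
  · have h0 := z2 1 (by simp [machine])
    have h1 := d1 1 (by simp [machine])
    omega
  · have h0 := z1 1 (by simp [machine])
    have h1 := d2 1 (by simp [machine])
    omega
  · simp only [machine, State.back.injEq, and_true] at h
    exact absurd (congrArg _ (Subtype.ext h)) hne

variable {body}

theorem nStep_intro {l : Label (conts body) (size body)} {v v' : ℕ → ℕ} {q : State (size body)}
    (hl : choice body l = none) (hs : (machine body).src l = q)
    (hz : ∀ r ∈ (machine body).zero l, v r = 0) (hd : ∀ r ∈ (machine body).dec l, 0 < v r)
    (hv : ∀ r, v' r = v r - (if r ∈ (machine body).dec l then 1 else 0) + (machine body).add l r) :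
    (sys body).NStep (q, v) ((machine body).tgt l, v') :=
  ⟨l, hl, ⟨hs, hz, hd⟩, by rw [funext hv]; rfl⟩

theorem drain_path (i : conts body × Bool) (v : ℕ → ℕ) :
    ReflTransGen (sys body).NStep (.drain i.1 i.2, v)
      (.drain i.1 i.2, update (update v 0 0) 1 (v 1 + size body * v 0)) := by
  generalize hn : v 0 = n
  induction n generalizing v with
  | zero =>
    have : update (update v 0 0) 1 (v 1 + size body * 0) = v := by
      funext r
      rcases r with _ | _ | r <;> simp [hn]
    rw [this]
  | succ n ih =>
    refine ReflTransGen.head (nStep_intro (l := .drain i)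
      (v' := update (update v 0 n) 1 (v 1 + size body)) rfl rfl (by simp [machine])
      (by simp [machine, hn]) fun r => ?_) ?_
    · rcases r with _ | _ | r <;> simp [machine, hn]
    · convert ih (update (update v 0 n) 1 (v 1 + size body)) (by simp) using 2
      · rfl
      · funext r
        rcases r with _ | _ | r <;> simp
        ring

theorem back_path (k : conts body) (v : ℕ → ℕ) :
    ReflTransGen (sys body).NStep (.back k (v 1 : ZMod (size body)), v)
      (.back k 0, update (update v 1 0) 0 (v 0 + v 1)) := by
  generalize hn : v 1 = n
  induction n generalizing v with
  | zero =>
    have : update (update v 1 0) 0 (v 0 + 0) = v := by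
      funext r
      rcases r with _ | _ | r <;> simp [hn]
    rw [this, Nat.cast_zero]
  | succ n ih =>
    have hs := nStep_intro (l := .back (k, ((n + 1 : ℕ) : ZMod (size body)))) (v := v)
      (v' := update (update v 1 n) 0 (v 0 + 1)) rfl rfl (by simp [machine])
      (by simp [machine, hn]) fun r => by
        rcases r with _ | _ | r <;> simp [machine, hn]
    refine ReflTransGen.head hs ?_
    convert ih (update (update v 1 n) 0 (v 0 + 1)) (by simp) using 2
    · simp [machine]
    · funext r
      rcases r with _ | _ | r <;> simp
      ring

/-- The machine is in a main state, with registers described by `w`. -/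
def Sim (k : List Prog) (w : ℕ → ℕ) (c : State (size body) × (ℕ → ℕ)) : Prop :=
  c.1 = .main k ∧ c.2 1 = 0 ∧ ∀ r, c.2 (r + 2) = w r

theorem path_of_fired (i : conts body × Bool) (hn : (rule body i.1 i.2).next ∈ conts body)
    {v w : ℕ → ℕ} (h1 : v 1 = 0) (hw : ∀ r, v (r + 2) = w r) :
    ∃ c, ReflTransGen (sys body).NStep (.drain i.1 i.2, v) c ∧
      Sim (rule body i.1 i.2).next w c := by
  have p1 := drain_path i v
  set v1 := update (update v 0 0) 1 (v 1 + size body * v 0) with hv1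
  have p2 := nStep_intro (l := .digit i) (v := v1)
    (v' := update v1 1 (size body * v 0 + digit body i)) rfl rfl (by simp [machine, hv1])
    (by simp [machine]) fun r => by
      rcases r with _ | _ | r <;> simp [machine, hv1, h1]
  have p3 := back_path ⟨_, hn⟩ (update v1 1 (size body * v 0 + digit body i))
  have e : (((update v1 1 (size body * v 0 + digit body i)) 1 : ℕ) : ZMod (size body)) =
      digit body i := by
    rw [update_self, Nat.cast_add, Nat.cast_mul, ZMod.natCast_self, zero_mul, zero_add]
  rw [e] at p3
  have p4 := nStep_intro (l := .done ⟨_, hn⟩)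
    (v := update (update (update v1 1 (size body * v 0 + digit body i)) 1 0) 0
        (update v1 1 (size body * v 0 + digit body i) 0 +
          update v1 1 (size body * v 0 + digit body i) 1))
    (v' := update (update (update v1 1 (size body * v 0 + digit body i)) 1 0) 0
        (update v1 1 (size body * v 0 + digit body i) 0 +
          update v1 1 (size body * v 0 + digit body i) 1)) rfl rfl (by simp [machine])
    (by simp [machine]) fun r => by simp [machine]
  refine ⟨_, ((p1.tail p2).trans p3).tail p4, rfl, by simp, fun r => ?_⟩
  simp [hv1, hw]

theorem sim_step {k : List Prog} {b : Bool} (hk : k ∈ conts body) (hk0 : k ≠ [])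
    (hn : (rule body k b).next ∈ conts body) {w w' : ℕ → ℕ} {c} (h : Sim (body := body) k w c)
    (hz : ∀ r ∈ (rule body k b).zero, ∃ s, r = s + 2 ∧ w s = 0)
    (hd : ∀ r ∈ (rule body k b).dec, ∃ s, r = s + 2 ∧ 0 < w s)
    (hw : ∀ r, w' r = w r - (if r + 2 ∈ (rule body k b).dec then 1 else 0) +
      (rule body k b).add (r + 2)) :
    ∃ c', ReflTransGen (sys body).NStep c c' ∧ Sim (rule body k b).next w' c' := by
  obtain ⟨q, v⟩ := c
  obtain ⟨hq, h1, hv⟩ := h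
  have hq : q = .main k := hq
  have h1 : v 1 = 0 := h1
  have hv : ∀ r, v (r + 2) = w r := hv
  have p1 := nStep_intro (l := .fire (⟨k, hk⟩, b)) (v := v) (q := q)
    (v' := fun r => v r - (if r ∈ (rule body k b).dec then 1 else 0) + (rule body k b).add r)
    (by rcases k with _ | ⟨p, k⟩; exacts [absurd rfl hk0, rfl]) hq.symm (by
      intro r hr
      rcases Finset.mem_insert.1 hr with rfl | hr
      · exact h1
      · obtain ⟨s, rfl, hs⟩ := hz r hr
        rw [hv, hs]) (by
      intro r hr
      obtain ⟨s, rfl, hs⟩ := hd r hr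
      rwa [hv]) fun r => rfl
  obtain ⟨c', p2, hc'⟩ := path_of_fired (⟨k, hk⟩, b) hn (w := w')
    (v := fun r => v r - (if r ∈ (rule body k b).dec then 1 else 0) + (rule body k b).add r)
    (by
      have : 1 ∉ (rule body k b).dec := fun hr => by
        obtain ⟨s, hs, -⟩ := hd 1 hr
        omega
      simp [this, h1, rule_add_one]) (fun r => by simp only [hw, hv])
  exact ⟨c', p2.head p1, hc'⟩

theorem sim_big {p : Prog} {w w' : ℕ → ℕ} (h : Big p w w') {k : List Prog}
    (hp : reach p k ⊆ conts body) (hk : k ∈ conts body) {c} (hc : Sim (body := body) (p :: k) w c) :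
    ∃ c', ReflTransGen (sys body).NStep c c' ∧ Sim k w' c' := by
  induction h generalizing k c with
  | skip v =>
    exact sim_step (b := false) (hp (cons_mem_reach _ _)) (by simp) hk hc (by simp [rule])
      (by simp [rule]) (by simp [rule])
  | inc r v =>
    refine sim_step (b := false) (hp (cons_mem_reach _ _)) (by simp) hk hc (by simp [rule])
      (by simp [rule]) fun s => ?_
    by_cases hs : s = r
    · subst hs; simp [rule]
    · simp [rule, hs]
  | @seq p q v v' v'' _ _ ih1 ih2 =>
    have hp1 : reach p (q :: k) ⊆ conts body := fun x hx => hp (by simp [reach, hx])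
    have hp2 : reach q k ⊆ conts body := fun x hx => hp (by simp [reach, hx])
    obtain ⟨c1, hp1', hc1⟩ := sim_step (b := false) (w' := v) (hp (cons_mem_reach _ _)) (by simp)
      (hp1 (cons_mem_reach _ _)) hc (by simp [rule]) (by simp [rule]) (by simp [rule])
    obtain ⟨c2, hp2', hc2⟩ := ih1 hp1 (hp2 (cons_mem_reach _ _)) hc1
    obtain ⟨c3, hp3', hc3⟩ := ih2 hp2 hk hc2
    exact ⟨c3, (hp1'.trans hp2').trans hp3', hc3⟩
  | @loop_zero r p v hr =>
    exact sim_step (b := false) (hp (cons_mem_reach _ _)) (by simp) hk hc (by simpa [rule])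
      (by simp [rule]) (by simp [rule])
  | @loop_succ r p v n v' v'' hr _ _ ih1 ih2 =>
    have hl : Prog.loop r p :: k ∈ conts body := hp (cons_mem_reach _ _)
    have hp1 : reach p (.loop r p :: k) ⊆ conts body := fun x hx => hp (by simp [reach, hx])
    obtain ⟨c1, hp1', hc1⟩ := sim_step (b := true) (w' := update v r n) hl (by simp)
      (hp1 (cons_mem_reach _ _)) hc (by simp [rule]) (by simp [rule, hr]) fun s => by
        simp only [rule, update_apply]
        split_ifs <;> simp_all
    obtain ⟨c2, hp2', hc2⟩ := ih1 hp1 hl hc1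
    obtain ⟨c3, hp3', hc3⟩ := ih2 hp hk hc2
    exact ⟨c3, (hp1'.trans hp2').trans hp3', hc3⟩

theorem sys_tests {χ : ℕ → ℕ} (hbody : ∀ b z, Big (body b) (update 0 0 z)
      (update (update 0 0 (2 * z + b.toNat)) 1 (χ (2 * z + b.toNat)))) :
    (sys body).Tests χ fun z => Sim [] (update 0 0 z) := by
  rintro z ⟨q, v⟩ b ⟨hq, h1, hv⟩
  have hq : q = .main [] := hq
  have h1 : v 1 = 0 := h1
  have hv : ∀ r, v (r + 2) = update (0 : ℕ → ℕ) 0 z r := hv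
  have hmem := reach_subset_conts body b
  obtain ⟨c1, p1, hc1⟩ := path_of_fired (⟨[], nil_mem_conts body⟩, b)
    (hmem (cons_mem_reach _ _)) h1 hv
  obtain ⟨c2, p2, hc2⟩ := sim_big (hbody b z) hmem (nil_mem_conts body) hc1
  refine ⟨.fire (⟨[], nil_mem_conts body⟩, b), c2, rfl, ⟨hq.symm, ?_, by simp [machine, rule]⟩,
    ?_, fun h0 => ?_, fun h0 l hl => ?_⟩
  · simpa [machine, rule, h1] using hv 1
  · have e : (sys body).apply (.fire (⟨[], nil_mem_conts body⟩, b)) (q, v) = (.drain [] b, v) := by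
      simp [sys, RegMachine.system, machine, rule]
    rw [e]
    exact p1.trans p2
  · rwa [h0, update_eq_self_iff.2 (by simp)] at hc2
  · obtain ⟨q', v'⟩ := c2
    obtain ⟨hq', -, hv'⟩ := hc2
    obtain ⟨hs, hz, -⟩ := hl
    have := hs.trans hq'
    rcases l with ⟨⟨k, hk⟩, a⟩ | i | i | i | k <;>
      first
      | (simp only [machine, reduceCtorEq] at this; done)
      | skip
    simp only [machine, State.main.injEq] at this
    subst this
    have h3 := hz 3 (by simp [machine, rule])
    have h4 := hv' 1
    simp only [update_self] at h4
    exact h0 (h4.symm.trans h3)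

end ProgMachine

/-- Every primitive recursive test is performed by a reversible register machine. -/
theorem exists_regMachine {χ : ℕ → ℕ} (hχ : Primrec χ) (h1 : χ 1 = 0) {S : Set (ℕ → Bool)}
    (hS : ∀ x, x ∈ S ↔ ∀ k, χ (prefixCode x k) = 0) :
    ∃ (Q ι : Type) (_ : Finite ι) (M : RegMachine Q ι) (ch : ι → Option Bool) (q : Q) (v : ℕ →₀ ℕ),
      v ≠ 0 ∧ M.BackDet ∧ ∀ [TopologicalSpace ι], ∃ Φ : (ℕ → Bool) → ℕ → ι, ContinuousOn Φ S ∧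
        Set.InjOn Φ S ∧ Φ '' S = (M.system ch (q, v)).runs := by
  choose body hbody using exists_test_prog hχ
  refine ⟨_, _, inferInstance, ProgMachine.machine body, ProgMachine.choice body, .main [],
    Finsupp.single 2 1, by simp, ProgMachine.machine_backDet body, fun {_} => ?_⟩
  refine ChoiceSystem.exists_parametrization (ProgMachine.sys_deterministic body)
    (ProgMachine.sys_tests hbody) ⟨rfl, ?_, fun r => ?_⟩ h1 hS
  · change (Finsupp.single 2 1 : ℕ →₀ ℕ) 1 = 0
    simp
  · change (Finsupp.single 2 1 : ℕ →₀ ℕ) (r + 2) = _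
    rcases r with _ | r <;> simp

end RegisterMachines

section Geometry

open Function

/-- The data of the drawn computations: a sequence `n` of numbers starting at `seed` is multiplied by
`(B + C i) / B` at the steps labelled `i`, where `T` tells which label is allowed after the previous
label, depending on the residue of the current number. -/
structure Drawing (ι : Type) where
  B : ℕ
  seed : ℕ
  m : ℕ
  C : ι → ℕ
  T : Option ι → ZMod m → ι → Prop
  two_le_B : 2 ≤ B
  two_le_seed : 2 ≤ seed
  two_le_C : ∀ i, 2 ≤ C i
  m_pos : 0 < m
  T_unique : ∀ {a b r c}, T a r c → T b r c → a = b

namespace Drawing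

variable {ι : Type}

/-- The alphabet. -/
inductive Tile (G : Drawing ι) : Type
  | o
  | e
  | K
  | S (i : ℕ) (hi : i ≤ G.B * G.seed)
  | W
  | P (c : ι) (j : ℕ) (hj : j < G.C c)
  | a
  | b
  | h (c : Option ι) (r : ZMod G.m)
  | L (c : ι) (j : ℕ) (hj : j < G.C c) (r : ZMod G.m)
  | M (i : ℕ) (hi : i < G.B)
  | N (c : Option ι) (r : ZMod G.m) (d : ι)

open Tile

instance [Finite ι] (G : Drawing ι) : Finite G.Tile := by
  have : NeZero G.m := ⟨G.m_pos.ne'⟩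
  refine Finite.of_surjective (α := Fin 6 ⊕ Fin (G.B * G.seed + 1) ⊕ (Σ c, Fin (G.C c)) ⊕
    (Option ι × ZMod G.m) ⊕ ((Σ c, Fin (G.C c)) × ZMod G.m) ⊕ Fin G.B ⊕
    (Option ι × ZMod G.m × ι)) (Sum.elim ![o, e, K, W, a, b] (Sum.elim
    (fun i => S i (Nat.lt_succ_iff.1 i.2)) (Sum.elim (fun p => P p.1 p.2 p.2.2) (Sum.elim
    (fun p => h p.1 p.2) (Sum.elim (fun p => L p.1.1 p.1.2 p.1.2.2 p.2) (Sum.elim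
    (fun i => M i i.2) fun p => N p.1 p.2.1 p.2.2)))))) ?_
  rintro (_ | _ | _ | ⟨i, hi⟩ | _ | ⟨c, j, hj⟩ | _ | _ | ⟨c, r⟩ | ⟨c, j, hj, r⟩ | ⟨i, hi⟩ | ⟨c, r, d⟩)
  · exact ⟨.inl 0, rfl⟩
  · exact ⟨.inl 1, rfl⟩
  · exact ⟨.inl 2, rfl⟩
  · exact ⟨.inr (.inl ⟨i, Nat.lt_succ_iff.2 hi⟩), rfl⟩
  · exact ⟨.inl 3, rfl⟩
  · exact ⟨.inr (.inr (.inl ⟨c, j, hj⟩)), rfl⟩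
  · exact ⟨.inl 4, rfl⟩
  · exact ⟨.inl 5, rfl⟩
  · exact ⟨.inr (.inr (.inr (.inl (c, r)))), rfl⟩
  · exact ⟨.inr (.inr (.inr (.inr (.inl (⟨c, j, hj⟩, r))))), rfl⟩
  · exact ⟨.inr (.inr (.inr (.inr (.inr (.inl ⟨i, hi⟩))))), rfl⟩
  · exact ⟨.inr (.inr (.inr (.inr (.inr (.inr (c, r, d)))))), rfl⟩

variable {G : Drawing ι}

/-- The phase of a symbol on the line bounding the drawing on the right. -/
def phase : G.Tile → Option ℕ
  | M i _ => some i
  | N _ _ _ => some 0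
  | _ => none

/-- The symbols of the vertical axis. -/
def IsAxis : G.Tile → Prop
  | K | S _ _ | W | P _ _ _ => True
  | _ => False

/-- First symbols of the segments of a falling line. -/
def IsAnchor : G.Tile → Prop
  | L _ j _ _ | P _ j _ => j = 0
  | _ => False

/-- The rule for a symbol and the one on its right. -/
def HRule (s t : G.Tile) : Prop :=
  match s with
  | o => t = o ∨ IsAxis t
  | K | M _ _ | N _ _ _ | e => t = e
  | S i _ => (i < G.B ∧ t = e) ∨ (G.B ≤ i ∧ i < G.B * G.seed ∧ (t = b ∨ ∃ k hk, t = M k hk)) ∨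
      (i = G.B * G.seed ∧ t = h none 1)
  | W | a => t = a ∨ ∃ c j hj r, t = L c j hj r
  | P c j _ => (j + 1 < G.C c ∧ t = b) ∨ (j + 1 = G.C c ∧ t = h (some c) 1)
  | b | L _ _ _ _ => t = b ∨ ∃ k hk, t = M k hk
  | h c r => t = h c (r + 1) ∨ ∃ d, t = N c (r + 1) d

/-- The rule for a symbol and the one above it. -/
def VRule (s t : G.Tile) : Prop :=
  match s with
  | o => t = o
  | K => t = K ∨ ∃ hi, t = S 0 hi
  | S i _ => (∃ hi, t = S (i + 1) hi) ∨ (i = G.B * G.seed ∧ t = W)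
  | W => t = W ∨ ∃ c hj, t = P c 0 hj
  | P c j _ => (∃ hj, t = P c (j + 1) hj) ∨ (j + 1 = G.C c ∧ t = W)
  | a | h _ _ => t = a ∨ ∃ c hj r, t = L c 0 hj r
  | b => t = b ∨ ∃ c r, t = h c r
  | L c j _ r => (∃ hj, t = L c (j + 1) hj r) ∨ (j + 1 = G.C c ∧ t = b)
  | M i _ => (∃ hi, t = M (i + 1) hi) ∨ (i + 1 = G.B ∧ (t = b ∨ ∃ c r, t = h c r))
  | N _ _ _ => ∃ hi, t = M 1 hi
  | e => t = e ∨ phase t = some 0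

/-- The rule for a symbol and its upper left neighbour. -/
def NWRule (s t : G.Tile) : Prop :=
  match s with
  | L c j _ r => (j + 1 ≠ G.C c ∧ ¬ IsAnchor t) ∨ (j + 1 = G.C c ∧
      ((∃ hj, t = L c 0 hj (r - 1)) ∨ (r = 1 ∧ ∃ hj, t = P c 0 hj)))
  | N c r d => G.T c r d ∧ ∃ hj, t = L d 0 hj (r - 1)
  | _ => ¬ IsAnchor t

/-- The rule for a symbol and its upper right neighbour. -/
def NERule (s t : G.Tile) : Prop :=
  match s with
  | M i _ | S i _ => i + 1 = G.B ↔ phase t = some 0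
  | _ => phase t ≠ some 0

variable (G) in
/-- The subshift. -/
def space : Set (ℤ × ℤ → G.Tile) :=
  {x | ∀ i j, HRule (x (i, j)) (x (i + 1, j)) ∧ VRule (x (i, j)) (x (i, j + 1)) ∧
    NWRule (x (i, j)) (x (i - 1, j + 1)) ∧ NERule (x (i, j)) (x (i + 1, j + 1))}

/-! ### Determinism -/


theorem VRule.below {s n : G.Tile} (hv : VRule s n) :
    match n with
    | o => s = o
    | K | S 0 _ => s = K
    | S (i + 1) _ => ∃ hi, s = S i hi
    | W => s = W ∨ (∃ c j hj, j + 1 = G.C c ∧ s = P c j hj) ∨ ∃ hi, s = S (G.B * G.seed) hi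
    | P _ 0 _ => s = W
    | P c (j + 1) _ => ∃ hj, s = P c j hj
    | a | L _ 0 _ _ => s = a ∨ ∃ c r, s = h c r
    | b => s = b ∨ (∃ c j hj r, j + 1 = G.C c ∧ s = L c j hj r) ∨ ∃ i hi, i + 1 = G.B ∧ s = M i hi
    | h _ _ => s = b ∨ ∃ i hi, i + 1 = G.B ∧ s = M i hi
    | L c (j + 1) _ r => ∃ hj, s = L c j hj r
    | M 0 _ | N _ _ _ | e => s = e
    | M 1 _ => (∃ hi, s = M 0 hi) ∨ ∃ c r d, s = N c r d
    | M (i + 2) _ => ∃ hi, s = M (i + 1) hi := by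
  cases s <;> simp only [VRule] at hv
  case o => subst hv; rfl
  case e =>
    rcases hv with rfl | hv
    · rfl
    · cases n <;> simp only [phase, Option.some.injEq, reduceCtorEq] at hv
      · subst hv; rfl
      · rfl
  case K => rcases hv with rfl | ⟨hi, rfl⟩ <;> rfl
  case S => rcases hv with ⟨hi, rfl⟩ | ⟨rfl, rfl⟩ <;> simp <;> assumption
  case W => rcases hv with rfl | ⟨c, hj, rfl⟩ <;> simp
  case P => rcases hv with ⟨hj, rfl⟩ | ⟨hj, rfl⟩ <;> simp [hj] <;> assumption
  case a => rcases hv with rfl | ⟨c, hj, r, rfl⟩ <;> simp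
  case b => rcases hv with rfl | ⟨c, r, rfl⟩ <;> simp
  case h => rcases hv with rfl | ⟨c, hj, r, rfl⟩ <;> simp
  case L => rcases hv with ⟨hj, rfl⟩ | ⟨hj, rfl⟩ <;> simp [hj] <;> assumption
  case M i hi =>
    rcases hv with ⟨hj, rfl⟩ | ⟨hj, rfl | ⟨c, r, rfl⟩⟩
    · cases i <;> (simp; assumption)
    · simp [hj] ; assumption
    · simp [hj] ; assumption
  case N => obtain ⟨hi, rfl⟩ := hv; simp

theorem NWRule.of_L {s : G.Tile} {d hj r} (hw : NWRule s (L d 0 hj r)) :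
    (∃ j hj, j + 1 = G.C d ∧ s = L d j hj (r + 1)) ∨ ∃ c, G.T c (r + 1) d ∧ s = N c (r + 1) d := by
  cases s <;> simp only [NWRule, IsAnchor, not_true] at hw
  case L c j hj r =>
    obtain ⟨-, h⟩ | ⟨hj, ⟨_, h⟩ | ⟨_, _, h⟩⟩ := hw
    · exact h.elim
    · cases h; exact Or.inl ⟨j, by assumption, hj, by simp⟩
    · cases h
  case N c r d =>
    obtain ⟨hT, _, h⟩ := hw
    cases h; exact Or.inr ⟨c, by simpa using hT, by simp⟩

theorem NWRule.of_P {s : G.Tile} {d hj} (hw : NWRule s (P d 0 hj)) :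
    ∃ j hj, j + 1 = G.C d ∧ s = L d j hj 1 := by
  cases s <;> simp only [NWRule, IsAnchor, not_true] at hw
  case L c j hj r =>
    obtain ⟨-, h⟩ | ⟨hj, ⟨_, h⟩ | ⟨rfl, _, h⟩⟩ := hw
    · exact h.elim
    · cases h
    · cases h; exact ⟨j, _, hj, rfl⟩
  case N c r d =>
    obtain ⟨hT, _, h⟩ := hw
    cases h

theorem NERule.of_phase {s t : G.Tile} (he : NERule s t) (ht : phase t = some 0) :
    (∃ i hi, i + 1 = G.B ∧ s = M i hi) ∨ ∃ i hi, i + 1 = G.B ∧ s = S i hi := by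
  cases s <;> simp only [NERule] at he <;> first | exact absurd ht he | skip
  · exact Or.inr ⟨_, _, he.2 ht, rfl⟩
  · exact Or.inl ⟨_, _, he.2 ht, rfl⟩

theorem init_bound (G : Drawing ι) : G.B < G.B * G.seed := by
  nlinarith [G.two_le_B, G.two_le_seed]

theorem rule_det {s s' t n nw ne : G.Tile} (h1 : HRule s t) (h2 : VRule s n) (h3 : NWRule s nw)
    (h4 : NERule s ne) (h1' : HRule s' t) (h2' : VRule s' n) (h3' : NWRule s' nw)
    (h4' : NERule s' ne) : s = s' := by
  have hBn := G.init_bound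
  by_cases hw : IsAnchor nw
  · cases nw <;> simp only [IsAnchor] at hw
    case P c j hj =>
      subst hw
      obtain ⟨j, hj, hC, rfl⟩ := h3.of_P
      obtain ⟨j', hj', hC', rfl⟩ := h3'.of_P
      simp only [L.injEq, true_and, and_true]
      omega
    case L c j hj r =>
      subst hw
      rcases h3.of_L with ⟨j, hj, hC, rfl⟩ | ⟨c, hT, rfl⟩ <;>
      rcases h3'.of_L with ⟨j', hj', hC', rfl⟩ | ⟨c', hT', rfl⟩
      · simp only [L.injEq, true_and, and_true]
        omega
      · simp [HRule] at h1 h1'; simp [h1'] at h1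
      · simp [HRule] at h1 h1'; simp [h1] at h1'
      · rw [G.T_unique hT hT']
  have hL : ∀ {s : G.Tile}, NWRule s nw → ∀ c j hj r, s = L c j hj r → j + 1 ≠ G.C c := by
    rintro s h c j hj r rfl hC
    rcases h with ⟨h, -⟩ | ⟨-, ⟨hj, rfl⟩ | ⟨-, hj, rfl⟩⟩
    · exact h hC
    · exact hw rfl
    · exact hw rfl
  have hN : ∀ {s : G.Tile}, NWRule s nw → ∀ c r d, s ≠ N c r d := by
    rintro s h c r d rfl
    obtain ⟨-, hj, rfl⟩ := h
    exact hw rfl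
  by_cases he : phase ne = some 0
  · rcases h4.of_phase he with ⟨i, hi, hC, rfl⟩ | ⟨i, hi, hC, rfl⟩ <;>
    rcases h4'.of_phase he with ⟨i', hi', hC', rfl⟩ | ⟨i', hi', hC', rfl⟩
    · simp only [M.injEq]; omega
    · simp only [VRule] at h2 h2'
      rcases h2' with ⟨_, rfl⟩ | ⟨h2', -⟩
      · simp at h2
      · omega
    · simp only [VRule] at h2 h2'
      rcases h2 with ⟨_, rfl⟩ | ⟨h2, -⟩
      · simp at h2'
      · omega
    · simp only [S.injEq]; omega
  have hM : ∀ {s : G.Tile}, NERule s ne → ∀ i hi, s = M i hi → i + 1 ≠ G.B := by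
    rintro s h i hi rfl hC
    exact he (h.1 hC)
  have b2 := h2.below
  have b2' := h2'.below
  have l1 := hL h3
  have l1' := hL h3'
  have n1 := hN h3
  have n1' := hN h3'
  have m1 := hM h4
  have m1' := hM h4'
  have key : ∀ {s s' : G.Tile}, (s = a ∨ ∃ c r, s = h c r) → (s' = a ∨ ∃ c r, s' = h c r) →
      HRule s t → HRule s' t → s = s' := by
    rintro s s' (rfl | ⟨c, r, rfl⟩) (rfl | ⟨c', r', rfl⟩) h1 h1'
    · rfl
    · simp only [HRule] at h1 h1'
      rcases h1 with rfl | ⟨c, j, hj, r, rfl⟩ <;> simp at h1'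
    · simp only [HRule] at h1 h1'
      rcases h1' with rfl | ⟨c, j, hj, r, rfl⟩ <;> simp at h1
    · simp only [HRule] at h1 h1'
      rcases h1 with rfl | ⟨d, rfl⟩ <;> simp at h1' <;> simp [h1']
  rcases n with _ | _ | _ | ⟨_ | i, hi⟩ | _ | ⟨c, _ | j, hj⟩ | _ | _ | ⟨c, r⟩ | ⟨c, _ | j, hj, r⟩ |
    ⟨_ | _ | i, hi⟩ | ⟨c, r, d⟩
  · exact b2.trans b2'.symm
  · exact b2.trans b2'.symm
  · exact b2.trans b2'.symm
  · exact b2.trans b2'.symm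
  · obtain ⟨_, rfl⟩ := b2; obtain ⟨_, rfl⟩ := b2'; rfl
  · have q : ∀ {s : G.Tile}, (s = W ∨ (∃ c j hj, j + 1 = G.C c ∧ s = P c j hj) ∨
        ∃ hi, s = S (G.B * G.seed) hi) → HRule s t → (s = W ∧ ∀ c r, t ≠ h c r) ∨
        (∃ c j hj, j + 1 = G.C c ∧ s = P c j hj ∧ t = h (some c) 1) ∨
        ∃ hi, s = S (G.B * G.seed) hi ∧ t = h none 1 := by
      rintro s (rfl | ⟨c, j, hj, hC, rfl⟩ | ⟨hi, rfl⟩) h1 <;> simp only [HRule] at h1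
      · refine Or.inl ⟨rfl, ?_⟩
        rcases h1 with rfl | ⟨_, _, _, _, rfl⟩ <;> simp
      · exact Or.inr (Or.inl ⟨c, j, hj, hC, rfl, by simpa [hC] using h1⟩)
      · refine Or.inr (Or.inr ⟨hi, rfl, ?_⟩)
        rcases h1 with h1 | h1 | h1
        · omega
        · omega
        · exact h1.2
    rcases q b2 h1 with ⟨e, f⟩ | ⟨c, j, hj, hC, e, f⟩ | ⟨_, e, f⟩ <;>
    rcases q b2' h1' with ⟨e', f'⟩ | ⟨c', j', hj', hC', e', f'⟩ | ⟨_, e', f'⟩ <;>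
    first
    | exact e.trans e'.symm
    | exact absurd f' (f _ _)
    | exact absurd f (f' _ _)
    | (rw [f] at f'; simp at f'; done)
    | skip
    rw [f] at f'
    simp only [h.injEq, Option.some.injEq, and_true] at f'
    subst f'
    rw [e, e']
    simp only [P.injEq, true_and]
    omega
  · exact b2.trans b2'.symm
  · obtain ⟨_, rfl⟩ := b2; obtain ⟨_, rfl⟩ := b2'; rfl
  · exact key b2 b2' h1 h1'
  · have q : ∀ {s : G.Tile}, (s = b ∨ (∃ c j hj r, j + 1 = G.C c ∧ s = L c j hj r) ∨
        ∃ i hi, i + 1 = G.B ∧ s = M i hi) → (∀ c j hj r, s = L c j hj r → j + 1 ≠ G.C c) →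
        (∀ i hi, s = M i hi → i + 1 ≠ G.B) → s = b := by
      rintro s (rfl | ⟨c, j, hj, r, hC, rfl⟩ | ⟨i, hi, hC, rfl⟩) h1 h2
      · rfl
      · exact absurd hC (h1 _ _ _ _ rfl)
      · exact absurd hC (h2 _ _ rfl)
    rw [q b2 l1 m1, q b2' l1' m1']
  · obtain rfl | ⟨i, hi, hC, rfl⟩ := b2
    · obtain rfl | ⟨i, hi, hC, rfl⟩ := b2'
      · rfl
      · exact absurd hC (m1' _ _ rfl)
    · exact absurd hC (m1 _ _ rfl)
  · exact key b2 b2' h1 h1'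
  · obtain ⟨_, rfl⟩ := b2; obtain ⟨_, rfl⟩ := b2'; rfl
  · exact b2.trans b2'.symm
  · obtain ⟨_, rfl⟩ := b2.resolve_right (by rintro ⟨c, r, d, rfl⟩; exact n1 _ _ _ rfl)
    obtain ⟨_, rfl⟩ := b2'.resolve_right (by rintro ⟨c, r, d, rfl⟩; exact n1' _ _ _ rfl)
    rfl
  · obtain ⟨_, rfl⟩ := b2; obtain ⟨_, rfl⟩ := b2'; rfl
  · exact b2.trans b2'.symm

end Drawing
end Geometry

section FiniteType

open Function

theorem isSFT2_of_local {A : Type*} [Finite A] [Nonempty A] (D : Finset (ℤ × ℤ))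
    (R : (ℤ × ℤ → A) → Prop) (hR : ∀ p q, (∀ m ∈ D, p m = q m) → R p → R q) :
    IsSFT2 {x : ℤ × ℤ → A | ∀ n, R fun m => x (n + m)} := by
  classical
  let ext : (D → A) → ℤ × ℤ → A := fun p m => if h : m ∈ D then p ⟨m, h⟩ else Classical.arbitrary A
  refine ⟨{P | ∃ p, P = (D, ext p) ∧ ¬ R (ext p)},
    (Set.finite_range fun p => (D, ext p)).subset ?_, ?_⟩
  · rintro P ⟨p, rfl, -⟩
    exact ⟨p, rfl⟩
  · ext x
    constructor
    · rintro hx P ⟨p, rfl, hp⟩ ⟨n, hn⟩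
      exact hp (hR _ _ hn (hx n))
    · intro hx n
      by_contra hn
      have h : ∀ m ∈ D, x (n + m) = ext (fun m => x (n + m)) m := fun m hm => by simp [ext, hm]
      exact hx _ ⟨fun m => x (n + m), rfl, fun h' => hn (hR _ _ (fun m hm => (h m hm).symm) h')⟩ ⟨n, h⟩

theorem isSFT1_of_pairs {A : Type*} [Finite A] (H : A → A → Prop) :
    IsSFT1 {y : ℤ → A | ∀ j, H (y j) (y (j + 1))} := by
  refine ⟨{u | ∃ s t, u = [s, t] ∧ ¬ H s t},
    (Set.finite_range fun p : A × A => [p.1, p.2]).subset ?_, ?_⟩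
  · rintro u ⟨s, t, rfl, -⟩
    exact ⟨(s, t), rfl⟩
  · ext y
    constructor
    · rintro hy u ⟨s, t, rfl, hst⟩ ⟨n, hn⟩
      have h0 := hn ⟨0, by simp⟩
      have h1 := hn ⟨1, by simp⟩
      simp at h0 h1
      exact hst (h0 ▸ h1 ▸ hy n)
    · intro hy j
      by_contra hj
      refine hy _ ⟨_, _, rfl, hj⟩ ⟨j, fun i => ?_⟩
      rcases i with ⟨_ | _ | i, hi⟩
      · simp
      · simp
      · simp at hi

/-- A one-dimensional nearest neighbour subshift is countable if its letters are ranked, the ranks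
increase along rows and every row is determined in both directions as long as the rank does not
change. -/
theorem countable_of_rank {A : Type*} [Finite A] {H : A → A → Prop} (rk : A → ℕ)
    (hmono : ∀ {s t}, H s t → rk s ≤ rk t)
    (hr : ∀ {s t t'}, H s t → H s t' → rk t = rk s → rk t' = rk s → t = t')
    (hl : ∀ {s s' t}, H s t → H s' t → rk s = rk t → rk s' = rk t → s = s') :
    {y : ℤ → A | ∀ j, H (y j) (y (j + 1))}.Countable := by
  have key : {y : ℤ → A | ∀ j, H (y j) (y (j + 1))} ⊆ ⋃ N : ℕ, {y : ℤ → A |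
      (∀ j, H (y j) (y (j + 1))) ∧ (∀ j, (N : ℤ) ≤ j → rk (y j) = rk (y N)) ∧
      ∀ j, j ≤ -(N : ℤ) → rk (y j) = rk (y (-N))} := by
    intro y hy
    have hm : Monotone fun j => rk (y j) := monotone_int_of_le_succ fun j => hmono (hy j)
    have hfin : (Set.range rk).Finite := Set.finite_range rk
    obtain ⟨i, hi⟩ := Set.Finite.exists_maximal (hfin.subset (Set.range_comp_subset_range y rk))
      ⟨_, 0, rfl⟩
    obtain ⟨k, hk⟩ := Set.Finite.exists_minimal (hfin.subset (Set.range_comp_subset_range y rk))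
      ⟨_, 0, rfl⟩
    obtain ⟨⟨i, rfl⟩, hi⟩ := hi
    obtain ⟨⟨k, rfl⟩, hk⟩ := hk
    have hi' : ∀ j, i ≤ j → rk (y j) = rk (y i) := fun j hj =>
      le_antisymm (hi ⟨j, rfl⟩ (hm hj)) (hm hj)
    have hk' : ∀ j, j ≤ k → rk (y j) = rk (y k) := fun j hj =>
      le_antisymm (hm hj) (hk ⟨j, rfl⟩ (hm hj))
    refine Set.mem_iUnion.2 ⟨i.natAbs + k.natAbs, hy, fun j hj => ?_, fun j hj => ?_⟩
    · exact (hi' j (by omega)).trans (hi' _ (by omega)).symm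
    · exact (hk' j (by omega)).trans (hk' _ (by omega)).symm
  refine (Set.countable_iUnion fun N => ?_).mono key
  refine Set.Finite.countable (Set.Finite.of_injOn (t := Set.univ)
    (f := fun (y : ℤ → A) (j : Set.Icc (-(N : ℤ)) N) => y j) (fun _ _ => trivial) ?_ Set.finite_univ)
  rintro y ⟨hy, hy1, hy2⟩ z ⟨hz, hz1, hz2⟩ hyz
  have hmid : ∀ j, -(N : ℤ) ≤ j → j ≤ N → y j = z j := fun j h1 h2 =>
    congrFun hyz (⟨j, h1, h2⟩ : Set.Icc (-(N : ℤ)) N)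
  have hright : ∀ k : ℕ, y (N + k) = z (N + k) := by
    intro k
    induction k with
    | zero => exact hmid _ (by simp) (by simp)
    | succ k ih =>
      have e : ((N : ℤ) + (k + 1 : ℕ)) = N + k + 1 := by push_cast; ring
      rw [e]
      have h1 := hy (N + k)
      rw [ih] at h1
      refine hr h1 (hz _) ?_ ?_
      · rw [← ih, hy1 _ (by omega), hy1 (N + k) (by omega)]
      · rw [hz1 _ (by omega), hz1 (N + k) (by omega)]
  have hleft : ∀ k : ℕ, y (-N - k) = z (-N - k) := by
    intro k
    induction k with
    | zero => exact hmid _ (by simp) (by simp)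
    | succ k ih =>
      have e : (-(N : ℤ) - k) = -N - (k + 1 : ℕ) + 1 := by push_cast; ring
      have h1 := hy (-N - (k + 1 : ℕ))
      have h2 := hz (-N - (k + 1 : ℕ))
      rw [← e] at h1 h2
      rw [ih] at h1
      refine hl h1 h2 ?_ ?_
      · rw [← ih, hy2 _ (by omega), hy2 (-N - k) (by omega)]
      · rw [hz2 _ (by omega), hz2 (-N - k) (by omega)]
  funext j
  rcases le_total (N : ℤ) j with h | h
  · have := hright (j - N).toNat
    rwa [Int.toNat_of_nonneg (by omega), add_sub_cancel] at this
  · rcases le_total (-(N : ℤ)) j with h' | h'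
    · exact hmid j h' h
    · have := hleft (-N - j).toNat
      rwa [Int.toNat_of_nonneg (by omega), sub_sub_cancel] at this

end FiniteType

section Geometry

namespace Drawing

open Tile

variable {ι : Type} {G : Drawing ι}

/-- Rank of the symbols along rows. -/
def rk : G.Tile → ℕ
  | o => 0
  | K | S _ _ | W | P _ _ _ => 1
  | a | h _ _ => 2
  | L _ _ _ _ => 3
  | b => 4
  | M _ _ | N _ _ _ => 5
  | e => 6

theorem HRule.rk_cases {s t : G.Tile} (hst : HRule s t) : rk s < rk t ∨ (s = o ∧ t = o) ∨
    (s = e ∧ t = e) ∨ (s = a ∧ t = a) ∨ (s = b ∧ t = b) ∨ ∃ c r, s = h c r ∧ t = h c (r + 1) := by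
  cases s <;> simp only [HRule] at hst
  case o =>
    rcases hst with rfl | hst
    · simp
    · cases t <;> simp_all [IsAxis, rk]
  case e => subst hst; simp
  case K => subst hst; simp [rk]
  case S =>
    rcases hst with ⟨-, rfl⟩ | ⟨-, -, rfl | ⟨_, _, rfl⟩⟩ | ⟨-, rfl⟩ <;> simp [rk]
  case W => rcases hst with rfl | ⟨_, _, _, _, rfl⟩ <;> simp [rk]
  case P => rcases hst with ⟨-, rfl⟩ | ⟨-, rfl⟩ <;> simp [rk]
  case a => rcases hst with rfl | ⟨_, _, _, _, rfl⟩ <;> simp [rk]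
  case b => rcases hst with rfl | ⟨_, _, rfl⟩ <;> simp [rk]
  case h => rcases hst with rfl | ⟨_, rfl⟩ <;> simp [rk]
  case L => rcases hst with rfl | ⟨_, _, rfl⟩ <;> simp [rk]
  case M => subst hst; simp [rk]
  case N => subst hst; simp [rk]

theorem HRule.rk_le {s t : G.Tile} (hst : HRule s t) : rk s ≤ rk t := by
  rcases hst.rk_cases with h | ⟨rfl, rfl⟩ | ⟨rfl, rfl⟩ | ⟨rfl, rfl⟩ | ⟨rfl, rfl⟩ | ⟨c, r, rfl, rfl⟩
  · exact h.le
  all_goals exact le_rfl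

theorem countable_rows [Finite ι] : {y : ℤ → G.Tile | ∀ j, HRule (y j) (y (j + 1))}.Countable := by
  refine countable_of_rank rk (fun h => h.rk_le) (fun h h' e e' => ?_) fun h h' e e' => ?_
  · have h1 := h.rk_cases.resolve_left (by omega)
    have h2 := h'.rk_cases.resolve_left (by omega)
    rcases h1 with ⟨rfl, rfl⟩ | ⟨rfl, rfl⟩ | ⟨rfl, rfl⟩ | ⟨rfl, rfl⟩ | ⟨c, r, rfl, rfl⟩ <;>
    simpa [eq_comm] using h2
  · have h1 := h.rk_cases.resolve_left (by omega)
    have h2 := h'.rk_cases.resolve_left (by omega)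
    rcases h1 with ⟨rfl, rfl⟩ | ⟨rfl, rfl⟩ | ⟨rfl, rfl⟩ | ⟨rfl, rfl⟩ | ⟨c, r, rfl, rfl⟩ <;>
    simpa [eq_comm] using h2

theorem isSFT2_space [Finite ι] : IsSFT2 G.space := by
  have : Nonempty G.Tile := ⟨o⟩
  have := isSFT2_of_local (A := G.Tile) {(0, 0), (1, 0), (0, 1), (-1, 1), (1, 1)}
    (fun p => HRule (p (0, 0)) (p (1, 0)) ∧ VRule (p (0, 0)) (p (0, 1)) ∧
      NWRule (p (0, 0)) (p (-1, 1)) ∧ NERule (p (0, 0)) (p (1, 1))) (fun p q hpq h => by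
        simpa [← hpq] using h)
  convert this using 1
  ext x
  simp [space, sub_eq_add_neg]

theorem pProperty_space [Finite ι] : PProperty G.space := by
  let : TopologicalSpace G.Tile := ⊥
  refine ⟨G.Tile, Fintype.ofFinite _, G.space, id, id, ⟨continuous_id, continuous_id⟩,
    fun _ _ => rfl, fun _ _ => rfl, fun _ h => h, fun _ h => h, fun _ _ => rfl, fun _ _ => rfl,
    _, isSFT1_of_pairs HRule, countable_rows, ?_⟩
  rintro _ ⟨x, hx, rfl⟩ j
  exact (hx j 0).1

theorem space_det {x y : ℤ × ℤ → G.Tile} (hx : x ∈ G.space) (hy : y ∈ G.space)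
    (h : ∀ i j, 1 ≤ i + 2 * j → x (i, j) = y (i, j)) : x = y := by
  have key : ∀ k : ℕ, ∀ i j : ℤ, 1 - (k : ℤ) ≤ i + 2 * j → x (i, j) = y (i, j) := by
    intro k
    induction k with
    | zero => simpa using h
    | succ k ih =>
      intro i j hij
      push_cast at hij
      obtain ⟨h1, h2, h3, h4⟩ := hx i j
      obtain ⟨h1', h2', h3', h4'⟩ := hy i j
      rw [← ih (i + 1) j (by omega)] at h1'
      rw [← ih i (j + 1) (by omega)] at h2'
      rw [← ih (i - 1) (j + 1) (by omega)] at h3'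
      rw [← ih (i + 1) (j + 1) (by omega)] at h4'
      exact rule_det h1 h2 h3 h4 h1' h2' h3' h4'
  funext ⟨i, j⟩
  exact key (1 - (i + 2 * j)).toNat i j (by omega)

theorem detSomeDir_space : DetSomeDir G.space := by
  let A : Matrix.SpecialLinearGroup (Fin 2) ℤ := ⟨!![1, 1; 1, 2], by simp [Matrix.det_fin_two_of]⟩
  have hA : ∀ i j : ℤ, sl2Vec A⁻¹ (i + j, i + 2 * j) = (i, j) := by
    have hinv : (A⁻¹ : Matrix.SpecialLinearGroup (Fin 2) ℤ).1 = !![2, -1; -1, 1] := by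
      rw [Matrix.SpecialLinearGroup.coe_inv]
      exact Matrix.adjugate_fin_two_of 1 1 1 2
    intro i j
    simp only [sl2Vec, hinv]
    simp
    constructor <;> ring
  refine ⟨(-1, -2), ⟨-1, 0, by norm_num⟩, A, by simp [sl2Vec, rot90, A], ?_⟩
  rintro _ ⟨x, hx, rfl⟩ _ ⟨y, hy, rfl⟩ h
  congr 1
  refine space_det hx hy fun i j hij => ?_
  have := h (i + j) (i + 2 * j) hij
  simpa only [confAct, hA] using this

end Drawing
end Geometry

section Geometry

open Function

namespace Drawing

open Tile

variable {ι : Type} {G : Drawing ι}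

theorem HRule.of_axis {s t : G.Tile} (hst : HRule s t) (ht : IsAxis t) : s = o := by
  cases s <;> simp only [HRule] at hst
  case o => rfl
  case e => subst hst; exact ht.elim
  case K => subst hst; exact ht.elim
  case S => rcases hst with ⟨-, rfl⟩ | ⟨-, -, rfl | ⟨_, _, rfl⟩⟩ | ⟨-, rfl⟩ <;> exact ht.elim
  case W => rcases hst with rfl | ⟨_, _, _, _, rfl⟩ <;> exact ht.elim
  case P => rcases hst with ⟨-, rfl⟩ | ⟨-, rfl⟩ <;> exact ht.elim
  case a => rcases hst with rfl | ⟨_, _, _, _, rfl⟩ <;> exact ht.elim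
  case b => rcases hst with rfl | ⟨_, _, rfl⟩ <;> exact ht.elim
  case h => rcases hst with rfl | ⟨_, rfl⟩ <;> exact ht.elim
  case L => rcases hst with rfl | ⟨_, _, rfl⟩ <;> exact ht.elim
  case M => subst hst; exact ht.elim
  case N => subst hst; exact ht.elim

theorem eq_o_of_rk {s : G.Tile} (h : rk s ≤ 0) : s = o := by
  cases s <;> simp [rk] at h ⊢

theorem eq_e_of_rk {s : G.Tile} (h : 6 ≤ rk s) : s = e := by
  cases s <;> simp [rk] at h ⊢

variable (G) in
/-- Sequences respecting the horizontal rule. -/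
def IsRow (ρ : ℤ → G.Tile) : Prop := ∀ j, HRule (ρ j) (ρ (j + 1))

namespace IsRow

variable {ρ : ℤ → G.Tile} (hρ : G.IsRow ρ)
include hρ

theorem rk_mono : Monotone fun j => rk (ρ j) := monotone_int_of_le_succ fun j => (hρ j).rk_le

theorem pred (j : ℤ) : HRule (ρ (j - 1)) (ρ j) := by simpa using hρ (j - 1)

theorem eq_o {p j : ℤ} (hp : IsAxis (ρ p)) (hj : j < p) : ρ j = o := by
  have h := (hρ.pred p).of_axis hp
  have := hρ.rk_mono (show j ≤ p - 1 by omega)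
  simp only [h] at this
  exact eq_o_of_rk this

theorem eq_e {p j : ℤ} (hp : ρ p = e) (hj : p ≤ j) : ρ j = e := by
  have := hρ.rk_mono hj
  simp only [hp] at this
  exact eq_e_of_rk this

theorem eq_e_of_phase {p j : ℤ} {i : ℕ} (hp : phase (ρ p) = some i) (hj : p < j) : ρ j = e := by
  refine hρ.eq_e (p := p + 1) ?_ hj
  have h := hρ p
  revert h hp
  cases ρ p <;> simp [phase, HRule]

theorem not_axis {p j : ℤ} (hp : ρ p ≠ o) (hj : p < j) : ¬ IsAxis (ρ j) := fun h =>
  hp (hρ.eq_o h hj)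

theorem eq_a {p q : ℤ} (hp : ρ p = W ∨ ρ p = a)
    (hL : ∀ j, p < j → j < q → ∀ c k hk r, ρ j ≠ L c k hk r) {j : ℤ} (h1 : p < j) (h2 : j < q) :
    ρ j = a := by
  obtain ⟨k, rfl⟩ : ∃ k : ℕ, j = p + 1 + k := ⟨(j - p - 1).toNat, by omega⟩
  induction k with
  | zero =>
    have h := hρ p
    rw [Nat.cast_zero, add_zero] at h1 h2 ⊢
    rcases hp with hp | hp <;> rw [hp] at h <;>
      exact h.resolve_right fun ⟨_, _, _, _, h'⟩ => hL _ h1 h2 _ _ _ _ h'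
  | succ k ih =>
    have h := hρ (p + 1 + k)
    rw [ih (by omega) (by omega)] at h
    rw [show p + 1 + ((k + 1 : ℕ) : ℤ) = p + 1 + k + 1 by push_cast; ring] at h1 h2 ⊢
    exact h.resolve_right fun ⟨_, _, _, _, h'⟩ => hL _ h1 h2 _ _ _ _ h'

theorem eq_b {p q : ℤ} (hp : ρ (p + 1) = b ∨ ∃ k hk, ρ (p + 1) = M k hk)
    (hM : ∀ j, p < j → j < q → ∀ k hk, ρ j ≠ M k hk) {j : ℤ} (h1 : p < j) (h2 : j < q) :
    ρ j = b := by
  obtain ⟨k, rfl⟩ : ∃ k : ℕ, j = p + 1 + k := ⟨(j - p - 1).toNat, by omega⟩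
  induction k with
  | zero =>
    rw [Nat.cast_zero, add_zero] at h1 h2 ⊢
    exact hp.resolve_right fun ⟨_, _, h'⟩ => hM _ h1 h2 _ _ h'
  | succ k ih =>
    have h := hρ (p + 1 + k)
    rw [ih (by omega) (by omega)] at h
    rw [show p + 1 + ((k + 1 : ℕ) : ℤ) = p + 1 + k + 1 by push_cast; ring] at h1 h2 ⊢
    exact h.resolve_right fun ⟨_, _, h'⟩ => hM _ h1 h2 _ _ h'

theorem eq_h {p q : ℤ} {c r} (hp : ρ p = h c r)
    (hN : ∀ j, p < j → j < q → ∀ c r d, ρ j ≠ N c r d) {j : ℤ} (h1 : p ≤ j) (h2 : j < q) :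
    ρ j = h c (r + ((j - p : ℤ) : ZMod G.m)) := by
  obtain ⟨k, rfl⟩ : ∃ k : ℕ, j = p + k := ⟨(j - p).toNat, by omega⟩
  induction k with
  | zero => simpa using hp
  | succ k ih =>
    have h := hρ (p + k)
    rw [ih (by omega) (by omega)] at h
    rw [show p + ((k + 1 : ℕ) : ℤ) = p + k + 1 by push_cast; ring] at h1 h2 ⊢
    rw [h.resolve_right fun ⟨_, h'⟩ => hN _ (by omega) h2 _ _ _ h']
    push_cast
    ring_nf

theorem not_M {p q : ℤ} {i : ℕ} (hq : phase (ρ q) = some i) (hpq : p < q) : phase (ρ p) = none := by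
  by_contra h
  obtain ⟨k, hk⟩ := Option.ne_none_iff_exists'.1 h
  have := hρ.eq_e_of_phase hk hpq
  rw [this] at hq
  simp [phase] at hq

theorem not_L {p q : ℤ} (hq : rk (ρ q) ≤ 3) (hpq : p < q) (c k hk r) : ρ p ≠ L c k hk r := by
  intro h
  have h1 := hρ p
  rw [h] at h1
  have h2 := hρ.rk_mono (show p + 1 ≤ q by omega)
  rcases h1 with h1 | ⟨_, _, h1⟩ <;>
  · have h3 : 4 ≤ rk (ρ q) := (by rw [h1]; simp [rk] : 4 ≤ rk (ρ (p + 1))).trans h2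
    omega

end IsRow

variable (G) in
/-- Row with symbol `z` on the axis, the falling line in column `q` and the right line in column `μ`. -/
def genRow (z : G.Tile) (q : ℤ) (l : G.Tile) (μ : ℤ) (i : ℕ) (hi : i < G.B) (j : ℤ) : G.Tile :=
  if j < 0 then o else if j = 0 then z else if j < q then a else if j = q then l
  else if j < μ then b else if j = μ then M i hi else e

variable (G) in
/-- Row with symbol `z` on the axis and a horizontal line up to column `n`. -/
def horRow (z : G.Tile) (n : ℤ) (c : Option ι) (d : ι) (j : ℤ) : G.Tile :=
  if j < 0 then o else if j = 0 then z else if j < n then h c j else if j = n then N c n d else e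

theorem eq_M_of_phase {s : G.Tile} {i : ℕ} (hs : phase s = some i)
    (h : s = b ∨ ∃ k hk, s = M k hk) : ∃ hi, s = M i hi := by
  rcases h with rfl | ⟨k, hk, rfl⟩
  · simp [phase] at hs
  · simp only [phase, Option.some.injEq] at hs
    subst hs
    exact ⟨hk, rfl⟩

namespace IsRow

variable {ρ : ℤ → G.Tile} (hρ : G.IsRow ρ)
include hρ

theorem eq_M {p μ : ℤ} {i : ℕ} (h1 : ρ (p + 1) = b ∨ ∃ k hk, ρ (p + 1) = M k hk) (hμ : p < μ)
    (hM : phase (ρ μ) = some i) : ∃ hi, ρ μ = M i hi := by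
  refine eq_M_of_phase hM ?_
  rcases eq_or_lt_of_le (show p + 1 ≤ μ by omega) with rfl | hlt
  · exact h1
  · have h2 := hρ.eq_b (q := μ) h1 (fun j _ h3 k hk h' => by
      have := hρ.not_M hM h3
      simp [h', phase] at this) (show p < μ - 1 by omega) (by omega)
    have := hρ.pred μ
    rwa [h2] at this

theorem eq_genRow {z : G.Tile} {μ : ℤ} {i : ℕ} (hi : i < G.B) (hz : IsAxis z) (h0 : ρ 0 = z)
    (h1 : ρ 1 = b ∨ ∃ k hk, ρ 1 = M k hk) (hμ : 0 < μ) (hM : phase (ρ μ) = some i) :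
    ρ = G.genRow z 0 a μ i hi := by
  have h1' : ρ (0 + 1) = b ∨ ∃ k hk, ρ (0 + 1) = M k hk := by simpa using h1
  funext j
  unfold genRow
  split_ifs with c1 c2 c3 c4
  · exact hρ.eq_o (h0 ▸ hz) c1
  · exact c2 ▸ h0
  · exact hρ.eq_b (q := μ) h1' (fun j _ h3 k hk h' => by
      have := hρ.not_M hM h3
      simp [h', phase] at this) (by omega) c3
  · obtain ⟨_, h'⟩ := hρ.eq_M h1' hμ hM
    exact c4 ▸ h'
  · exact hρ.eq_e_of_phase hM (by omega)

theorem eq_genRow_of_e {z : G.Tile} {μ : ℤ} {i : ℕ} (hi : i < G.B) (hz : IsAxis z) (h0 : ρ 0 = z)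
    (h1 : ρ 1 = e) (hμ : μ ≤ 0) : ρ = G.genRow z 0 a μ i hi := by
  funext j
  unfold genRow
  split_ifs with c1 c2 c3 c4
  · exact hρ.eq_o (h0 ▸ hz) c1
  · exact c2 ▸ h0
  · omega
  · omega
  · exact hρ.eq_e h1 (by omega)

theorem eq_genRow_of_L {q μ : ℤ} {i : ℕ} {c k hk r} (hi : i < G.B) (h0 : ρ 0 = W)
    (hq : ρ q = L c k hk r) (_ : 0 < q) (hμ : q < μ) (hM : phase (ρ μ) = some i) :
    ρ = G.genRow W q (L c k hk r) μ i hi := by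
  have h1 := hρ q
  rw [hq] at h1
  funext j
  unfold genRow
  split_ifs with c1 c2 c3 c4 c5 c6
  · exact hρ.eq_o (p := 0) (by rw [h0]; trivial) c1
  · exact c2 ▸ h0
  · exact hρ.eq_a (Or.inl h0) (fun j _ h => hρ.not_L (by simp [hq, rk]) h) (by omega) c3
  · exact c4 ▸ hq
  · exact hρ.eq_b (q := μ) h1 (fun j _ h3 k hk h' => by
      have := hρ.not_M hM h3
      simp [h', phase] at this) (by omega) c5
  · obtain ⟨_, h'⟩ := hρ.eq_M h1 hμ hM
    exact c6 ▸ h'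
  · exact hρ.eq_e_of_phase hM (by omega)

theorem eq_horRow {z : G.Tile} {n : ℤ} {i : ℕ} {c} (hz : IsAxis z) (h0 : ρ 0 = z)
    (h1 : ρ 1 = h c 1) (hn : 1 < n) (hM : phase (ρ n) = some i) :
    i = 0 ∧ ∃ d, ρ = G.horRow z n c d := by
  have hh : ∀ j, 1 ≤ j → j < n → ρ j = h c j := fun j h2 h3 => by
    have := hρ.eq_h h1 (q := n) (fun j _ h3 k hk d h' => by
      have := hρ.not_M hM h3
      simp [h', phase] at this) h2 h3
    simpa using this
  have h2 := hρ.pred n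
  rw [hh _ (by omega) (by omega)] at h2
  obtain h2 | ⟨d, h2⟩ := h2
  · rw [h2] at hM
    simp [phase] at hM
  · refine ⟨by simpa [h2, phase, eq_comm] using hM, d, ?_⟩
    funext j
    unfold horRow
    split_ifs with c1 c2 c3 c4
    · exact hρ.eq_o (h0 ▸ hz) c1
    · exact c2 ▸ h0
    · exact hh j (by omega) c3
    · rw [c4, h2]; simp
    · exact hρ.eq_e_of_phase hM (by omega)

end IsRow

end Drawing
end Geometry

section Geometry

open Function

namespace Drawing

open Tile

variable {ι : Type} {G : Drawing ι}

variable (G) in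
/-- The rules between a row and the one above it. -/
def Above (ρ ρ' : ℤ → G.Tile) : Prop :=
  ∀ j, VRule (ρ j) (ρ' j) ∧ NWRule (ρ j) (ρ' (j - 1)) ∧ NERule (ρ j) (ρ' (j + 1))

/-- Consecutive positions on the line bounding the drawing on the right. -/
def Succ (B : ℕ) (μ : ℤ) (i : ℕ) (μ' : ℤ) (i' : ℕ) : Prop :=
  (μ' = μ ∧ i' = i + 1) ∨ (i + 1 = B ∧ μ' = μ + 1 ∧ i' = 0)

set_option linter.unusedSimpArgs false
set_option linter.unreachableTactic false
set_option linter.unusedTactic false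

theorem genRow_cases (z : G.Tile) (q : ℤ) (l : G.Tile) (μ : ℤ) {i : ℕ} (hi : i < G.B) (j : ℤ) :
    (j < 0 ∧ G.genRow z q l μ i hi j = o) ∨ (j = 0 ∧ G.genRow z q l μ i hi j = z) ∨
    ((0 < j ∧ j < q) ∧ G.genRow z q l μ i hi j = a) ∨
    ((0 < j ∧ j = q) ∧ G.genRow z q l μ i hi j = l) ∨
    ((0 < j ∧ q < j ∧ j < μ) ∧ G.genRow z q l μ i hi j = b) ∨
    ((0 < j ∧ q < j ∧ j = μ) ∧ G.genRow z q l μ i hi j = M i hi) ∨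
    ((0 < j ∧ q < j ∧ μ < j) ∧ G.genRow z q l μ i hi j = e) := by
  unfold genRow
  split_ifs <;> simp <;> omega

theorem horRow_cases (z : G.Tile) {n : ℤ} (hn : 0 < n) (c d) (j : ℤ) :
    (j < 0 ∧ G.horRow z n c d j = o) ∨ (j = 0 ∧ G.horRow z n c d j = z) ∨
    ((0 < j ∧ j < n) ∧ G.horRow z n c d j = h c j) ∨
    (j = n ∧ G.horRow z n c d j = N c n d) ∨ (n < j ∧ G.horRow z n c d j = e) := by
  unfold horRow
  split_ifs with h1 h2 <;> simp <;> first | omega | (subst h2; simp; omega)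

section Soundness

variable {μ μ' : ℤ} {i i' : ℕ} {hi : i < G.B} {hi' : i' < G.B}

theorem isRow_genRow {z : G.Tile} {q : ℤ} {l : G.Tile} (hz : IsAxis z)
    (h : (0 < q ∧ q < μ ∧ z = W ∧ ∃ c j hj r, l = L c j hj r) ∨
      (q = 0 ∧ μ ≤ 0 ∧ HRule z e) ∨ (q = 0 ∧ 1 < μ ∧ HRule z b) ∨
      (q = 0 ∧ μ = 1 ∧ HRule z (M i hi))) : G.IsRow (G.genRow z q l μ i hi) := by
  intro j
  rcases h with ⟨h1, h2, rfl, c, k, hk, r, rfl⟩ | ⟨rfl, h2, h⟩ | ⟨rfl, h2, h⟩ | ⟨rfl, rfl, h⟩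
  · rcases genRow_cases W q (L c k hk r) μ hi j with ⟨h3, e1⟩ | ⟨h3, e1⟩ | ⟨h3, e1⟩ | ⟨h3, e1⟩ | ⟨h3, e1⟩ | ⟨h3, e1⟩ | ⟨h3, e1⟩ <;>
    rcases genRow_cases W q (L c k hk r) μ hi (j + 1) with ⟨h4, e2⟩ | ⟨h4, e2⟩ | ⟨h4, e2⟩ | ⟨h4, e2⟩ | ⟨h4, e2⟩ | ⟨h4, e2⟩ | ⟨h4, e2⟩ <;>
    first
    | omega
    | (rw [e1, e2]; first | assumption | (simp [HRule, hk, IsAxis]; done) | (simp [HRule]; assumption))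
  · rcases genRow_cases z 0 l μ hi j with ⟨h3, e1⟩ | ⟨h3, e1⟩ | ⟨h3, e1⟩ | ⟨h3, e1⟩ | ⟨h3, e1⟩ | ⟨h3, e1⟩ | ⟨h3, e1⟩ <;>
    rcases genRow_cases z 0 l μ hi (j + 1) with ⟨h4, e2⟩ | ⟨h4, e2⟩ | ⟨h4, e2⟩ | ⟨h4, e2⟩ | ⟨h4, e2⟩ | ⟨h4, e2⟩ | ⟨h4, e2⟩ <;>
    first
    | omega
    | (rw [e1, e2]; first | assumption | (simp [HRule, hz]; done) | (simp [HRule]; assumption))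
  · rcases genRow_cases z 0 l μ hi j with ⟨h3, e1⟩ | ⟨h3, e1⟩ | ⟨h3, e1⟩ | ⟨h3, e1⟩ | ⟨h3, e1⟩ | ⟨h3, e1⟩ | ⟨h3, e1⟩ <;>
    rcases genRow_cases z 0 l μ hi (j + 1) with ⟨h4, e2⟩ | ⟨h4, e2⟩ | ⟨h4, e2⟩ | ⟨h4, e2⟩ | ⟨h4, e2⟩ | ⟨h4, e2⟩ | ⟨h4, e2⟩ <;>
    first
    | omega
    | (rw [e1, e2]; first | assumption | (simp [HRule, hz]; done) | (simp [HRule]; assumption))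
  · rcases genRow_cases z 0 l 1 hi j with ⟨h3, e1⟩ | ⟨h3, e1⟩ | ⟨h3, e1⟩ | ⟨h3, e1⟩ | ⟨h3, e1⟩ | ⟨h3, e1⟩ | ⟨h3, e1⟩ <;>
    rcases genRow_cases z 0 l 1 hi (j + 1) with ⟨h4, e2⟩ | ⟨h4, e2⟩ | ⟨h4, e2⟩ | ⟨h4, e2⟩ | ⟨h4, e2⟩ | ⟨h4, e2⟩ | ⟨h4, e2⟩ <;>
    first
    | omega
    | (rw [e1, e2]; first | assumption | (simp [HRule, hz]; done) | (simp [HRule]; assumption))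

theorem isRow_horRow {z : G.Tile} {n : ℕ} {c d} (hz : IsAxis z) (hn : 1 < n)
    (h : HRule z (Tile.h c 1)) : G.IsRow (G.horRow z n c d) := by
  have hn0 : 0 < (n : ℤ) := by omega
  intro j
  rcases horRow_cases z hn0 c d j with ⟨h3, e1⟩ | ⟨h3, e1⟩ | ⟨h3, e1⟩ | ⟨h3, e1⟩ | ⟨h3, e1⟩ <;>
    rcases horRow_cases z hn0 c d (j + 1) with ⟨h4, e2⟩ | ⟨h4, e2⟩ | ⟨h4, e2⟩ | ⟨h4, e2⟩ | ⟨h4, e2⟩ <;>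
    first
    | omega
    | (rw [e1, e2]; first
        | (simp [HRule, hz]; done)
        | (subst h3; simpa using h)
        | (rw [← h4]; simp [HRule]))

theorem above_genRow_axis {z z' : G.Tile} (hv : VRule z z') (hw : NWRule z o) (hz' : ¬ IsAnchor z')
    (hp : phase z' = none)
    (he : NERule z (G.genRow z' 0 a μ' i' hi' 1)) (hs : Succ G.B μ i μ' i') :
    G.Above (G.genRow z 0 a μ i hi) (G.genRow z' 0 a μ' i' hi') := by
  rcases hs with ⟨hμ, rfl⟩ | ⟨hB, hμ, rfl⟩ <;> intro j <;> refine ⟨?_, ?_, ?_⟩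
  · rcases genRow_cases z 0 a μ hi j with ⟨h1, e1⟩ | ⟨h1, e1⟩ | ⟨h1, e1⟩ | ⟨h1, e1⟩ | ⟨h1, e1⟩ | ⟨h1, e1⟩ | ⟨h1, e1⟩ <;>
    rcases genRow_cases z' 0 a μ' hi' j with ⟨h2, e2⟩ | ⟨h2, e2⟩ | ⟨h2, e2⟩ | ⟨h2, e2⟩ | ⟨h2, e2⟩ | ⟨h2, e2⟩ | ⟨h2, e2⟩ <;>
    first
    | omega
    | (rw [e1, e2]; first | assumption | (subst h1; rw [show (0 : ℤ) + 1 = 1 from rfl] at e2; rw [e2] at he; exact he) | (simp [VRule, phase, IsAnchor, hz', hp]; done) | (simp [VRule, phase, IsAnchor, hz', hp]; omega))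
  · rcases genRow_cases z 0 a μ hi j with ⟨h1, e1⟩ | ⟨h1, e1⟩ | ⟨h1, e1⟩ | ⟨h1, e1⟩ | ⟨h1, e1⟩ | ⟨h1, e1⟩ | ⟨h1, e1⟩ <;>
    rcases genRow_cases z' 0 a μ' hi' (j - 1) with ⟨h2, e2⟩ | ⟨h2, e2⟩ | ⟨h2, e2⟩ | ⟨h2, e2⟩ | ⟨h2, e2⟩ | ⟨h2, e2⟩ | ⟨h2, e2⟩ <;>
    first
    | omega
    | (rw [e1, e2]; first | assumption | (subst h1; rw [show (0 : ℤ) + 1 = 1 from rfl] at e2; rw [e2] at he; exact he) | (simp [NWRule, phase, IsAnchor, hz', hp]; done) | (simp [NWRule, phase, IsAnchor, hz', hp]; omega))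
  · rcases genRow_cases z 0 a μ hi j with ⟨h1, e1⟩ | ⟨h1, e1⟩ | ⟨h1, e1⟩ | ⟨h1, e1⟩ | ⟨h1, e1⟩ | ⟨h1, e1⟩ | ⟨h1, e1⟩ <;>
    rcases genRow_cases z' 0 a μ' hi' (j + 1) with ⟨h2, e2⟩ | ⟨h2, e2⟩ | ⟨h2, e2⟩ | ⟨h2, e2⟩ | ⟨h2, e2⟩ | ⟨h2, e2⟩ | ⟨h2, e2⟩ <;>
    first
    | omega
    | (rw [e1, e2]; first | assumption | (subst h1; rw [show (0 : ℤ) + 1 = 1 from rfl] at e2; rw [e2] at he; exact he) | (simp [NERule, hp]; done) | (simp [NERule, phase, IsAnchor, hz', hp]; done) | (simp [NERule, hp]; done) | (simp [NERule, phase, IsAnchor, hz', hp]; omega))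
  · rcases genRow_cases z 0 a μ hi j with ⟨h1, e1⟩ | ⟨h1, e1⟩ | ⟨h1, e1⟩ | ⟨h1, e1⟩ | ⟨h1, e1⟩ | ⟨h1, e1⟩ | ⟨h1, e1⟩ <;>
    rcases genRow_cases z' 0 a μ' hi' j with ⟨h2, e2⟩ | ⟨h2, e2⟩ | ⟨h2, e2⟩ | ⟨h2, e2⟩ | ⟨h2, e2⟩ | ⟨h2, e2⟩ | ⟨h2, e2⟩ <;>
    first
    | omega
    | (rw [e1, e2]; first | assumption | (subst h1; rw [show (0 : ℤ) + 1 = 1 from rfl] at e2; rw [e2] at he; exact he) | (simp [VRule, phase, IsAnchor, hz', hp]; done) | (simp [VRule, phase, IsAnchor, hz', hp]; omega))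
  · rcases genRow_cases z 0 a μ hi j with ⟨h1, e1⟩ | ⟨h1, e1⟩ | ⟨h1, e1⟩ | ⟨h1, e1⟩ | ⟨h1, e1⟩ | ⟨h1, e1⟩ | ⟨h1, e1⟩ <;>
    rcases genRow_cases z' 0 a μ' hi' (j - 1) with ⟨h2, e2⟩ | ⟨h2, e2⟩ | ⟨h2, e2⟩ | ⟨h2, e2⟩ | ⟨h2, e2⟩ | ⟨h2, e2⟩ | ⟨h2, e2⟩ <;>
    first
    | omega
    | (rw [e1, e2]; first | assumption | (subst h1; rw [show (0 : ℤ) + 1 = 1 from rfl] at e2; rw [e2] at he; exact he) | (simp [NWRule, phase, IsAnchor, hz', hp]; done) | (simp [NWRule, phase, IsAnchor, hz', hp]; omega))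
  · rcases genRow_cases z 0 a μ hi j with ⟨h1, e1⟩ | ⟨h1, e1⟩ | ⟨h1, e1⟩ | ⟨h1, e1⟩ | ⟨h1, e1⟩ | ⟨h1, e1⟩ | ⟨h1, e1⟩ <;>
    rcases genRow_cases z' 0 a μ' hi' (j + 1) with ⟨h2, e2⟩ | ⟨h2, e2⟩ | ⟨h2, e2⟩ | ⟨h2, e2⟩ | ⟨h2, e2⟩ | ⟨h2, e2⟩ | ⟨h2, e2⟩ <;>
    first
    | omega
    | (rw [e1, e2]; first | assumption | (subst h1; rw [show (0 : ℤ) + 1 = 1 from rfl] at e2; rw [e2] at he; exact he) | (simp [NERule, hp]; done) | (simp [NERule, phase, IsAnchor, hz', hp]; done) | (simp [NERule, hp]; done) | (simp [NERule, phase, IsAnchor, hz', hp]; omega))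

theorem above_genRow {c : ι} {k : ℕ} {hk : k < G.C c} {hk' r} {q : ℤ} (hq : 0 < q) (hqμ : q < μ)
    (hs : Succ G.B μ i μ' i') :
    G.Above (G.genRow W q (L c k hk r) μ i hi) (G.genRow W q (L c (k + 1) hk' r) μ' i' hi') := by
  rcases hs with ⟨hμ, rfl⟩ | ⟨hB, hμ, rfl⟩ <;> intro j <;> refine ⟨?_, ?_, ?_⟩
  · rcases genRow_cases W q (L c k hk r) μ hi j with ⟨h1, e1⟩ | ⟨h1, e1⟩ | ⟨h1, e1⟩ | ⟨h1, e1⟩ | ⟨h1, e1⟩ | ⟨h1, e1⟩ | ⟨h1, e1⟩ <;>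
    rcases genRow_cases W q (L c (k + 1) hk' r) μ' hi' j with ⟨h2, e2⟩ | ⟨h2, e2⟩ | ⟨h2, e2⟩ | ⟨h2, e2⟩ | ⟨h2, e2⟩ | ⟨h2, e2⟩ | ⟨h2, e2⟩ <;>
    first
    | omega
    | (rw [e1, e2]; first | (simp [VRule, phase, IsAnchor, hk']; done) | (simp [VRule, phase, IsAnchor, hk']; omega))
  · rcases genRow_cases W q (L c k hk r) μ hi j with ⟨h1, e1⟩ | ⟨h1, e1⟩ | ⟨h1, e1⟩ | ⟨h1, e1⟩ | ⟨h1, e1⟩ | ⟨h1, e1⟩ | ⟨h1, e1⟩ <;>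
    rcases genRow_cases W q (L c (k + 1) hk' r) μ' hi' (j - 1) with ⟨h2, e2⟩ | ⟨h2, e2⟩ | ⟨h2, e2⟩ | ⟨h2, e2⟩ | ⟨h2, e2⟩ | ⟨h2, e2⟩ | ⟨h2, e2⟩ <;>
    first
    | omega
    | (rw [e1, e2]; first | (simp [NWRule, phase, IsAnchor, hk']; done) | (simp [NWRule, phase, IsAnchor, hk']; omega))
  · rcases genRow_cases W q (L c k hk r) μ hi j with ⟨h1, e1⟩ | ⟨h1, e1⟩ | ⟨h1, e1⟩ | ⟨h1, e1⟩ | ⟨h1, e1⟩ | ⟨h1, e1⟩ | ⟨h1, e1⟩ <;>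
    rcases genRow_cases W q (L c (k + 1) hk' r) μ' hi' (j + 1) with ⟨h2, e2⟩ | ⟨h2, e2⟩ | ⟨h2, e2⟩ | ⟨h2, e2⟩ | ⟨h2, e2⟩ | ⟨h2, e2⟩ | ⟨h2, e2⟩ <;>
    first
    | omega
    | (rw [e1, e2]; first | (simp [NERule, phase, IsAnchor, hk']; done) | (simp [NERule, phase, IsAnchor, hk']; omega))
  · rcases genRow_cases W q (L c k hk r) μ hi j with ⟨h1, e1⟩ | ⟨h1, e1⟩ | ⟨h1, e1⟩ | ⟨h1, e1⟩ | ⟨h1, e1⟩ | ⟨h1, e1⟩ | ⟨h1, e1⟩ <;>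
    rcases genRow_cases W q (L c (k + 1) hk' r) μ' hi' j with ⟨h2, e2⟩ | ⟨h2, e2⟩ | ⟨h2, e2⟩ | ⟨h2, e2⟩ | ⟨h2, e2⟩ | ⟨h2, e2⟩ | ⟨h2, e2⟩ <;>
    first
    | omega
    | (rw [e1, e2]; first | (simp [VRule, phase, IsAnchor, hk']; done) | (simp [VRule, phase, IsAnchor, hk']; omega))
  · rcases genRow_cases W q (L c k hk r) μ hi j with ⟨h1, e1⟩ | ⟨h1, e1⟩ | ⟨h1, e1⟩ | ⟨h1, e1⟩ | ⟨h1, e1⟩ | ⟨h1, e1⟩ | ⟨h1, e1⟩ <;>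
    rcases genRow_cases W q (L c (k + 1) hk' r) μ' hi' (j - 1) with ⟨h2, e2⟩ | ⟨h2, e2⟩ | ⟨h2, e2⟩ | ⟨h2, e2⟩ | ⟨h2, e2⟩ | ⟨h2, e2⟩ | ⟨h2, e2⟩ <;>
    first
    | omega
    | (rw [e1, e2]; first | (simp [NWRule, phase, IsAnchor, hk']; done) | (simp [NWRule, phase, IsAnchor, hk']; omega))
  · rcases genRow_cases W q (L c k hk r) μ hi j with ⟨h1, e1⟩ | ⟨h1, e1⟩ | ⟨h1, e1⟩ | ⟨h1, e1⟩ | ⟨h1, e1⟩ | ⟨h1, e1⟩ | ⟨h1, e1⟩ <;>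
    rcases genRow_cases W q (L c (k + 1) hk' r) μ' hi' (j + 1) with ⟨h2, e2⟩ | ⟨h2, e2⟩ | ⟨h2, e2⟩ | ⟨h2, e2⟩ | ⟨h2, e2⟩ | ⟨h2, e2⟩ | ⟨h2, e2⟩ <;>
    first
    | omega
    | (rw [e1, e2]; first | (simp [NERule, phase, IsAnchor, hk']; done) | (simp [NERule, phase, IsAnchor, hk']; omega))

theorem above_genRow_sub_one {c : ι} {k : ℕ} {hk : k < G.C c} {hk' r} {q : ℤ} (hq : 1 < q)
    (hqμ : q < μ) (hkC : k + 1 = G.C c) (hs : Succ G.B μ i μ' i') :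
    G.Above (G.genRow W q (L c k hk r) μ i hi)
      (G.genRow W (q - 1) (L c 0 hk' (r - 1)) μ' i' hi') := by
  rcases hs with ⟨hμ, rfl⟩ | ⟨hB, hμ, rfl⟩ <;> intro j <;> refine ⟨?_, ?_, ?_⟩
  · rcases genRow_cases W q (L c k hk r) μ hi j with ⟨h1, e1⟩ | ⟨h1, e1⟩ | ⟨h1, e1⟩ | ⟨h1, e1⟩ | ⟨h1, e1⟩ | ⟨h1, e1⟩ | ⟨h1, e1⟩ <;>
    rcases genRow_cases W (q - 1) (L c 0 hk' (r - 1)) μ' hi' j with ⟨h2, e2⟩ | ⟨h2, e2⟩ | ⟨h2, e2⟩ | ⟨h2, e2⟩ | ⟨h2, e2⟩ | ⟨h2, e2⟩ | ⟨h2, e2⟩ <;>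
    first
    | omega
    | (rw [e1, e2]; first | (simp [VRule, phase, IsAnchor, hkC, hk']; done) | (simp [VRule, phase, IsAnchor, hkC, hk']; omega))
  · rcases genRow_cases W q (L c k hk r) μ hi j with ⟨h1, e1⟩ | ⟨h1, e1⟩ | ⟨h1, e1⟩ | ⟨h1, e1⟩ | ⟨h1, e1⟩ | ⟨h1, e1⟩ | ⟨h1, e1⟩ <;>
    rcases genRow_cases W (q - 1) (L c 0 hk' (r - 1)) μ' hi' (j - 1) with ⟨h2, e2⟩ | ⟨h2, e2⟩ | ⟨h2, e2⟩ | ⟨h2, e2⟩ | ⟨h2, e2⟩ | ⟨h2, e2⟩ | ⟨h2, e2⟩ <;>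
    first
    | omega
    | (rw [e1, e2]; first | (simp [NWRule, phase, IsAnchor, hkC, hk']; done) | (simp [NWRule, phase, IsAnchor, hkC, hk']; omega))
  · rcases genRow_cases W q (L c k hk r) μ hi j with ⟨h1, e1⟩ | ⟨h1, e1⟩ | ⟨h1, e1⟩ | ⟨h1, e1⟩ | ⟨h1, e1⟩ | ⟨h1, e1⟩ | ⟨h1, e1⟩ <;>
    rcases genRow_cases W (q - 1) (L c 0 hk' (r - 1)) μ' hi' (j + 1) with ⟨h2, e2⟩ | ⟨h2, e2⟩ | ⟨h2, e2⟩ | ⟨h2, e2⟩ | ⟨h2, e2⟩ | ⟨h2, e2⟩ | ⟨h2, e2⟩ <;>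
    first
    | omega
    | (rw [e1, e2]; first | (simp [NERule, phase, IsAnchor, hkC, hk']; done) | (simp [NERule, phase, IsAnchor, hkC, hk']; omega))
  · rcases genRow_cases W q (L c k hk r) μ hi j with ⟨h1, e1⟩ | ⟨h1, e1⟩ | ⟨h1, e1⟩ | ⟨h1, e1⟩ | ⟨h1, e1⟩ | ⟨h1, e1⟩ | ⟨h1, e1⟩ <;>
    rcases genRow_cases W (q - 1) (L c 0 hk' (r - 1)) μ' hi' j with ⟨h2, e2⟩ | ⟨h2, e2⟩ | ⟨h2, e2⟩ | ⟨h2, e2⟩ | ⟨h2, e2⟩ | ⟨h2, e2⟩ | ⟨h2, e2⟩ <;>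
    first
    | omega
    | (rw [e1, e2]; first | (simp [VRule, phase, IsAnchor, hkC, hk']; done) | (simp [VRule, phase, IsAnchor, hkC, hk']; omega))
  · rcases genRow_cases W q (L c k hk r) μ hi j with ⟨h1, e1⟩ | ⟨h1, e1⟩ | ⟨h1, e1⟩ | ⟨h1, e1⟩ | ⟨h1, e1⟩ | ⟨h1, e1⟩ | ⟨h1, e1⟩ <;>
    rcases genRow_cases W (q - 1) (L c 0 hk' (r - 1)) μ' hi' (j - 1) with ⟨h2, e2⟩ | ⟨h2, e2⟩ | ⟨h2, e2⟩ | ⟨h2, e2⟩ | ⟨h2, e2⟩ | ⟨h2, e2⟩ | ⟨h2, e2⟩ <;>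
    first
    | omega
    | (rw [e1, e2]; first | (simp [NWRule, phase, IsAnchor, hkC, hk']; done) | (simp [NWRule, phase, IsAnchor, hkC, hk']; omega))
  · rcases genRow_cases W q (L c k hk r) μ hi j with ⟨h1, e1⟩ | ⟨h1, e1⟩ | ⟨h1, e1⟩ | ⟨h1, e1⟩ | ⟨h1, e1⟩ | ⟨h1, e1⟩ | ⟨h1, e1⟩ <;>
    rcases genRow_cases W (q - 1) (L c 0 hk' (r - 1)) μ' hi' (j + 1) with ⟨h2, e2⟩ | ⟨h2, e2⟩ | ⟨h2, e2⟩ | ⟨h2, e2⟩ | ⟨h2, e2⟩ | ⟨h2, e2⟩ | ⟨h2, e2⟩ <;>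
    first
    | omega
    | (rw [e1, e2]; first | (simp [NERule, phase, IsAnchor, hkC, hk']; done) | (simp [NERule, phase, IsAnchor, hkC, hk']; omega))

theorem above_genRow_one {c : ι} {k : ℕ} {hk : k < G.C c} {hk'}
    (hqμ : 1 < μ) (hkC : k + 1 = G.C c) (hs : Succ G.B μ i μ' i') :
    G.Above (G.genRow W 1 (L c k hk 1) μ i hi) (G.genRow (P c 0 hk') 0 a μ' i' hi') := by
  rcases hs with ⟨hμ, rfl⟩ | ⟨hB, hμ, rfl⟩ <;> intro j <;> refine ⟨?_, ?_, ?_⟩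
  · rcases genRow_cases W 1 (L c k hk 1) μ hi j with ⟨h1, e1⟩ | ⟨h1, e1⟩ | ⟨h1, e1⟩ | ⟨h1, e1⟩ | ⟨h1, e1⟩ | ⟨h1, e1⟩ | ⟨h1, e1⟩ <;>
    rcases genRow_cases (P c 0 hk') 0 a μ' hi' j with ⟨h2, e2⟩ | ⟨h2, e2⟩ | ⟨h2, e2⟩ | ⟨h2, e2⟩ | ⟨h2, e2⟩ | ⟨h2, e2⟩ | ⟨h2, e2⟩ <;>
    first
    | omega
    | (rw [e1, e2]; first | (simp [VRule, phase, IsAnchor, hkC, hk']; done) | (simp [VRule, phase, IsAnchor, hkC, hk']; omega))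
  · rcases genRow_cases W 1 (L c k hk 1) μ hi j with ⟨h1, e1⟩ | ⟨h1, e1⟩ | ⟨h1, e1⟩ | ⟨h1, e1⟩ | ⟨h1, e1⟩ | ⟨h1, e1⟩ | ⟨h1, e1⟩ <;>
    rcases genRow_cases (P c 0 hk') 0 a μ' hi' (j - 1) with ⟨h2, e2⟩ | ⟨h2, e2⟩ | ⟨h2, e2⟩ | ⟨h2, e2⟩ | ⟨h2, e2⟩ | ⟨h2, e2⟩ | ⟨h2, e2⟩ <;>
    first
    | omega
    | (rw [e1, e2]; first | (simp [NWRule, phase, IsAnchor, hkC, hk']; done) | (simp [NWRule, phase, IsAnchor, hkC, hk']; omega))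
  · rcases genRow_cases W 1 (L c k hk 1) μ hi j with ⟨h1, e1⟩ | ⟨h1, e1⟩ | ⟨h1, e1⟩ | ⟨h1, e1⟩ | ⟨h1, e1⟩ | ⟨h1, e1⟩ | ⟨h1, e1⟩ <;>
    rcases genRow_cases (P c 0 hk') 0 a μ' hi' (j + 1) with ⟨h2, e2⟩ | ⟨h2, e2⟩ | ⟨h2, e2⟩ | ⟨h2, e2⟩ | ⟨h2, e2⟩ | ⟨h2, e2⟩ | ⟨h2, e2⟩ <;>
    first
    | omega
    | (rw [e1, e2]; first | (simp [NERule, phase, IsAnchor, hkC, hk']; done) | (simp [NERule, phase, IsAnchor, hkC, hk']; omega))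
  · rcases genRow_cases W 1 (L c k hk 1) μ hi j with ⟨h1, e1⟩ | ⟨h1, e1⟩ | ⟨h1, e1⟩ | ⟨h1, e1⟩ | ⟨h1, e1⟩ | ⟨h1, e1⟩ | ⟨h1, e1⟩ <;>
    rcases genRow_cases (P c 0 hk') 0 a μ' hi' j with ⟨h2, e2⟩ | ⟨h2, e2⟩ | ⟨h2, e2⟩ | ⟨h2, e2⟩ | ⟨h2, e2⟩ | ⟨h2, e2⟩ | ⟨h2, e2⟩ <;>
    first
    | omega
    | (rw [e1, e2]; first | (simp [VRule, phase, IsAnchor, hkC, hk']; done) | (simp [VRule, phase, IsAnchor, hkC, hk']; omega))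
  · rcases genRow_cases W 1 (L c k hk 1) μ hi j with ⟨h1, e1⟩ | ⟨h1, e1⟩ | ⟨h1, e1⟩ | ⟨h1, e1⟩ | ⟨h1, e1⟩ | ⟨h1, e1⟩ | ⟨h1, e1⟩ <;>
    rcases genRow_cases (P c 0 hk') 0 a μ' hi' (j - 1) with ⟨h2, e2⟩ | ⟨h2, e2⟩ | ⟨h2, e2⟩ | ⟨h2, e2⟩ | ⟨h2, e2⟩ | ⟨h2, e2⟩ | ⟨h2, e2⟩ <;>
    first
    | omega
    | (rw [e1, e2]; first | (simp [NWRule, phase, IsAnchor, hkC, hk']; done) | (simp [NWRule, phase, IsAnchor, hkC, hk']; omega))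
  · rcases genRow_cases W 1 (L c k hk 1) μ hi j with ⟨h1, e1⟩ | ⟨h1, e1⟩ | ⟨h1, e1⟩ | ⟨h1, e1⟩ | ⟨h1, e1⟩ | ⟨h1, e1⟩ | ⟨h1, e1⟩ <;>
    rcases genRow_cases (P c 0 hk') 0 a μ' hi' (j + 1) with ⟨h2, e2⟩ | ⟨h2, e2⟩ | ⟨h2, e2⟩ | ⟨h2, e2⟩ | ⟨h2, e2⟩ | ⟨h2, e2⟩ | ⟨h2, e2⟩ <;>
    first
    | omega
    | (rw [e1, e2]; first | (simp [NERule, phase, IsAnchor, hkC, hk']; done) | (simp [NERule, phase, IsAnchor, hkC, hk']; omega))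

theorem above_horRow {z z' : G.Tile} {n : ℕ} {c d} (hv : VRule z z') (hw : NWRule z o)
    (hz' : ¬ IsAnchor z') (hp : phase z' = none) (he : NERule z (Tile.h c 1)) (hn : 1 < n)
    (hs : Succ G.B μ i n 0) :
    G.Above (G.genRow z 0 a μ i hi) (G.horRow z' n c d) := by
  have hn0 : 0 < (n : ℤ) := by omega
  obtain ⟨rfl, h⟩ | ⟨hB, hμ, -⟩ := hs
  · omega
  intro j
  refine ⟨?_, ?_, ?_⟩
  · rcases genRow_cases z 0 a μ hi j with ⟨h1, e1⟩ | ⟨h1, e1⟩ | ⟨h1, e1⟩ | ⟨h1, e1⟩ | ⟨h1, e1⟩ | ⟨h1, e1⟩ | ⟨h1, e1⟩ <;>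
    rcases horRow_cases z' hn0 c d j with ⟨h2, e2⟩ | ⟨h2, e2⟩ | ⟨h2, e2⟩ | ⟨h2, e2⟩ | ⟨h2, e2⟩ <;>
    first
    | omega
    | (rw [e1, e2]; first | assumption | (subst h1; simpa using he) | (simp [VRule, phase, IsAnchor, hz', hp, hB]; done) | (simp [VRule, phase, IsAnchor, hz', hp, hB]; omega))
  · rcases genRow_cases z 0 a μ hi j with ⟨h1, e1⟩ | ⟨h1, e1⟩ | ⟨h1, e1⟩ | ⟨h1, e1⟩ | ⟨h1, e1⟩ | ⟨h1, e1⟩ | ⟨h1, e1⟩ <;>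
    rcases horRow_cases z' hn0 c d (j - 1) with ⟨h2, e2⟩ | ⟨h2, e2⟩ | ⟨h2, e2⟩ | ⟨h2, e2⟩ | ⟨h2, e2⟩ <;>
    first
    | omega
    | (rw [e1, e2]; first | assumption | (subst h1; simpa using he) | (simp [NWRule, phase, IsAnchor, hz', hp, hB]; done) | (simp [NWRule, phase, IsAnchor, hz', hp, hB]; omega))
  · rcases genRow_cases z 0 a μ hi j with ⟨h1, e1⟩ | ⟨h1, e1⟩ | ⟨h1, e1⟩ | ⟨h1, e1⟩ | ⟨h1, e1⟩ | ⟨h1, e1⟩ | ⟨h1, e1⟩ <;>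
    rcases horRow_cases z' hn0 c d (j + 1) with ⟨h2, e2⟩ | ⟨h2, e2⟩ | ⟨h2, e2⟩ | ⟨h2, e2⟩ | ⟨h2, e2⟩ <;>
    first
    | omega
    | (rw [e1, e2]; first | assumption | (subst h1; simpa using he) | (simp [NERule, hp]; done) | (simp [NERule, phase, IsAnchor, hz', hp, hB]; done) | (simp [NERule, hp]; done) | (simp [NERule, phase, IsAnchor, hz', hp, hB]; omega))

theorem horRow_above {z : G.Tile} {n : ℕ} {c d} (hv : VRule z W) (hw : NWRule z o)
    (he : ∀ t, phase t = none → NERule z t) (hn : 1 < n) (hT : G.T c n d) (hk) (hi : 1 < G.B) :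
    G.Above (G.horRow z n c d) (G.genRow W (n - 1 : ℤ) (L d 0 hk (n - 1)) n 1 hi) := by
  have hn0 : 0 < (n : ℤ) := by omega
  intro j
  refine ⟨?_, ?_, ?_⟩
  · rcases horRow_cases z hn0 c d j with ⟨h1, e1⟩ | ⟨h1, e1⟩ | ⟨h1, e1⟩ | ⟨h1, e1⟩ | ⟨h1, e1⟩ <;>
    rcases genRow_cases W (n - 1 : ℤ) (L d 0 hk (n - 1)) n hi j with ⟨h2, e2⟩ | ⟨h2, e2⟩ | ⟨h2, e2⟩ | ⟨h2, e2⟩ | ⟨h2, e2⟩ | ⟨h2, e2⟩ | ⟨h2, e2⟩ <;>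
    first
    | omega
    | (rw [e1, e2]; first | assumption | (exact he _ rfl) | (simp [VRule, phase, IsAnchor, hT, hk, hi]; done) | (simp [VRule, phase, IsAnchor, hT, hk, hi]; omega))
  · rcases horRow_cases z hn0 c d j with ⟨h1, e1⟩ | ⟨h1, e1⟩ | ⟨h1, e1⟩ | ⟨h1, e1⟩ | ⟨h1, e1⟩ <;>
    rcases genRow_cases W (n - 1 : ℤ) (L d 0 hk (n - 1)) n hi (j - 1) with ⟨h2, e2⟩ | ⟨h2, e2⟩ | ⟨h2, e2⟩ | ⟨h2, e2⟩ | ⟨h2, e2⟩ | ⟨h2, e2⟩ | ⟨h2, e2⟩ <;>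
    first
    | omega
    | (rw [e1, e2]; first | assumption | (exact he _ rfl) | (simp [NWRule, phase, IsAnchor, hT, hk, hi]; done) | (simp [NWRule, phase, IsAnchor, hT, hk, hi]; omega))
  · rcases horRow_cases z hn0 c d j with ⟨h1, e1⟩ | ⟨h1, e1⟩ | ⟨h1, e1⟩ | ⟨h1, e1⟩ | ⟨h1, e1⟩ <;>
    rcases genRow_cases W (n - 1 : ℤ) (L d 0 hk (n - 1)) n hi (j + 1) with ⟨h2, e2⟩ | ⟨h2, e2⟩ | ⟨h2, e2⟩ | ⟨h2, e2⟩ | ⟨h2, e2⟩ | ⟨h2, e2⟩ | ⟨h2, e2⟩ <;>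
    first
    | omega
    | (rw [e1, e2]; first | assumption | (exact he _ rfl) | (simp [NERule, phase, IsAnchor, hT, hk, hi]; done) | (simp [NERule, phase, IsAnchor, hT, hk, hi]; omega))

end Soundness

end Drawing
end Geometry

section Geometry

open Function

namespace Drawing

open Tile

variable {ι : Type} {G : Drawing ι}

@[simp] theorem genRow_zero (z : G.Tile) (q : ℤ) (l : G.Tile) (μ : ℤ) {i : ℕ} (hi : i < G.B) :
    G.genRow z q l μ i hi 0 = z := by simp [genRow]

theorem genRow_left (z : G.Tile) {q : ℤ} (l : G.Tile) (μ : ℤ) {i : ℕ} (hi : i < G.B) {j : ℤ}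
    (h0 : 0 < j) (hq : j < q) : G.genRow z q l μ i hi j = a := by
  simp [genRow, h0.ne', h0.not_gt, hq]

theorem genRow_line (z : G.Tile) {q : ℤ} (l : G.Tile) (μ : ℤ) {i : ℕ} (hi : i < G.B)
    (hq : 0 < q) : G.genRow z q l μ i hi q = l := by simp [genRow, hq.ne', hq.not_gt]

theorem genRow_right (z : G.Tile) {q : ℤ} (l : G.Tile) {μ : ℤ} {i : ℕ} (hi : i < G.B)
    (hq : 0 ≤ q) (hμ : q < μ) : G.genRow z q l μ i hi μ = M i hi := by
  have h0 : 0 < μ := hq.trans_lt hμ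
  simp [genRow, h0.ne', h0.not_gt, hμ.ne', hμ.not_gt]

@[simp] theorem horRow_zero (z : G.Tile) (n : ℤ) (c d) : G.horRow z n c d 0 = z := by
  simp [horRow]

theorem horRow_right (z : G.Tile) {n : ℤ} (hn : 0 < n) (c d) : G.horRow z n c d n = N c n d := by
  simp [horRow, hn.ne', hn.not_gt]

namespace Above

variable {ρ ρ' : ℤ → G.Tile} (ha : G.Above ρ ρ')
include ha

theorem phase_eq {μ μ' : ℤ} {i i' : ℕ} (h : phase (ρ μ) = some i) (hs : Succ G.B μ i μ' i')
    (hi' : i' < G.B) : phase (ρ' μ') = some i' := by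
  have hB := G.two_le_B
  obtain ⟨hv, -, hn⟩ := ha μ
  revert h hv hn
  cases ρ μ <;> simp only [phase, reduceCtorEq, false_imp_iff, Option.some.injEq] <;> intro h hv hn
  · subst h
    rcases hs with ⟨rfl, rfl⟩ | ⟨hB, rfl, rfl⟩
    · rcases hv with ⟨_, hv⟩ | ⟨hv, -⟩
      · rw [hv]
      · omega
    · exact hn.1 hB
  · subst h
    rcases hs with ⟨rfl, rfl⟩ | ⟨hB, rfl, rfl⟩
    · obtain ⟨_, hv⟩ := hv
      rw [hv]
    · omega

theorem axis_eq {p : ℤ} (h1 : ρ p = W) (h2 : NWRule (ρ (p + 1)) (ρ' p) → ¬ IsAnchor (ρ' p)) :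
    ρ' p = W := by
  obtain ⟨hv, -, -⟩ := ha p
  obtain ⟨-, hw, -⟩ := ha (p + 1)
  rw [add_sub_cancel_right] at hw
  rw [h1] at hv
  refine hv.resolve_right ?_
  rintro ⟨c, hj, h⟩
  refine h2 hw ?_
  rw [h]
  rfl

variable (hr : G.IsRow ρ')
include hr

theorem of_horRow {z : G.Tile} {n : ℕ} {c d} (hρ : ρ = G.horRow z n c d)
    (hz : ∀ t, VRule z t → t = W) (hn : 1 < n) (hd : 0 < G.C d) (hB : 1 < G.B) :
    G.T c n d ∧ ρ' = G.genRow W (n - 1 : ℤ) (L d 0 hd (n - 1)) n 1 hB := by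
  have hn0 : (0 : ℤ) < n := by omega
  have h0 : ρ' 0 = W := hz _ (by simpa [hρ] using (ha 0).1)
  obtain ⟨hv, hw, -⟩ := ha n
  rw [hρ, horRow_right _ hn0] at hv hw
  obtain ⟨_, hv⟩ := hv
  obtain ⟨hT, _, hw⟩ := hw
  rw [Int.cast_natCast] at hT hw
  exact ⟨hT, hr.eq_genRow_of_L hB h0 hw (by omega) (by omega) (by rw [hv]; rfl)⟩

variable {μ μ' : ℤ} {i i' : ℕ} {hi : i < G.B}

theorem of_genRow {q : ℤ} {c : ι} {k : ℕ} {hk : k < G.C c} {r}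
    (hρ : ρ = G.genRow W q (L c k hk r) μ i hi) (hq : 0 < q) (hμ : q < μ)
    (hs : Succ G.B μ i μ' i') (hi' : i' < G.B) (hk' : k + 1 < G.C c) :
    ρ' = G.genRow W q (L c (k + 1) hk' r) μ' i' hi' := by
  have hM := ha.phase_eq (i := i) (by rw [hρ, genRow_right _ _ _ hq.le hμ]; rfl) hs hi'
  have hμ' : q < μ' := by rcases hs with hs | hs <;> omega
  have h0 : ρ' 0 = W := by
    refine ha.axis_eq (by simp [hρ]) fun h => ?_
    rw [zero_add, hρ] at h
    rcases eq_or_lt_of_le (show 1 ≤ q by omega) with rfl | hq1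
    · rw [genRow_line _ _ _ _ hq] at h
      rcases h with h | ⟨h, -⟩
      · exact h.2
      · omega
    · rwa [genRow_left _ _ _ _ (by omega) hq1] at h
  obtain ⟨hv, -, -⟩ := ha q
  rw [hρ, genRow_line _ _ _ _ hq] at hv
  rcases hv with ⟨_, hv⟩ | ⟨h, -⟩
  · exact hr.eq_genRow_of_L hi' h0 hv hq hμ' hM
  · omega

theorem of_genRow_last {q : ℤ} {c : ι} {k : ℕ} {hk : k < G.C c} {r}
    (hρ : ρ = G.genRow W q (L c k hk r) μ i hi) (hq : 1 < q) (hμ : q < μ)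
    (hs : Succ G.B μ i μ' i') (hi' : i' < G.B) (hkC : k + 1 = G.C c) (hk' : 0 < G.C c) :
    ρ' = G.genRow W (q - 1) (L c 0 hk' (r - 1)) μ' i' hi' := by
  have hM := ha.phase_eq (i := i) (by rw [hρ, genRow_right _ _ _ (by omega) hμ]; rfl) hs hi'
  have hμ' : q ≤ μ' := by rcases hs with hs | hs <;> omega
  have h0 : ρ' 0 = W := by
    refine ha.axis_eq (by simp [hρ]) fun h => ?_
    rw [zero_add, hρ] at h
    rwa [genRow_left _ _ _ _ (by omega) hq] at h
  obtain ⟨-, hw, -⟩ := ha q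
  rw [hρ, genRow_line _ _ _ _ (by omega)] at hw
  rcases hw with ⟨h, -⟩ | ⟨-, ⟨_, hw⟩ | ⟨-, _, hw⟩⟩
  · exact absurd hkC h
  · exact hr.eq_genRow_of_L hi' h0 hw (by omega) (by omega) hM
  · exact absurd (by rw [hw]; trivial) (hr.not_axis (p := 0) (by simp [h0]) (j := q - 1) (by omega))

theorem of_genRow_one {c : ι} {k : ℕ} {hk : k < G.C c} {r}
    (hρ : ρ = G.genRow W 1 (L c k hk r) μ i hi) (hμ : 1 < μ)
    (hs : Succ G.B μ i μ' i') (hi' : i' < G.B) (hkC : k + 1 = G.C c) (hk' : 0 < G.C c) :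
    ρ' = G.genRow (P c 0 hk') 0 a μ' i' hi' := by
  have hM := ha.phase_eq (i := i) (by rw [hρ, genRow_right _ _ _ (by omega) hμ]; rfl) hs hi'
  obtain ⟨hv, hw, -⟩ := ha 1
  obtain ⟨hv0, -, -⟩ := ha 0
  rw [hρ, genRow_line _ _ _ _ one_pos] at hv hw
  rw [hρ, genRow_zero] at hv0
  rw [sub_self] at hw
  refine hr.eq_genRow hi' trivial ?_ (Or.inl ?_) (by rcases hs with hs | hs <;> omega) hM
  · rcases hw with ⟨h, -⟩ | ⟨-, ⟨_, hw⟩ | ⟨-, _, hw⟩⟩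
    · exact absurd hkC h
    · rw [hw] at hv0
      rcases hv0 with h | ⟨_, _, h⟩ <;> simp at h
    · exact hw
  · rcases hv with ⟨_, -⟩ | ⟨-, hv⟩
    · omega
    · exact hv

theorem of_genRow_zero {z z' : G.Tile} (hρ : ρ = G.genRow z 0 a μ i hi) (h0 : ρ' 0 = z')
    (hz' : IsAxis z') (h : HRule z' (ρ' 1) → ρ' 1 = b ∨ ∃ k hk, ρ' 1 = M k hk) (hμ : 0 < μ)
    (hs : Succ G.B μ i μ' i') (hi' : i' < G.B) : ρ' = G.genRow z' 0 a μ' i' hi' := by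
  have hM := ha.phase_eq (i := i) (by rw [hρ, genRow_right _ _ _ le_rfl hμ]; rfl) hs hi'
  exact hr.eq_genRow hi' hz' h0 (h (by simpa [h0] using hr 0))
    (by rcases hs with hs | hs <;> omega) hM

theorem to_horRow {z z' : G.Tile} {c} (hρ : ρ = G.genRow z 0 a μ i hi) (h0 : ρ' 0 = z')
    (hz' : IsAxis z') (h : HRule z' (ρ' 1) → ρ' 1 = h c 1) (hμ : 0 < μ)
    (hs : Succ G.B μ i μ' i') (hi' : i' < G.B) (hμ' : 1 < μ') : i' = 0 ∧ ∃ d, ρ' = G.horRow z' μ' c d := by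
  have hM := ha.phase_eq (i := i) (by rw [hρ, genRow_right _ _ _ le_rfl hμ]; rfl) hs hi'
  exact hr.eq_horRow hz' h0 (h (by simpa [h0] using hr 0)) hμ' hM

end Above

end Drawing
end Geometry

section Geometry

open Function

namespace Drawing

open Tile

variable {ι : Type} {G : Drawing ι}

theorem B_pos (G : Drawing ι) : 0 < G.B := two_pos.trans_le G.two_le_B

theorem emod_toNat_lt (G : Drawing ι) (y : ℤ) : (y % G.B).toNat < G.B := by
  have := G.B_pos
  have := Int.emod_lt_of_pos y (show (0 : ℤ) < G.B by omega)
  omega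

variable (G) in
/-- A row at height `y`. -/
def gRow (z : G.Tile) (q : ℤ) (l : G.Tile) (y : ℤ) : ℤ → G.Tile :=
  G.genRow z q l (y / G.B) (y % G.B).toNat (G.emod_toNat_lt y)

theorem gRow_eq {z : G.Tile} {q : ℤ} {l : G.Tile} {y μ : ℤ} {i : ℕ} (hi : i < G.B)
    (hy : y = G.B * μ + i) : G.gRow z q l y = G.genRow z q l μ i hi := by
  have hB := G.B_pos
  obtain ⟨h1, h2⟩ := (Int.ediv_emod_unique (a := y) (b := G.B) (q := μ) (r := i) (by omega)).2
    ⟨by rw [hy]; ring, by omega, by omega⟩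
  have h3 : (y % G.B).toNat = i := by omega
  unfold gRow
  congr

theorem exists_eq (G : Drawing ι) (y : ℤ) : ∃ (μ : ℤ) (i : ℕ), i < G.B ∧ y = G.B * μ + i := by
  have hB := G.B_pos
  refine ⟨y / G.B, (y % G.B).toNat, G.emod_toNat_lt y, ?_⟩
  rw [Int.toNat_of_nonneg (Int.emod_nonneg _ (by omega))]
  exact (Int.mul_ediv_add_emod y G.B).symm

theorem succ_of_eq {B : ℕ} {μ μ' : ℤ} {i i' : ℕ} (hi : i < B) (hi' : i' < B)
    (h : (B : ℤ) * μ + i + 1 = B * μ' + i') : Succ B μ i μ' i' := by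
  have hB : 0 < B := by omega
  rcases lt_trichotomy μ μ' with hμ | rfl | hμ
  · have : (B : ℤ) * (μ + 1) ≤ B * μ' := by gcongr; omega
    rw [mul_add] at this
    have : i + 1 = B := by omega
    refine Or.inr ⟨this, ?_, by omega⟩
    have : (B : ℤ) * (μ + 1) = B * μ' := by rw [mul_add]; omega
    exact (mul_left_cancel₀ (by omega) this).symm
  · exact Or.inl ⟨rfl, by omega⟩
  · have : (B : ℤ) * (μ' + 1) ≤ B * μ := by gcongr; omega
    rw [mul_add] at this
    omega

theorem C_pos (G : Drawing ι) (d : ι) : 0 < G.C d := two_pos.trans_le (G.two_le_C d)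

variable (G) in
/-- The row at distance `s + 1` above the row with a horizontal line up to column `n`, when
the next multiplication is labelled `d`. -/
def lineRow (n : ℕ) (d : ι) (s : ℕ) : ℤ → G.Tile :=
  if s / G.C d + 1 < n then
    G.gRow W (n - 1 - (s / G.C d : ℕ)) (L d (s % G.C d) (Nat.mod_lt _ (G.C_pos d))
      (n - 1 - (s / G.C d : ℕ))) (G.B * n + 1 + s)
  else G.gRow (P d (s % G.C d) (Nat.mod_lt _ (G.C_pos d))) 0 a (G.B * n + 1 + s)

theorem lineRow_eq {n : ℕ} {d : ι} {s u j : ℕ} (hs : s = G.C d * u + j) (hj : j < G.C d)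
    (hu : u + 1 < n) : G.lineRow n d s =
      G.gRow W (n - 1 - u) (L d j hj (n - 1 - u)) (G.B * n + 1 + s) := by
  have h1 : s / G.C d = u := by
    rw [hs, Nat.mul_add_div (G.C_pos d), Nat.div_eq_of_lt hj, add_zero]
  have h2 : s % G.C d = j := by rw [hs, Nat.mul_add_mod, Nat.mod_eq_of_lt hj]
  subst h1 h2
  exact if_pos hu

theorem lineRow_eq_axis {n : ℕ} {d : ι} {s u j : ℕ} (hs : s = G.C d * u + j) (hj : j < G.C d)
    (hu : n = u + 1) : G.lineRow n d s = G.gRow (P d j hj) 0 a (G.B * n + 1 + s) := by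
  have h1 : s / G.C d = u := by
    rw [hs, Nat.mul_add_div (G.C_pos d), Nat.div_eq_of_lt hj, add_zero]
  have h2 : s % G.C d = j := by rw [hs, Nat.mul_add_mod, Nat.mod_eq_of_lt hj]
  subst h1 h2
  exact if_neg (by omega)

/-- Transitions between rows below which no horizontal line lies. -/
theorem lineRow_rec {n : ℕ} {d : ι} {motive : (ℤ → G.Tile) → (ℤ → G.Tile) → Prop} {s : ℕ}
    (hn : 1 < n) (hs : s + 2 < G.C d * n)
    (h1 : ∀ {q μ μ' : ℤ} {i i' hi hi' k hk hk' r}, 0 < q → q < μ → Succ G.B μ i μ' i' →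
      motive (G.genRow W q (L d k hk r) μ i hi) (G.genRow W q (L d (k + 1) hk' r) μ' i' hi'))
    (h2 : ∀ {q μ μ' : ℤ} {i i' hi hi' k hk hk' r}, 1 < q → q < μ → k + 1 = G.C d →
      Succ G.B μ i μ' i' →
      motive (G.genRow W q (L d k hk r) μ i hi) (G.genRow W (q - 1) (L d 0 hk' (r - 1)) μ' i' hi'))
    (h3 : ∀ {μ μ' : ℤ} {i i' hi hi' k hk hk'}, 1 < μ → k + 1 = G.C d → Succ G.B μ i μ' i' →
      motive (G.genRow W 1 (L d k hk 1) μ i hi) (G.genRow (P d 0 hk') 0 a μ' i' hi'))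
    (h4 : ∀ {μ μ' : ℤ} {i i' hi hi' k hk hk'}, 1 < μ → k + 2 < G.C d → Succ G.B μ i μ' i' →
      motive (G.genRow (P d k hk) 0 a μ i hi) (G.genRow (P d (k + 1) hk') 0 a μ' i' hi')) :
    motive (G.lineRow n d s) (G.lineRow n d (s + 1)) := by
  have hC := G.two_le_C d
  obtain ⟨u, j, hj, hsu⟩ : ∃ u j, j < G.C d ∧ s = G.C d * u + j :=
    ⟨s / G.C d, s % G.C d, Nat.mod_lt _ (G.C_pos d), (Nat.div_add_mod _ _).symm⟩
  have hun : u < n := by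
    by_contra h
    have : G.C d * n ≤ G.C d * u := by gcongr; omega
    omega
  obtain ⟨μ, i, hi, hy⟩ := G.exists_eq (G.B * n + 1 + s)
  obtain ⟨μ', i', hi', hy'⟩ := G.exists_eq (G.B * n + 1 + (s + 1 : ℕ))
  have hsucc : Succ G.B μ i μ' i' := succ_of_eq hi hi' (by push_cast at hy'; omega)
  have hμ : (n : ℤ) ≤ μ := by
    by_contra h
    have : (G.B : ℤ) * (μ + 1) ≤ G.B * n := by gcongr; omega
    rw [mul_add] at this
    omega
  rcases (show j + 1 ≤ G.C d by omega).lt_or_eq with hj' | hj'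
  · rcases (show u + 1 ≤ n by omega).lt_or_eq with hu | hu
    · rw [lineRow_eq hsu hj hu, lineRow_eq (show s + 1 = G.C d * u + (j + 1) by omega) hj' hu,
        gRow_eq hi hy, gRow_eq hi' hy']
      exact h1 (by omega) (by omega) hsucc
    · rw [lineRow_eq_axis hsu hj hu.symm,
        lineRow_eq_axis (show s + 1 = G.C d * u + (j + 1) by omega) hj' hu.symm,
        gRow_eq hi hy, gRow_eq hi' hy']
      subst hu
      rw [mul_add] at hs
      exact h4 (by omega) (by omega) hsucc
  · have hu : u + 1 < n := by
      by_contra h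
      obtain rfl : n = u + 1 := by omega
      rw [mul_add] at hs
      omega
    have hsu' : s + 1 = G.C d * (u + 1) + 0 := by rw [mul_add]; omega
    rw [lineRow_eq hsu hj hu, gRow_eq hi hy]
    rcases (show u + 1 + 1 ≤ n by omega).lt_or_eq with hu' | hu'
    · rw [lineRow_eq hsu' (by omega) hu', gRow_eq hi' hy']
      convert! h2 (hk := hj) (hk' := G.C_pos d) (hi := hi) (hi' := hi') _ _ hj' hsucc using 2
      · push_cast; ring
      · congr 1; push_cast; ring
      · omega
      · omega
    · rw [lineRow_eq_axis hsu' (by omega) hu'.symm, gRow_eq hi' hy']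
      subst hu'
      convert! h3 (hk := hj) (hi := hi) (hi' := hi') _ hj' hsucc using 2
      · push_cast; ring
      · congr 1; push_cast; ring
      · omega

theorem phase_genRow_one (z l : G.Tile) (μ : ℤ) {i : ℕ} (hi : i < G.B) :
    phase (G.genRow z 0 l μ i hi 1) = if μ = 1 then some i else none := by
  rcases genRow_cases z 0 l μ hi 1 with h | h | h | h | h | h | h <;> obtain ⟨h1, h2⟩ := h <;>
    first
    | omega
    | (rw [h2]; simp only [phase]; rw [eq_comm]; simp; omega)

theorem above_lineRow {n : ℕ} {d : ι} {s : ℕ} (hn : 1 < n) (hs : s + 2 < G.C d * n) :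
    G.Above (G.lineRow n d s) (G.lineRow n d (s + 1)) := by
  refine lineRow_rec hn hs above_genRow above_genRow_sub_one above_genRow_one ?_
  intro μ μ' i i' hi hi' k hk hk' hμ hkC hs
  refine above_genRow_axis (Or.inl ⟨hk', rfl⟩) (by simp [NWRule, IsAnchor]) (by simp [IsAnchor]) rfl
    ?_ hs
  simp only [NERule, phase_genRow_one]
  rcases hs with hs | hs <;> rw [if_neg (by omega)] <;> simp

theorem isRow_lineRow {n : ℕ} {d : ι} {s : ℕ} (hn : 1 < n) (hs : s + 1 < G.C d * n) :
    G.IsRow (G.lineRow n d s) := by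
  have hC := G.two_le_C d
  obtain ⟨u, j, hj, hsu⟩ : ∃ u j, j < G.C d ∧ s = G.C d * u + j :=
    ⟨s / G.C d, s % G.C d, Nat.mod_lt _ (G.C_pos d), (Nat.div_add_mod _ _).symm⟩
  have hun : u < n := by
    by_contra h
    have : G.C d * n ≤ G.C d * u := by gcongr; omega
    omega
  obtain ⟨μ, i, hi, hy⟩ := G.exists_eq (G.B * n + 1 + s)
  have hμ : (n : ℤ) ≤ μ := by
    by_contra h
    have : (G.B : ℤ) * (μ + 1) ≤ G.B * n := by gcongr; omega
    rw [mul_add] at this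
    omega
  rcases (show u + 1 ≤ n by omega).lt_or_eq with hu | rfl
  · rw [lineRow_eq hsu hj hu, gRow_eq hi hy]
    exact isRow_genRow trivial (Or.inl ⟨by omega, by omega, rfl, _, _, _, _, rfl⟩)
  · rw [lineRow_eq_axis hsu hj rfl, gRow_eq hi hy]
    rw [mul_add] at hs
    exact isRow_genRow trivial
      (Or.inr (Or.inr (Or.inl ⟨rfl, by omega, Or.inl ⟨by omega, rfl⟩⟩)))

theorem lineRow_last {n n' : ℕ} {d : ι} {s : ℕ} (hn : 1 < n) (hs : s + 2 = G.C d * n)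
    (hn' : G.B * n' = (G.B + G.C d) * n) (hC) :
    1 < n' ∧ Succ G.B (n' - 1 : ℤ) (G.B - 1) n' 0 ∧ G.lineRow n d s =
      G.genRow (P d (G.C d - 2) hC) 0 a (n' - 1) (G.B - 1) (Nat.sub_lt G.B_pos one_pos) := by
  have h2 := G.two_le_C d
  have hB := G.two_le_B
  have hlt : n < n' := by
    refine lt_of_mul_lt_mul_left (a := G.B) ?_ G.B_pos.le
    rw [hn', add_mul]
    have := Nat.mul_le_mul h2 hn.le
    omega
  refine ⟨by omega, Or.inr ⟨by omega, by omega, rfl⟩, ?_⟩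
  obtain ⟨u, rfl⟩ : ∃ u, n = u + 1 := ⟨n - 1, by omega⟩
  rw [lineRow_eq_axis (j := G.C d - 2) (u := u) (by rw [mul_add] at hs; omega) hC rfl, gRow_eq]
  rw [Nat.cast_sub (by omega), mul_sub]
  zify at hn' hs
  rw [hn', add_mul, ← hs]
  push_cast
  ring

theorem lineRow_zero {n : ℕ} {d : ι} (hn : 1 < n) : G.lineRow n d 0 =
    G.genRow W (n - 1 : ℤ) (L d 0 (G.C_pos d) (n - 1)) n 1 (by have := G.two_le_B; omega) := by
  rw [lineRow_eq (u := 0) (j := 0) (by simp) (G.C_pos d) (by omega),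
    gRow_eq (μ := n) (i := 1) (by have := G.two_le_B; omega) (by simp)]
  simp

theorem lineRow_above {n n' : ℕ} {d d' : ι} {s : ℕ} (hn : 1 < n) (hs : s + 2 = G.C d * n)
    (hn' : G.B * n' = (G.B + G.C d) * n) (hC) :
    G.Above (G.lineRow n d s) (G.horRow (P d (G.C d - 1) hC) n' (some d) d') := by
  have h2 := G.two_le_C d
  obtain ⟨h1, hsucc, h⟩ := lineRow_last hn hs hn' (by omega)
  rw [h]
  refine above_horRow (Or.inl ?_) (by simp [NWRule, IsAnchor]) (by simp [IsAnchor]; omega) rfl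
    (by simp [NERule, phase]) h1 hsucc
  refine ⟨by omega, ?_⟩
  simp only [P.injEq, true_and]
  omega

end Drawing
end Geometry

section Geometry

open Function

namespace Drawing

open Tile

variable {ι : Type} {G : Drawing ι}

variable (G) in
/-- The sequence of numbers produced by a sequence of labels. -/
def num (σ : ℕ → ι) : ℕ → ℕ
  | 0 => G.seed
  | k + 1 => (G.B + G.C (σ k)) * num σ k / G.B

/-- The label preceding a step. -/
def prev (σ : ℕ → ι) : ℕ → Option ι
  | 0 => none
  | k + 1 => some (σ k)

variable (G) in
/-- All multiplications described by `σ` are allowed. -/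
def Valid (σ : ℕ → ι) : Prop :=
  ∀ k, G.B * G.num σ (k + 1) = (G.B + G.C (σ k)) * G.num σ k ∧
    G.T (prev σ k) (G.num σ k) (σ k)

theorem one_lt_num (σ : ℕ → ι) (k : ℕ) : 1 < G.num σ k := by
  induction k with
  | zero => exact G.two_le_seed
  | succ k ih =>
    refine ih.trans_le ((Nat.le_div_iff_mul_le G.B_pos).2 ?_)
    rw [mul_comm, add_mul]
    exact Nat.le_add_right _ _

variable (G) in
/-- The step drawn `t` rows above the first horizontal line, and the distance to its beginning. -/
def stage (σ : ℕ → ι) : ℕ → ℕ × ℕ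
  | 0 => (0, 0)
  | t + 1 => if (stage σ t).2 + 1 < G.C (σ (stage σ t).1) * G.num σ (stage σ t).1 then
      ((stage σ t).1, (stage σ t).2 + 1) else ((stage σ t).1 + 1, 0)

theorem two_lt_mul_num (σ : ℕ → ι) (k : ℕ) : 2 < G.C (σ k) * G.num σ k := by
  have h1 := G.two_le_C (σ k)
  have h2 := one_lt_num (G := G) σ k
  nlinarith

theorem stage_lt (σ : ℕ → ι) (t : ℕ) :
    (G.stage σ t).2 < G.C (σ (G.stage σ t).1) * G.num σ (G.stage σ t).1 := by
  induction t with
  | zero => exact two_pos.trans (two_lt_mul_num σ 0)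
  | succ t ih =>
    rw [stage]
    split_ifs with h
    · exact h
    · exact two_pos.trans (two_lt_mul_num σ _)

theorem stage_le (σ : ℕ → ι) (t : ℕ) : (G.stage σ t).1 ≤ t := by
  induction t with
  | zero => exact le_rfl
  | succ t ih => rw [stage]; split_ifs <;> simp <;> omega

variable (G) in
/-- The symbol on the axis at the beginning of a step. -/
def axis (σ : ℕ → ι) : ℕ → G.Tile
  | 0 => S (G.B * G.seed) le_rfl
  | k + 1 => P (σ k) (G.C (σ k) - 1) (Nat.sub_lt (G.C_pos _) one_pos)

variable (G) in
/-- The rows of a step. -/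
def stageRow (σ : ℕ → ι) : ℕ × ℕ → ℤ → G.Tile
  | (k, 0) => G.horRow (G.axis σ k) (G.num σ k) (prev σ k) (σ k)
  | (k, s + 1) => G.lineRow (G.num σ k) (σ k) s

variable (G) in
/-- The axis below the first horizontal line. -/
def lowAxis (y : ℤ) : G.Tile :=
  if h : 0 ≤ y ∧ y.toNat ≤ G.B * G.seed then S y.toNat h.2 else K

variable (G) in
/-- The drawing of a sequence of labels, row by row. -/
def cfgRow (σ : ℕ → ι) (y : ℤ) : ℤ → G.Tile :=
  if y < G.B * G.seed then G.gRow (G.lowAxis y) 0 a y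
  else G.stageRow σ (G.stage σ (y - G.B * G.seed).toNat)

variable (G) in
/-- The drawing of a sequence of labels. -/
def cfg (σ : ℕ → ι) (p : ℤ × ℤ) : G.Tile := G.cfgRow σ p.2 p.1

theorem mem_space_iff {x : ℤ × ℤ → G.Tile} : x ∈ G.space ↔
    ∀ y, G.IsRow (fun j => x (j, y)) ∧ G.Above (fun j => x (j, y)) fun j => x (j, y + 1) := by
  constructor
  · exact fun hx y => ⟨fun j => (hx j y).1, fun j => (hx j y).2⟩
  · exact fun hx j y => ⟨(hx y).1 j, (hx y).2 j⟩

theorem axis_above (σ : ℕ → ι) (k : ℕ) : IsAxis (G.axis σ k) ∧ VRule (G.axis σ k) W ∧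
    NWRule (G.axis σ k) o ∧ (∀ t, phase t = none → NERule (G.axis σ k) t) ∧
    HRule (G.axis σ k) (Tile.h (prev σ k) 1) := by
  have hB := G.init_bound
  cases k with
  | zero =>
    refine ⟨trivial, Or.inr ⟨rfl, rfl⟩, by simp [axis, NWRule, IsAnchor], fun t ht => ?_,
      Or.inr (Or.inr ⟨rfl, rfl⟩)⟩
    simp only [axis, NERule, ht]
    simp only [reduceCtorEq, iff_false]
    omega
  | succ k =>
    have := G.C_pos (σ k)
    refine ⟨trivial, Or.inr ⟨by omega, rfl⟩, by simp [axis, NWRule, IsAnchor], fun t ht => ?_,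
      Or.inr ⟨by omega, rfl⟩⟩
    simp [axis, NERule, ht]

theorem isRow_stageRow (σ : ℕ → ι) (t : ℕ) : G.IsRow (G.stageRow σ (G.stage σ t)) := by
  have h := stage_lt (G := G) σ t
  generalize G.stage σ t = p at h ⊢
  obtain ⟨k, _ | s⟩ := p
  · obtain ⟨h1, -, -, -, h2⟩ := axis_above (G := G) σ k
    exact isRow_horRow h1 (one_lt_num σ k) h2
  · exact isRow_lineRow (one_lt_num σ k) h

theorem above_stageRow {σ : ℕ → ι} (hσ : G.Valid σ) (t : ℕ) :
    G.Above (G.stageRow σ (G.stage σ t)) (G.stageRow σ (G.stage σ (t + 1))) := by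
  have h := stage_lt (G := G) σ t
  rw [stage]
  generalize G.stage σ t = p at h ⊢
  obtain ⟨k, _ | s⟩ := p
  · obtain ⟨-, h1, h2, h3, -⟩ := axis_above (G := G) σ k
    have := two_lt_mul_num (G := G) σ k
    simp only
    rw [if_pos (by omega)]
    simp only [stageRow]
    rw [lineRow_zero (one_lt_num σ k)]
    exact horRow_above h1 h2 h3 (one_lt_num σ k) (hσ k).2 _ _
  · simp only at h ⊢
    split_ifs with hs
    · exact above_lineRow (one_lt_num σ k) hs
    · exact lineRow_above (one_lt_num σ k) (by omega) (hσ k).1 _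

theorem lowAxis_of_neg {y : ℤ} (hy : y < 0) : G.lowAxis y = K := dif_neg (by omega)

theorem lowAxis_natCast {i : ℕ} (hi : i ≤ G.B * G.seed) : G.lowAxis i = S i hi :=
  dif_pos (show 0 ≤ (i : ℤ) ∧ _ from ⟨by omega, hi⟩)

theorem lowAxis_cases {y : ℤ} (hy : y < G.B * G.seed) : (y < 0 ∧ G.lowAxis y = K) ∨
    ∃ (i : ℕ) (hi : i < G.B * G.seed), y = i ∧ G.lowAxis y = S i hi.le := by
  rcases lt_or_ge y 0 with h | h
  · exact Or.inl ⟨h, lowAxis_of_neg h⟩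
  · lift y to ℕ using h
    rw [← Nat.cast_mul, Nat.cast_lt] at hy
    exact Or.inr ⟨y, hy, rfl, lowAxis_natCast hy.le⟩

theorem isAxis_lowAxis (y : ℤ) : IsAxis (G.lowAxis y) := by
  unfold lowAxis
  split_ifs <;> trivial

theorem height_eq {μ : ℤ} {i : ℕ} (hi : i < G.B) : (0 ≤ (G.B : ℤ) * μ + i ↔ 0 ≤ μ) ∧
    ((G.B : ℤ) ≤ G.B * μ + i ↔ 1 ≤ μ) ∧ ((G.B : ℤ) = G.B * μ + i ↔ μ = 1 ∧ i = 0) := by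
  have hB := G.B_pos
  rcases lt_trichotomy μ 0 with h | rfl | h
  · have : (G.B : ℤ) * (μ + 1) ≤ G.B * 0 := by gcongr; omega
    rw [mul_add] at this
    omega
  · omega
  · rcases eq_or_lt_of_le (show 1 ≤ μ by omega) with rfl | h
    · omega
    · have : (G.B : ℤ) * 2 ≤ G.B * μ := by gcongr; omega
      omega

theorem isRow_lowRow {y : ℤ} (hy : y < G.B * G.seed) : G.IsRow (G.gRow (G.lowAxis y) 0 a y) := by
  obtain ⟨μ, i, hi, hμ⟩ := G.exists_eq y
  obtain ⟨h0, h1, -⟩ := height_eq (G := G) (μ := μ) hi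
  rw [← hμ] at h0 h1
  rw [gRow_eq hi hμ]
  refine isRow_genRow (isAxis_lowAxis y) (Or.inr ?_)
  rcases lowAxis_cases hy with ⟨h, hz⟩ | ⟨k, hk, rfl, hz⟩ <;> rw [hz]
  · exact Or.inl ⟨rfl, by omega, rfl⟩
  · rcases lt_or_ge k G.B with h | h
    · exact Or.inl ⟨rfl, by omega, Or.inl ⟨h, rfl⟩⟩
    · rcases eq_or_lt_of_le (show 1 ≤ μ by omega) with rfl | h'
      · exact Or.inr (Or.inr ⟨rfl, rfl, Or.inr (Or.inl ⟨h, hk, Or.inr ⟨_, _, rfl⟩⟩)⟩)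
      · exact Or.inr (Or.inl ⟨rfl, h', Or.inr (Or.inl ⟨h, hk, Or.inl rfl⟩)⟩)

theorem above_lowRow {y : ℤ} (hy : y + 1 < G.B * G.seed) :
    G.Above (G.gRow (G.lowAxis y) 0 a y) (G.gRow (G.lowAxis (y + 1)) 0 a (y + 1)) := by
  have hB := G.B_pos
  obtain ⟨μ, i, hi, hμ⟩ := G.exists_eq y
  obtain ⟨μ', i', hi', hμ'⟩ := G.exists_eq (y + 1)
  have hs := succ_of_eq hi hi' (by omega : (G.B : ℤ) * μ + i + 1 = G.B * μ' + i')
  obtain ⟨-, -, h1⟩ := height_eq (G := G) (μ := μ') hi'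
  rw [← hμ'] at h1
  rw [gRow_eq hi hμ, gRow_eq hi' hμ']
  have hp : phase (G.genRow (G.lowAxis (y + 1)) 0 a μ' i' hi' 1) = some 0 ↔ (G.B : ℤ) = y + 1 := by
    rw [phase_genRow_one, h1]
    split_ifs with h <;> simp [h]
  rcases lowAxis_cases hy with ⟨h, hz⟩ | ⟨k, hk, h, hz⟩ <;>
    rcases lowAxis_cases (show y < G.B * G.seed by omega) with ⟨h', hz'⟩ | ⟨k', hk', h', hz'⟩ <;>
    rw [hz] at hp ⊢ <;> rw [hz'] <;>
    refine above_genRow_axis ?_ (by simp [NWRule, IsAnchor]) (by simp [IsAnchor]) rfl ?_ hs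
  · exact Or.inl rfl
  · exact fun hc => by have := hp.1 hc; omega
  · omega
  · omega
  · obtain rfl : k = 0 := by omega
    exact Or.inr ⟨_, rfl⟩
  · exact fun hc => by have := hp.1 hc; omega
  · obtain rfl : k = k' + 1 := by omega
    exact Or.inl ⟨_, rfl⟩
  · rw [NERule, hp]; omega

theorem lowRow_last : G.gRow (G.lowAxis (G.B * G.seed - 1)) 0 a (G.B * G.seed - 1) =
    G.genRow (S (G.B * G.seed - 1) (Nat.sub_le _ _)) 0 a (G.seed - 1) (G.B - 1)
      (Nat.sub_lt G.B_pos one_pos) := by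
  have hB := G.init_bound
  have := G.B_pos
  rw [gRow_eq (Nat.sub_lt G.B_pos one_pos) (μ := G.seed - 1) (by
    rw [Nat.cast_sub (by omega)]; push_cast; ring)]
  congr
  rw [← lowAxis_natCast, Nat.cast_sub (by omega)]
  simp

theorem cfg_mem {σ : ℕ → ι} (hσ : G.Valid σ) : G.cfg σ ∈ G.space := by
  have hB := G.init_bound
  refine mem_space_iff.2 fun y => ?_
  change G.IsRow (G.cfgRow σ y) ∧ G.Above (G.cfgRow σ y) (G.cfgRow σ (y + 1))
  unfold cfgRow
  rcases lt_trichotomy (y + 1) (G.B * G.seed) with h | h | h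
  · rw [if_pos (by omega), if_pos h]
    exact ⟨isRow_lowRow (by omega), above_lowRow h⟩
  · rw [if_pos (by omega), if_neg (by omega), h, sub_self]
    refine ⟨isRow_lowRow (by omega), ?_⟩
    obtain rfl : y = G.B * G.seed - 1 := by omega
    rw [lowRow_last]
    refine above_horRow (Or.inl ⟨by omega, ?_⟩) (by simp [NWRule, IsAnchor])
      (by simp [axis, IsAnchor]) rfl ?_ G.two_le_seed
      (Or.inr ⟨by have := G.B_pos; omega, by simp [num], rfl⟩)
    · simp only [axis, S.injEq]; omega
    · simp only [NERule, phase, reduceCtorEq, iff_false]; omega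
  · rw [if_neg (by omega), if_neg (by omega)]
    refine ⟨isRow_stageRow σ _, ?_⟩
    rw [show (y + 1 - G.B * G.seed : ℤ).toNat = (y - G.B * G.seed : ℤ).toNat + 1 by omega]
    exact above_stageRow hσ _

end Drawing
end Geometry

section Geometry

open Function

namespace Drawing

open Tile

variable {ι : Type} {G : Drawing ι}

/-! ### Every drawing with a seed is the drawing of a sequence of labels -/

theorem le_of_height {n : ℕ} {μ : ℤ} {i : ℕ} (hi : i < G.B) (h : (G.B : ℤ) * n ≤ G.B * μ + i) :
    (n : ℤ) ≤ μ := by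
  by_contra hlt
  have : (G.B : ℤ) * (μ + 1) ≤ G.B * n := by gcongr; omega
  rw [mul_add] at this
  omega

/-- The rows above a horizontal line. -/
theorem rows_above_horRow {R : ℤ → ℤ → G.Tile} (hR : ∀ y, G.IsRow (R y) ∧ G.Above (R y) (R (y + 1)))
    {y : ℤ} {z : G.Tile} {n : ℕ} {c : Option ι} {d : ι} (hz : ∀ t, VRule z t → t = W) (hn : 1 < n)
    (hy : R y = G.horRow z n c d) :
    G.T c n d ∧ (∀ s, s + 1 < G.C d * n → R (y + 1 + s) = G.lineRow n d s) ∧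
      ∃ (n' : ℕ) (d' : ι), G.B * n' = (G.B + G.C d) * n ∧ R (y + G.C d * n) =
        G.horRow (P d (G.C d - 1) (Nat.sub_lt (G.C_pos d) one_pos)) n' (some d) d' := by
  have hB := G.two_le_B
  have hC := G.two_le_C d
  have hCn : 2 * 2 ≤ G.C d * n := Nat.mul_le_mul hC hn
  obtain ⟨hT, h0⟩ := (hR y).2.of_horRow (hR _).1 hy hz hn (G.C_pos d) hB
  rw [← lineRow_zero hn] at h0
  have hline : ∀ s, s + 1 < G.C d * n → R (y + 1 + s) = G.lineRow n d s := by
    intro s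
    induction s with
    | zero => intro; simpa using h0
    | succ s ih =>
      intro hs
      have h1 := ih (by omega)
      have ha := (hR (y + 1 + s)).2
      have hr := (hR (y + 1 + s + 1)).1
      rw [show y + 1 + ((s + 1 : ℕ) : ℤ) = y + 1 + s + 1 by push_cast; ring]
      generalize R (y + 1 + s) = ρ at h1 ha
      generalize R (y + 1 + s + 1) = ρ' at hr ha
      revert h1
      refine lineRow_rec (motive := fun τ τ' => ρ = τ → ρ' = τ') hn hs ?_ ?_ ?_ ?_
      · intro q μ μ' i i' hi hi' k hk hk' r hq hμ hs h1
        exact ha.of_genRow hr h1 hq hμ hs hi' hk'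
      · intro q μ μ' i i' hi hi' k hk hk' r hq hμ hkC hs h1
        exact ha.of_genRow_last hr h1 hq hμ hs hi' hkC hk'
      · intro μ μ' i i' hi hi' k hk hk' hμ hkC hs h1
        exact ha.of_genRow_one hr h1 hμ hs hi' hkC hk'
      · intro μ μ' i i' hi hi' k hk hk' hμ hkC hs h1
        refine ha.of_genRow_zero hr (z' := P d (k + 1) hk') h1 ?_ trivial (fun h => ?_) (by omega) hs hi'
        · have := (ha 0).1
          rw [h1, genRow_zero] at this
          obtain ⟨_, h⟩ | ⟨h, -⟩ := this
          · exact h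
          · omega
        · obtain ⟨-, h⟩ | ⟨h, -⟩ := h
          · exact Or.inl h
          · omega
  refine ⟨hT, hline, ?_⟩
  obtain ⟨s, hs⟩ : ∃ s, s + 2 = G.C d * n := ⟨G.C d * n - 2, by omega⟩
  have h1 := hline s (by omega)
  have ha := (hR (y + 1 + s)).2
  have hr := (hR (y + 1 + s + 1)).1
  rw [show y + G.C d * (n : ℤ) = y + 1 + s + 1 by
    rw [← Nat.cast_mul, ← hs]; push_cast; ring]
  generalize R (y + 1 + s) = ρ at h1 ha
  generalize R (y + 1 + s + 1) = ρ' at hr ha ⊢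
  obtain ⟨u, rfl⟩ : ∃ u, n = u + 1 := ⟨n - 1, by omega⟩
  obtain ⟨μ, i, hi, hμ⟩ := G.exists_eq (G.B * (u + 1 : ℕ) + 1 + s)
  obtain ⟨μ', i', hi', hμ'⟩ := G.exists_eq (G.B * (u + 1 : ℕ) + 1 + s + 1)
  have h2 := le_of_height (G := G) (n := u + 1) (μ := μ) hi (by omega)
  have h3 := le_of_height (G := G) (n := u + 1) (μ := μ') hi' (by omega)
  rw [lineRow_eq_axis (j := G.C d - 2) (u := u) (by rw [mul_add] at hs; omega) (by omega) rfl,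
    gRow_eq hi hμ] at h1
  have h5 : ρ' 0 = P d (G.C d - 1) (Nat.sub_lt (G.C_pos d) one_pos) := by
    have := (ha 0).1
    rw [h1, genRow_zero] at this
    obtain ⟨_, h⟩ | ⟨h, -⟩ := this
    · rw [h]
      simp only [P.injEq, true_and]
      omega
    · omega
  obtain ⟨rfl, d', h4⟩ := ha.to_horRow hr (c := some d) (μ' := μ') h1 h5 trivial
    (fun h => (h.resolve_left fun h => by omega).2) (by omega)
    (succ_of_eq hi hi' (by omega)) hi' (by omega)
  lift μ' to ℕ using by omega
  refine ⟨μ', d', ?_, h4⟩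
  zify at hs ⊢
  rw [add_mul, ← hs]
  push_cast at hμ'
  linarith

theorem rows_below {R : ℤ → ℤ → G.Tile} (hR : ∀ y, G.IsRow (R y) ∧ G.Above (R y) (R (y + 1)))
    (h0 : R 0 0 = S 0 (Nat.zero_le _)) :
    (∀ y < (G.B * G.seed : ℤ), R y = G.gRow (G.lowAxis y) 0 a y) ∧
      ∃ d, R (G.B * G.seed) = G.horRow (S (G.B * G.seed) le_rfl) G.seed none d := by
  have hB := G.two_le_B
  have hBn := G.init_bound
  have hup : ∀ i (hi : i ≤ G.B * G.seed), R i 0 = S i hi := by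
    intro i
    induction i with
    | zero => exact fun _ => h0
    | succ i ih =>
      intro hi
      have := ((hR i).2 0).1
      rw [ih (by omega)] at this
      obtain ⟨_, h⟩ | ⟨h, -⟩ := this
      · exact_mod_cast h
      · omega
  have hdown : ∀ i : ℕ, R (-1 - i) 0 = K := by
    intro i
    induction i with
    | zero =>
      have := ((hR (-1)).2 0).1
      rw [show (-1 + 1 : ℤ) = 0 by rfl, h0] at this
      simpa using this.below
    | succ i ih =>
      have := ((hR (-1 - (i + 1 : ℕ))).2 0).1
      rw [show -1 - ((i + 1 : ℕ) : ℤ) + 1 = -1 - i by push_cast; ring, ih] at this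
      exact this.below
  have haxis : ∀ y ≤ (G.B * G.seed : ℤ), R y 0 = G.lowAxis y := by
    intro y hy
    rcases lt_or_ge y 0 with h | h
    · rw [lowAxis_of_neg h, ← hdown (-1 - y).toNat]
      congr
      omega
    · lift y to ℕ using h
      rw [hup y (by exact_mod_cast hy), lowAxis_natCast]
  have hlow : ∀ y < (G.B : ℤ), R y = G.gRow (G.lowAxis y) 0 a y := by
    intro y hy
    obtain ⟨μ, i, hi, hμ⟩ := G.exists_eq y
    rw [gRow_eq hi hμ]
    have h1 := haxis y (by omega)
    refine (hR y).1.eq_genRow_of_e hi (isAxis_lowAxis y) h1 ?_ ?_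
    · have := (hR y).1 0
      rw [h1, zero_add] at this
      rcases lowAxis_cases (G := G) (y := y) (by omega) with ⟨h, hz⟩ | ⟨k, hk, rfl, hz⟩ <;>
        rw [hz] at this
      · exact this
      · rcases this with ⟨-, h⟩ | h | h
        · exact h
        · omega
        · omega
    · obtain ⟨-, h, -⟩ := height_eq (G := G) (μ := μ) hi
      omega
  have hhigh : ∀ k : ℕ, G.B + k < G.B * G.seed →
      R (G.B + k) = G.gRow (G.lowAxis (G.B + k)) 0 a (G.B + k) := by
    intro k hk
    have hb : HRule (G.lowAxis (G.B + k)) (R (G.B + k) 1) →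
        R (G.B + k) 1 = b ∨ ∃ j hj, R (G.B + k) 1 = M j hj := by
      rw [← Nat.cast_add, lowAxis_natCast hk.le]
      rintro (h | h | h)
      · omega
      · exact h.2.2
      · omega
    induction k with
    | zero =>
      rw [Nat.cast_zero, add_zero] at *
      rw [gRow_eq G.B_pos (μ := 1) (by simp)]
      have h1 := haxis G.B (by omega)
      refine (hR G.B).1.eq_genRow _ (isAxis_lowAxis _) h1 (hb ?_) one_pos ?_
      · simpa [h1] using (hR G.B).1 0
      · have := ((hR (G.B - 1 : ℕ)).2 0).2.2
        rw [hup _ (by omega), show ((G.B - 1 : ℕ) : ℤ) + 1 = G.B by omega] at this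
        exact this.1 (by omega)
    | succ k ih =>
      obtain ⟨μ, i, hi, hμ⟩ := G.exists_eq (G.B + k)
      obtain ⟨μ', i', hi', hμ'⟩ := G.exists_eq (G.B + (k + 1 : ℕ))
      have h1 := ih (by omega) fun h => ?_
      · rw [gRow_eq hi hμ] at h1
        rw [gRow_eq hi' hμ']
        refine (hR _).2.of_genRow_zero (hR _).1 h1 ?_ (isAxis_lowAxis _) ?_ ?_
          (succ_of_eq hi hi' (by omega)) hi'
        · rw [add_assoc, ← Nat.cast_succ]
          exact haxis _ (by omega)
        · rw [add_assoc, ← Nat.cast_succ]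
          exact hb
        · obtain ⟨-, h, -⟩ := height_eq (G := G) (μ := μ) hi
          omega
      · rw [← Nat.cast_add, lowAxis_natCast (by omega)] at h
        rcases h with h | h | h
        · omega
        · exact_mod_cast h.2.2
        · omega
  have hall : ∀ y < (G.B * G.seed : ℤ), R y = G.gRow (G.lowAxis y) 0 a y := by
    intro y hy
    rcases lt_or_ge y G.B with h | h
    · exact hlow y h
    · obtain ⟨k, rfl⟩ : ∃ k : ℕ, y = G.B + k := ⟨(y - G.B).toNat, by omega⟩
      exact hhigh k (by exact_mod_cast hy)
  refine ⟨hall, ?_⟩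
  have h1 := hall (G.B * G.seed - 1) (by omega)
  rw [lowRow_last] at h1
  have h2 := hup (G.B * G.seed) le_rfl
  push_cast at h2
  have ha := (hR (G.B * G.seed - 1)).2
  rw [sub_add_cancel] at ha
  refine (ha.to_horRow (hR _).1 (c := none) (i' := 0) h1 h2 trivial (fun h => ?_) ?_
    (Or.inr ⟨by omega, by simp, rfl⟩) G.B_pos ?_).2
  · rcases h with h | h | h
    · omega
    · omega
    · exact h.2
  · have := G.two_le_seed; omega
  · have := G.two_le_seed; omega

theorem stage_height {σ : ℕ → ι} (hσ : ∀ k, G.B * G.num σ (k + 1) = (G.B + G.C (σ k)) * G.num σ k)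
    (t : ℕ) : G.B * G.seed + t = G.B * G.num σ (G.stage σ t).1 + (G.stage σ t).2 := by
  induction t with
  | zero => rfl
  | succ t ih =>
    have := stage_lt (G := G) σ t
    rw [stage]
    split_ifs with h
    · simp only; omega
    · simp only [hσ]
      rw [add_mul]
      omega

/-- A sequence of numbers following the labels given by `f`. -/
def follow (G : Drawing ι) (f : ℕ → ι) : ℕ → ℕ
  | 0 => G.seed
  | k + 1 => (G.B + G.C (f (follow G f k))) * follow G f k / G.B

theorem num_follow (f : ℕ → ι) (k : ℕ) : G.num (fun k => f (G.follow f k)) k = G.follow f k := by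
  induction k with
  | zero => rfl
  | succ k ih => simp only [num, follow, ih]

open Classical in
theorem exists_cfg {x : ℤ × ℤ → G.Tile} (hx : x ∈ G.space) (h0 : x (0, 0) = S 0 (Nat.zero_le _)) :
    ∃ σ, G.Valid σ ∧ x = G.cfg σ := by
  set R : ℤ → ℤ → G.Tile := fun y j => x (j, y) with hRdef
  have hR : ∀ y, G.IsRow (R y) ∧ G.Above (R y) (R (y + 1)) := mem_space_iff.1 hx
  obtain ⟨hlow, d₀, hd₀⟩ := rows_below hR h0
  let f : ℕ → ι := fun n => if h : ∃ c r d, R (G.B * n) n = N c r d then h.choose_spec.choose_spec.choose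
    else d₀
  have hf : ∀ {n : ℕ} {z c d}, 1 < n → R (G.B * n) = G.horRow z n c d → f n = d := by
    intro n z c d hn h
    have h1 : R (G.B * n) n = N c (n : ℤ) d := by rw [h, horRow_right _ (by omega)]
    have h2 : ∃ c r d, R (G.B * n) n = N c r d := ⟨_, _, _, h1⟩
    have h3 := h2.choose_spec.choose_spec.choose_spec
    have h4 := h1.symm.trans h3
    rw [N.injEq] at h4
    exact (dif_pos h2).trans h4.2.2.symm
  set σ : ℕ → ι := fun k => f (G.follow f k) with hσ
  have hnum : ∀ k, G.num σ k = G.follow f k := num_follow f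
  have hz : ∀ k t, VRule (G.axis σ k) t → t = W := by
    intro k t ht
    cases k with
    | zero =>
      rcases ht with ⟨h, -⟩ | ht
      · omega
      · exact ht.2
    | succ k =>
      rcases ht with ⟨h, -⟩ | ht
      · have := G.C_pos (σ k); omega
      · exact ht.2
  have main : ∀ k, R (G.B * G.num σ k) = G.horRow (G.axis σ k) (G.num σ k) (prev σ k) (σ k) := by
    intro k
    induction k with
    | zero =>
      have : σ 0 = d₀ := hf G.two_le_seed hd₀
      rw [this]
      exact hd₀
    | succ k ih =>
      obtain ⟨-, -, n', d', hn', hd'⟩ := rows_above_horRow hR (hz k) (one_lt_num σ k) ih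
      have h1 : G.num σ (k + 1) = n' := by
        rw [num, ← hn', Nat.mul_div_cancel_left _ G.B_pos]
      have h2 : (G.B : ℤ) * G.num σ k + G.C (σ k) * G.num σ k = G.B * n' := by
        zify at hn'; rw [hn', add_mul]
      rw [h2, ← h1] at hd'
      have : σ (k + 1) = d' := by
        rw [← hf (one_lt_num σ _) hd', hnum]
      rw [this]
      exact hd'
  have step := fun k => rows_above_horRow hR (hz k) (one_lt_num σ k) (main k)
  have hmul : ∀ k, G.B * G.num σ (k + 1) = (G.B + G.C (σ k)) * G.num σ k := by
    intro k
    obtain ⟨-, -, n', d', hn', -⟩ := step k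
    rw [num, ← hn', Nat.mul_div_cancel_left _ G.B_pos]
  refine ⟨σ, fun k => ⟨hmul k, (step k).1⟩, ?_⟩
  have hall : ∀ y, R y = G.cfgRow σ y := by
    intro y
    unfold cfgRow
    split_ifs with hy
    · exact hlow y hy
    · obtain ⟨t, rfl⟩ : ∃ t : ℕ, y = G.B * G.seed + t := ⟨(y - G.B * G.seed).toNat, by omega⟩
      have h1 := stage_height hmul t
      have h2 := stage_lt (G := G) σ t
      rw [add_sub_cancel_left, Int.toNat_natCast]
      zify at h1
      rw [h1]
      generalize G.stage σ t = p at h2 ⊢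
      obtain ⟨k, _ | s⟩ := p
      · rw [stageRow, ← main k, Nat.cast_zero, add_zero]
      · have := (step k).2.1 s h2
        rw [stageRow, ← this]
        congr 1
        push_cast
        ring
  funext ⟨j, y⟩
  exact congrFun (hall y) j

end Drawing
end Geometry

section Geometry

open Function

namespace Drawing

open Tile

variable {ι : Type} {G : Drawing ι}

/-! ### Dependence of the drawing on the labels -/

section
variable {σ τ : ℕ → ι}

theorem num_congr {k : ℕ} (h : ∀ i < k, σ i = τ i) : G.num σ k = G.num τ k := by
  induction k with
  | zero => rfl
  | succ k ih => rw [num, num, h k (by omega), ih fun i hi => h i (by omega)]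

theorem stage_congr {t : ℕ} (h : ∀ i ≤ t, σ i = τ i) : G.stage σ t = G.stage τ t := by
  induction t with
  | zero => rfl
  | succ t ih =>
    have := stage_le (G := G) τ t
    rw [stage, stage, ih fun i hi => h i (by omega), h _ (by omega),
      num_congr fun i hi => h i (by omega)]

theorem stageRow_congr {p : ℕ × ℕ} (h : ∀ i ≤ p.1, σ i = τ i) :
    G.stageRow σ p = G.stageRow τ p := by
  obtain ⟨k, s⟩ := p
  have h1 : G.num σ k = G.num τ k := num_congr fun i hi => h i hi.le
  have h2 : σ k = τ k := h k le_rfl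
  rcases s with _ | s
  · rcases k with _ | k
    · simp [stageRow, axis, prev, num, h2]
    · simp [stageRow, axis, prev, h1, h2, h k (Nat.le_succ k)]
  · simp [stageRow, h1, h2]

theorem cfg_congr {p : ℤ × ℤ} (h : ∀ i ≤ (p.2 - G.B * G.seed).toNat, σ i = τ i) :
    G.cfg σ p = G.cfg τ p := by
  unfold cfg cfgRow
  rw [stage_congr h, stageRow_congr fun i hi => h i (hi.trans (stage_le _ _))]

end

theorem continuous_cfg [TopologicalSpace ι] [DiscreteTopology ι] [TopologicalSpace G.Tile] :
    Continuous G.cfg := by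
  refine continuous_pi fun p => ?_
  set t := (p.2 - G.B * G.seed).toNat with ht
  let g : (Fin (t + 1) → ι) → ℕ → ι := fun v i => v ⟨min i t, by omega⟩
  have : (fun σ => G.cfg σ p) = (fun v => G.cfg (g v) p) ∘ fun σ i => σ i.1 := by
    funext σ
    refine cfg_congr fun i hi => ?_
    simp only [g]
    rw [min_eq_left hi]
  rw [this]
  exact continuous_of_discreteTopology.comp (continuous_pi fun i => continuous_apply _)

theorem num_strictMono {σ : ℕ → ι} (hσ : G.Valid σ) : StrictMono (G.num σ) := by
  refine strictMono_nat_of_lt_succ fun k => lt_of_mul_lt_mul_left ?_ (Nat.zero_le G.B)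
  have := two_lt_mul_num (G := G) σ k
  rw [(hσ k).1, add_mul]
  omega

theorem stage_num {σ : ℕ → ι} (hσ : G.Valid σ) {k t : ℕ}
    (h : G.B * G.seed + t = G.B * G.num σ k) : G.stage σ t = (k, 0) := by
  have h1 := stage_height (fun k => (hσ k).1) t
  have h2 := stage_lt (G := G) σ t
  generalize G.stage σ t = p at h1 h2
  obtain ⟨k', s⟩ := p
  simp only at h1 h2
  have h3 := (hσ k').1
  rw [add_mul] at h3
  have h4 : G.num σ k' ≤ G.num σ k := le_of_mul_le_mul_left (by omega) G.B_pos
  have h5 : G.num σ k < G.num σ (k' + 1) :=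
    lt_of_mul_lt_mul_left (a := G.B) (by omega) (Nat.zero_le _)
  have h6 := (num_strictMono hσ).le_iff_le.1 h4
  have h7 := (num_strictMono hσ).lt_iff_lt.1 h5
  obtain rfl : k' = k := by omega
  simp only [Prod.mk.injEq, true_and]
  omega

theorem cfgRow_num {σ : ℕ → ι} (hσ : G.Valid σ) (k : ℕ) : G.cfgRow σ (G.B * G.num σ k) =
    G.horRow (G.axis σ k) (G.num σ k) (prev σ k) (σ k) := by
  have h1 : G.seed ≤ G.num σ k := (num_strictMono hσ).monotone (Nat.zero_le k)
  have h2 := Nat.mul_le_mul_left G.B h1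
  rw [cfgRow, if_neg (by exact_mod_cast h2.not_gt), stage_num hσ (k := k)]
  · rfl
  · zify at h2 ⊢
    omega

theorem cfg_injOn : Set.InjOn G.cfg {σ | G.Valid σ} := by
  intro σ hσ τ hτ h
  funext k
  induction k using Nat.strong_induction_on with
  | _ k ih =>
    have h1 : G.num σ k = G.num τ k := num_congr ih
    have hn : (0 : ℤ) < G.num τ k := by have := one_lt_num (G := G) τ k; omega
    have h2 : G.cfgRow σ (G.B * G.num τ k) (G.num τ k) = G.cfgRow τ (G.B * G.num τ k) (G.num τ k) :=
      congrFun h (((G.num τ k : ℕ) : ℤ), ((G.B : ℤ) * G.num τ k))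
    rw [cfgRow_num hτ, ← h1, cfgRow_num hσ, h1, horRow_right _ hn, horRow_right _ hn] at h2
    simp only [N.injEq] at h2
    exact h2.2.2

theorem cfg_seed (σ : ℕ → ι) : G.cfg σ (0, 0) = S 0 (Nat.zero_le _) := by
  have := G.init_bound
  change G.cfgRow σ 0 0 = _
  rw [cfgRow, if_pos (by omega), gRow, genRow_zero, ← lowAxis_natCast, Nat.cast_zero]

theorem image_cfg : G.cfg '' {σ | G.Valid σ} =
    G.space ∩ {x | x (0, 0) = S 0 (Nat.zero_le _)} := by
  ext x
  constructor
  · rintro ⟨σ, hσ, rfl⟩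
    exact ⟨cfg_mem hσ, cfg_seed σ⟩
  · rintro ⟨hx, h0⟩
    obtain ⟨σ, hσ, rfl⟩ := exists_cfg hx h0
    exact ⟨σ, hσ, rfl⟩

end Drawing
end Geometry

section Geometry

open Function

namespace Drawing

open Tile

variable {ι : Type} {G : Drawing ι}

/-- The number of the stratum a symbol belongs to. -/
def level : G.Tile → ℕ
  | S _ _ => 0
  | P _ _ _ | N _ _ _ => 1
  | K | W | h _ _ | L _ _ _ _ | M _ _ => 2
  | o | e | a | b => 3

variable (G) in
/-- The configurations with all symbols of level at least `k`. -/
def stratum (k : ℕ) : Set (ℤ × ℤ → G.Tile) := {x | x ∈ G.space ∧ ∀ p, k ≤ level (x p)}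

theorem level_lt (s : G.Tile) : level s < 4 := by
  cases s <;> simp [level]

theorem shift2_mem_space {x : ℤ × ℤ → G.Tile} (hx : x ∈ G.space) (n : ℤ × ℤ) :
    shift2 n x ∈ G.space := by
  intro i j
  have := hx (n.1 + i) (n.2 + j)
  obtain ⟨n, m⟩ := n
  simpa only [shift2, Prod.mk_add_mk, ← add_assoc, ← add_sub_assoc] using this

theorem shift2_mem_stratum {k : ℕ} {x : ℤ × ℤ → G.Tile} (hx : x ∈ G.stratum k) (n : ℤ × ℤ) :
    shift2 n x ∈ G.stratum k :=
  ⟨shift2_mem_space hx.1 n, fun p => hx.2 (n + p)⟩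

theorem stratum_anti {k l : ℕ} (hkl : k ≤ l) : G.stratum l ⊆ G.stratum k :=
  fun _ hx => ⟨hx.1, fun p => hkl.trans (hx.2 p)⟩

theorem phase_lt {s : G.Tile} {i : ℕ} (hs : phase s = some i) : i < G.B := by
  have := G.B_pos
  cases s <;> simp only [phase, reduceCtorEq, Option.some.injEq] at hs <;> omega

theorem toNat_emod_lt {B : ℕ} (hB : 0 < B) (v : ℤ) : (v % B).toNat < B := by
  have h1 := Int.emod_nonneg v (b := B) (by omega)
  have h2 := Int.emod_lt_of_pos v (b := B) (by omega)
  omega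

theorem succ_ediv {B : ℕ} (hB : 0 < B) (v : ℤ) :
    Succ B (v / B) (v % B).toNat ((v + 1) / B) ((v + 1) % B).toNat := by
  have hB' : (B : ℤ) ≠ 0 := by omega
  refine succ_of_eq (toNat_emod_lt hB _) (toNat_emod_lt hB _) ?_
  rw [Int.toNat_of_nonneg (Int.emod_nonneg _ hB'), Int.toNat_of_nonneg (Int.emod_nonneg _ hB'),
    Int.mul_ediv_add_emod, Int.mul_ediv_add_emod]

section lines

variable {x : ℤ × ℤ → G.Tile}

theorem phase_up (hx : x ∈ G.space) {v y : ℤ} (h : phase (x (v / G.B, y)) = some (v % G.B).toNat) :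
    phase (x ((v + 1) / G.B, y + 1)) = some ((v + 1) % G.B).toNat :=
  (mem_space_iff.1 hx y).2.phase_eq h (succ_ediv G.B_pos v) (G.emod_toNat_lt _)

theorem phase_down (hx : x ∈ G.stratum 1) {v y : ℤ}
    (h : phase (x ((v + 1) / G.B, y + 1)) = some ((v + 1) % G.B).toNat) :
    phase (x (v / G.B, y)) = some (v % G.B).toNat := by
  have hB := G.two_le_B
  have hs := succ_ediv G.B_pos v
  have hi := G.emod_toNat_lt v
  generalize (v + 1) / (G.B : ℤ) = μ' at *
  generalize ((v + 1) % (G.B : ℤ)).toNat = i' at *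
  generalize v / (G.B : ℤ) = μ at *
  generalize (v % (G.B : ℤ)).toNat = i at *
  rcases hs with ⟨rfl, rfl⟩ | ⟨hB, rfl, rfl⟩
  · have hv := (hx.1 μ' y).2.1
    revert h hv
    cases x (μ', y + 1) <;> simp only [phase, reduceCtorEq, false_imp_iff, Option.some.injEq] <;>
      intro h hv
    · subst h
      rcases i with _ | i
      · rcases hv.below with ⟨_, h⟩ | ⟨_, _, _, h⟩ <;> rw [h]
      · obtain ⟨_, h⟩ := hv.below
        rw [h]
  · rcases (hx.1 μ y).2.2.2.of_phase h with ⟨k, hk, hkB, h'⟩ | ⟨k, hk, hkB, h'⟩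
    · rw [h']
      simp only [phase, Option.some.injEq]
      omega
    · have := hx.2 (μ, y)
      rw [h'] at this
      simp [level] at this

theorem phase_add (hx : x ∈ G.stratum 1) {v y : ℤ}
    (h : phase (x (v / G.B, y)) = some (v % G.B).toNat) (t : ℤ) :
    phase (x ((v + t) / G.B, y + t)) = some ((v + t) % G.B).toNat := by
  induction t with
  | zero => simpa using h
  | succ t ih => simpa only [add_assoc] using phase_up hx.1 ih
  | pred t ih =>
    refine phase_down hx ?_
    rwa [show v + (-t - 1) + 1 = v + -t by ring, show y + (-t - 1) + 1 = y + -t by ring]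

theorem exists_phase {μ y : ℤ} {i : ℕ} (h : phase (x (μ, y)) = some i) :
    ∃ v : ℤ, v = G.B * μ + i ∧ phase (x (v / G.B, y)) = some (v % G.B).toNat := by
  have hB : (0 : ℤ) < G.B := by exact_mod_cast G.B_pos
  have hi := phase_lt h
  refine ⟨_, rfl, ?_⟩
  have h1 : ((G.B : ℤ) * μ + i) / G.B = μ := by
    rw [Int.mul_add_ediv_left _ _ hB.ne', Int.ediv_eq_zero_of_lt (by omega) (by omega), add_zero]
  have h2 : ((G.B : ℤ) * μ + i) % G.B = i := by
    rw [Int.mul_add_emod_self_left, Int.emod_eq_of_lt (by omega) (by omega)]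
  rw [h1, h2, h, Int.toNat_natCast]

theorem axis_down (hx : x ∈ G.stratum 1) {i j : ℤ} (h : IsAxis (x (i, j + 1))) :
    IsAxis (x (i, j)) := by
  have hv := (hx.1 i j).2.1
  revert h hv
  have hS := hx.2 (i, j + 1)
  revert hS
  cases x (i, j + 1) <;> simp only [IsAxis, false_imp_iff, imp_true_iff, true_imp_iff]
  · intro _ hv
    rw [hv.below]
    trivial
  · simp [level]
  · intro _ hv
    rcases hv.below with h | ⟨_, _, _, _, h⟩ | ⟨_, h⟩ <;> rw [h] <;> trivial
  · rename_i c k hk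
    intro _ hv
    rcases k with _ | k
    · rw [hv.below]
      trivial
    · obtain ⟨_, h⟩ := hv.below
      rw [h]
      trivial

theorem axis_sub (hx : x ∈ G.stratum 1) {i j : ℤ} (h : IsAxis (x (i, j))) {j' : ℤ} (hj : j' ≤ j) :
    IsAxis (x (i, j')) := by
  obtain ⟨k, rfl⟩ : ∃ k : ℕ, j' = j - k := ⟨(j - j').toNat, by omega⟩
  induction k with
  | zero => simpa using h
  | succ k ih =>
    refine axis_down hx ?_
    convert ih (by omega) using 3
    push_cast
    ring

theorem axis_phase (hx : x ∈ G.stratum 1) {p q : ℤ × ℤ} (h : IsAxis (x p)) {i : ℕ} :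
    phase (x q) ≠ some i := by
  intro hq
  have hB : (0 : ℤ) < G.B := by exact_mod_cast G.B_pos
  obtain ⟨v, -, hv⟩ := exists_phase (x := x) (μ := q.1) (y := q.2) hq
  set t := min (p.2 - q.2) (G.B * p.1 - v - 1) with ht
  have h1 := phase_add hx hv t
  have h2 := axis_sub hx (i := p.1) (j := p.2) h (j' := q.2 + t) (by omega)
  have h3 : (v + t) / G.B < p.1 := Int.ediv_lt_of_lt_mul hB (by rw [mul_comm]; omega)
  rw [(mem_space_iff.1 hx.1 (q.2 + t)).1.eq_o h2 h3] at h1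
  simp [phase] at h1

/-! ### Falling lines -/

variable (x) in
/-- The point of parameter `v` of a falling line lies in row `y`; the line passes at parameter `0`
through column `q`, where the residue is `r`. -/
def OnLine (c : ι) (r : ZMod G.m) (q v y : ℤ) : Prop :=
  ∃ hj, x (q - v / G.C c, y) = L c (v % G.C c).toNat hj (r - ((v / G.C c : ℤ) : ZMod G.m))

theorem OnLine.up (hx : x ∈ G.space) {c : ι} {r : ZMod G.m} {q v y : ℤ} (h : OnLine x c r q v y)
    (hP : ∀ hk, x (q - (v + 1) / G.C c, y + 1) ≠ P c 0 hk) : OnLine x c r q (v + 1) (y + 1) := by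
  have hs := succ_ediv (G.C_pos c) v
  have hi := toNat_emod_lt (G.C_pos c) (v + 1)
  unfold OnLine at *
  generalize (v + 1) / (G.C c : ℤ) = μ' at *
  generalize ((v + 1) % (G.C c : ℤ)).toNat = i' at *
  generalize v / (G.C c : ℤ) = μ at *
  generalize (v % (G.C c : ℤ)).toNat = i at *
  obtain ⟨hj, h⟩ := h
  obtain ⟨-, hv, hw, -⟩ := hx (q - μ) y
  rw [h] at hv hw
  refine ⟨hi, ?_⟩
  rcases hs with ⟨rfl, rfl⟩ | ⟨hB, rfl, rfl⟩
  · rcases hv with ⟨_, hv⟩ | ⟨hv, -⟩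
    · exact hv
    · omega
  · rw [← sub_sub] at hP ⊢
    rcases hw with ⟨hw, -⟩ | ⟨-, ⟨_, hw⟩ | ⟨-, _, hw⟩⟩
    · exact absurd hB hw
    · rw [hw]
      push_cast
      rw [sub_sub]
    · exact absurd hw (hP _)

theorem OnLine.down (hx : x ∈ G.space) {c : ι} {r : ZMod G.m} {q v y : ℤ}
    (h : OnLine x c r q (v + 1) (y + 1))
    (hN : ∀ c d r, x (q - v / G.C c, y) ≠ N d r c) : OnLine x c r q v y := by
  have hs := succ_ediv (G.C_pos c) v
  have hi := toNat_emod_lt (G.C_pos c) v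
  have hN := hN c
  unfold OnLine at *
  generalize (v + 1) / (G.C c : ℤ) = μ' at *
  generalize ((v + 1) % (G.C c : ℤ)).toNat = i' at *
  generalize v / (G.C c : ℤ) = μ at *
  generalize (v % (G.C c : ℤ)).toNat = i at *
  obtain ⟨hj, h⟩ := h
  obtain ⟨-, hv, hw, -⟩ := hx (q - μ) y
  refine ⟨hi, ?_⟩
  rcases hs with ⟨rfl, rfl⟩ | ⟨hB, rfl, rfl⟩
  · rw [h] at hv
    obtain ⟨_, hv⟩ := hv.below
    exact hv
  · rw [← sub_sub] at h
    rw [h] at hw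
    rcases hw.of_L with ⟨k, hk, hkC, hw⟩ | ⟨d, -, hw⟩
    · rw [hw]
      simp only [L.injEq, true_and]
      exact ⟨by omega, by push_cast; ring⟩
    · exact absurd hw (hN _ _)

theorem exists_onLine {c : ι} {j : ℕ} {hj : j < G.C c} {r : ZMod G.m} {q y : ℤ}
    (h : x (q, y) = L c j hj r) : OnLine x c r q j y := by
  have h1 : (j : ℤ) / G.C c = 0 := Int.ediv_eq_zero_of_lt (by omega) (by omega)
  have h2 : (j : ℤ) % G.C c = j := Int.emod_eq_of_lt (by omega) (by omega)
  unfold OnLine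
  rw [h1, h2]
  exact ⟨hj, by simpa using h⟩

theorem OnLine.add_nat (hx : x ∈ G.space) {c : ι} {r : ZMod G.m} {q v y : ℤ}
    (h : OnLine x c r q v y) (hP : ∀ p c k hk, x p ≠ P c k hk) (t : ℕ) :
    OnLine x c r q (v + t) (y + t) := by
  induction t with
  | zero => simpa using h
  | succ t ih =>
    simpa only [Nat.cast_succ, add_assoc] using ih.up hx fun _ => hP _ _ _ _

theorem OnLine.add_int (hx : x ∈ G.stratum 2) {c : ι} {r : ZMod G.m} {q v y : ℤ}
    (h : OnLine x c r q v y) (t : ℤ) : OnLine x c r q (v + t) (y + t) := by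
  induction t with
  | zero => simpa using h
  | succ t ih =>
    refine (add_assoc v _ 1 ▸ add_assoc y _ 1 ▸ ih.up hx.1 fun _ h => ?_)
    have := hx.2 (q - (v + t + 1) / G.C c, y + t + 1)
    rw [h] at this
    simp [level] at this
  | pred t ih =>
    refine OnLine.down hx.1 ?_ fun c d r h => ?_
    · rwa [show v + (-t - 1) + 1 = v + -t by ring, show y + (-t - 1) + 1 = y + -t by ring]
    · have := hx.2 (q - (v + (-t - 1)) / G.C c, y + (-t - 1))
      rw [h] at this
      simp [level] at this

/-! ### Rows -/

theorem a_above (hx : x ∈ G.space) {i₀ : ℤ} {j : ℤ}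
    (h : ∀ i, i₀ < i → x (i, j) = a ∨ ∃ c r, x (i, j) = Tile.h c r) {i : ℤ} (hi : i₀ < i) :
    x (i, j + 1) = a := by
  have key : ∀ i, i₀ < i → x (i, j + 1) = a ∨ ∃ c hj r, x (i, j + 1) = L c 0 hj r := by
    intro i hi
    have hv := (hx i j).2.1
    rcases h i hi with h | ⟨c, r, h⟩ <;> rw [h] at hv <;> exact hv
  refine (key i hi).resolve_right fun ⟨c, hj, r, hc⟩ => ?_
  have h1 := (hx i (j + 1)).1
  rw [hc] at h1
  rcases key (i + 1) (by omega) with h2 | ⟨_, _, _, h2⟩ <;> rw [h2] at h1 <;> simp [HRule] at h1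

theorem b_below (hx : x ∈ G.space) {i₀ : ℤ} {j : ℤ}
    (h : ∀ i, i₀ ≤ i → x (i, j + 1) = b ∨ ∃ c r, x (i, j + 1) = Tile.h c r) {i : ℤ} (hi : i₀ < i) :
    x (i, j) = b := by
  have key : ∀ i, i₀ ≤ i → x (i, j) = b ∨ (∃ c k hk r, k + 1 = G.C c ∧ x (i, j) = L c k hk r) ∨
      ∃ k hk, x (i, j) = M k hk := by
    intro i hi
    have hv := (hx i j).2.1
    rcases h i hi with h | ⟨c, r, h⟩ <;> rw [h] at hv
    · rcases hv.below with h | h | ⟨_, _, _, h⟩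
      · exact Or.inl h
      · exact Or.inr (Or.inl h)
      · exact Or.inr (Or.inr ⟨_, _, h⟩)
    · rcases hv.below with h | ⟨_, _, _, h⟩
      · exact Or.inl h
      · exact Or.inr (Or.inr ⟨_, _, h⟩)
  rcases key i hi.le with h1 | ⟨c, k, hk, r, hC, h1⟩ | ⟨k, hk, h1⟩
  · exact h1
  · have hw := (hx i j).2.2.1
    rw [h1] at hw
    rcases hw with ⟨hw, -⟩ | ⟨-, ⟨_, hw⟩ | ⟨-, _, hw⟩⟩
    · exact absurd hC hw
    · rcases h (i - 1) (by omega) with h2 | ⟨_, _, h2⟩ <;> rw [h2] at hw <;> simp at hw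
    · rcases h (i - 1) (by omega) with h2 | ⟨_, _, h2⟩ <;> rw [h2] at hw <;> simp at hw
  · have h2 := (hx i j).1
    rw [h1] at h2
    rcases key (i + 1) (by omega) with h3 | ⟨_, _, _, _, -, h3⟩ | ⟨_, _, h3⟩ <;> rw [h3] at h2 <;>
      simp [HRule] at h2

end lines

namespace IsRow

variable {ρ ρ' : ℤ → G.Tile} (hρ : G.IsRow ρ)
include hρ

theorem eq_a_left {q : ℤ} (hq : ρ q = a ∨ ∃ c k hk r, ρ q = L c k hk r)
    (ha : ∀ j, ¬ IsAxis (ρ j)) {j : ℤ} (hj : j < q) : ρ j = a := by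
  obtain ⟨k, rfl⟩ : ∃ k : ℕ, j = q - 1 - k := ⟨(q - 1 - j).toNat, by omega⟩
  have key : ∀ p, (ρ (p + 1) = a ∨ ∃ c k hk r, ρ (p + 1) = L c k hk r) → ρ p = a := by
    intro p hp
    have h1 := hρ p
    have h2 := ha p
    have h3 : ¬ IsAxis (ρ (p + 1)) := ha _
    revert h1 h2 h3
    rcases hp with hp | ⟨c, k, hk, r, hp⟩ <;> rw [hp] <;> cases ρ p <;> simp [HRule, IsAxis]
  induction k with
  | zero => exact key _ (by simpa using hq)
  | succ k ih =>
    refine key _ (Or.inl ?_)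
    convert ih (by omega) using 2
    push_cast
    ring

theorem eq_b_left {q : ℤ} (hq : ρ q = b ∨ ∃ k hk, ρ q = M k hk)
    (ha : ∀ j, ¬ IsAxis (ρ j)) (hL : ∀ j c k hk r, ρ j ≠ L c k hk r) {j : ℤ} (hj : j < q) :
    ρ j = b := by
  obtain ⟨k, rfl⟩ : ∃ k : ℕ, j = q - 1 - k := ⟨(q - 1 - j).toNat, by omega⟩
  have key : ∀ p, (ρ (p + 1) = b ∨ ∃ k hk, ρ (p + 1) = M k hk) → ρ p = b := by
    intro p hp
    have h1 := hρ p
    have h2 := ha p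
    have h3 := hL p
    revert h1 h2 h3
    rcases hp with hp | ⟨k, hk, hp⟩ <;> rw [hp] <;> cases ρ p <;> simp [HRule, IsAxis]
    all_goals intros; assumption
  induction k with
  | zero => exact key _ (by simpa using hq)
  | succ k ih =>
    refine key _ (Or.inl ?_)
    convert ih (by omega) using 2
    push_cast
    ring

theorem eq_h_left {q : ℤ} {c r} (hq : ρ q = h c r ∨ ∃ d, ρ q = N c r d)
    (ha : ∀ j, ¬ IsAxis (ρ j)) {j : ℤ} (hj : j < q) : ρ j = h c (r - ((q - j : ℤ) : ZMod G.m)) := by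
  obtain ⟨k, rfl⟩ : ∃ k : ℕ, j = q - 1 - k := ⟨(q - 1 - j).toNat, by omega⟩
  have key : ∀ p r, (ρ (p + 1) = h c r ∨ ∃ d, ρ (p + 1) = N c r d) → ρ p = h c (r - 1) := by
    intro p r hp
    have h1 := hρ p
    have h2 := ha p
    revert h1 h2
    rcases hp with hp | ⟨d, hp⟩ <;> rw [hp] <;> cases ρ p <;> simp [HRule, IsAxis]
    all_goals rintro rfl rfl; simp
  induction k with
  | zero => simpa using key _ r (by simpa using hq)
  | succ k ih =>
    convert key _ (r - ((q - (q - 1 - k) : ℤ) : ZMod G.m)) (Or.inl ?_) using 2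
    · push_cast
      ring
    · convert ih (by omega) using 2
      push_cast
      ring

theorem eq_right (hρ' : G.IsRow ρ') {q : ℤ} (hq : ρ q = ρ' q) (h4 : 3 ≤ rk (ρ q))
    (hph : ∀ j, q < j → phase (ρ j) = phase (ρ' j)) {j : ℤ} (hj : q ≤ j) : ρ j = ρ' j := by
  obtain ⟨k, rfl⟩ : ∃ k : ℕ, j = q + k := ⟨(j - q).toNat, by omega⟩
  induction k with
  | zero => simpa using hq
  | succ k ih =>
    have h1 := hρ (q + k)
    have h2 := hρ' (q + k)
    rw [← ih (by omega)] at h2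
    have h3 := hph (q + k + 1) (by omega)
    have h4' : 3 ≤ rk (ρ (q + k)) := h4.trans (hρ.rk_mono (by omega))
    rw [Nat.cast_succ, ← add_assoc]
    revert h1 h2 h3 h4'
    cases ρ (q + k) <;> simp only [rk, HRule] <;> intro h1 h2 h3 h4' <;> try omega
    all_goals
      first
      | exact h1.trans h2.symm
      | rcases h1 with h1 | ⟨_, _, h1⟩ <;> rcases h2 with h2 | ⟨_, _, h2⟩ <;> rw [h1, h2] at h3 ⊢ <;>
          simp_all [phase]

end IsRow

end Drawing
end Geometry

section Geometry

open Function

namespace Drawing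

open Tile

variable {ι : Type} {G : Drawing ι} {x y : ℤ × ℤ → G.Tile}

theorem above_W (hx : x ∈ G.space) {i j : ℤ} (h : x (i, j) = W) (ha : x (i + 1, j) = a) :
    x (i, j + 1) = W := by
  refine (mem_space_iff.1 hx j).2.axis_eq h fun hW => ?_
  simpa [ha, NWRule] using hW

/-- Above the last symbol `P` of a segment. -/
theorem above_corner (hx : x ∈ G.stratum 1) {c : ι} {j : ℕ} {hj : j < G.C c} (hjC : j + 1 = G.C c)
    (h0 : x (0, 0) = P c j hj) (k : ℕ) :
    x (0, k + 1) = W ∧ ∀ i, 0 < i → x (i, k + 1) = a := by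
  induction k with
  | zero =>
    rw [Nat.cast_zero]
    refine ⟨?_, fun i hi => a_above hx.1 (i₀ := 0) (fun i hi => Or.inr ?_) hi⟩
    · have := (hx.1 0 0).2.1
      rw [h0] at this
      rcases this with ⟨_, this⟩ | ⟨-, this⟩
      · omega
      · exact this
    · have hr := (mem_space_iff.1 hx.1 0).1
      have h1 : x (0 + 1, 0) = Tile.h (some c) 1 := by
        have := (hx.1 0 0).1
        rw [h0] at this
        rcases this with ⟨_, this⟩ | ⟨-, this⟩
        · omega
        · exact this
      refine ⟨_, _, hr.eq_h (q := i + 1) h1 (fun l _ _ c r d hN => ?_) (j := i) (by omega) (by omega)⟩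
      refine axis_phase hx (p := (0, 0)) (q := (l, 0)) (i := 0) (by rw [h0]; trivial) ?_
      rw [hN]
      rfl
  | succ k ih =>
    push_cast at ih ⊢
    exact ⟨above_W hx.1 ih.1 (ih.2 _ (by omega)),
      fun i hi => a_above hx.1 (i₀ := 0) (fun i hi => Or.inl (ih.2 i hi)) hi⟩

theorem corner_unique_of_last (hx : x ∈ G.stratum 1) (hy : y ∈ G.stratum 1) {c : ι} {j : ℕ}
    {hj : j < G.C c} (hjC : j + 1 = G.C c) (hx0 : x (0, 0) = P c j hj) (hy0 : y (0, 0) = P c j hj) :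
    x = y := by
  have key : ∀ x ∈ G.stratum 1, x (0, 0) = P c j hj → ∀ i k : ℤ, 1 ≤ i + 2 * k →
      x (i, k) = if k < 0 then b else if i < 0 then o else if i = 0 then (if k = 0 then P c j hj else W)
        else if k = 0 then Tile.h (some c) i else a := by
    intro x hx h0 i k hik
    have hr := fun y => (mem_space_iff.1 hx.1 y).1
    have hh : ∀ i, 0 < i → x (i, 0) = Tile.h (some c) i := by
      intro i hi
      have h1 : x (0 + 1, 0) = Tile.h (some c) 1 := by
        have := (hx.1 0 0).1
        rw [h0] at this
        rcases this with ⟨_, this⟩ | ⟨-, this⟩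
        · omega
        · exact this
      have := (hr 0).eq_h (q := i + 1) h1 (fun l _ _ c r d hN => ?_) (j := i) (by omega) (by omega)
      · rw [this]
        congr
        push_cast
        ring
      · refine axis_phase hx (p := (0, 0)) (q := (l, 0)) (i := 0) (by rw [h0]; trivial) ?_
        rw [hN]
        rfl
    have hneg : ∀ t : ℕ, ∀ i : ℤ, t + 1 < i → x (i, -(t + 1 : ℤ)) = b := by
      intro t
      induction t with
      | zero =>
        intro i hi
        refine b_below hx.1 (i₀ := 1) (fun i hi => Or.inr ⟨some c, i, ?_⟩) (by simpa using hi)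
        simpa using hh i (by omega)
      | succ t ih =>
        intro i hi
        refine b_below hx.1 (i₀ := t + 2) (fun i hi => Or.inl ?_) (by push_cast at hi; omega)
        rw [← ih i (by omega)]
        congr 2
    rcases lt_trichotomy k 0 with hk | rfl | hk
    · rw [if_pos hk]
      obtain ⟨t, rfl⟩ : ∃ t : ℕ, k = -(t + 1 : ℤ) := ⟨(-k - 1).toNat, by omega⟩
      exact hneg t i (by omega)
    · rw [if_neg (by omega), if_neg (by omega), if_neg (by omega), if_pos rfl, hh i (by omega)]
    · obtain ⟨t, rfl⟩ : ∃ t : ℕ, k = t + 1 := ⟨(k - 1).toNat, by omega⟩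
      have h1 := above_corner hx hjC h0 t
      rw [if_neg (by omega)]
      rcases lt_trichotomy i 0 with hi | rfl | hi
      · rw [if_pos hi]
        exact (hr (t + 1)).eq_o (p := 0) (by rw [h1.1]; trivial) hi
      · rw [if_neg (by omega), if_pos rfl, if_neg (by omega), h1.1]
      · rw [if_neg (by omega), if_neg (by omega), if_neg (by omega), h1.2 i hi]
  refine space_det hx.1 hy.1 fun i k h => ?_
  rw [key x hx hx0 i k h, key y hy hy0 i k h]

theorem segment_up (hx : x ∈ G.space) {c : ι} {j : ℕ} {hj : j < G.C c} {p q : ℤ}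
    (h : x (p, q) = P c j hj) (k : ℕ) (hk : j + k < G.C c) : x (p, q + k) = P c (j + k) hk := by
  induction k with
  | zero => simpa using h
  | succ k ih =>
    have := (hx p (q + k)).2.1
    rw [ih (by omega)] at this
    rcases this with ⟨_, this⟩ | ⟨this, -⟩
    · rw [Nat.cast_succ, ← add_assoc]
      exact this
    · omega

theorem shift2_injective {A : Type*} (n : ℤ × ℤ) : Injective (shift2 (S := A) n) := by
  intro x y hxy
  funext m
  simpa [shift2] using congrFun hxy (m - n)

theorem corner_unique (hx : x ∈ G.stratum 1) (hy : y ∈ G.stratum 1) {c : ι} {j : ℕ} {hj : j < G.C c}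
    (hx0 : x (0, 0) = P c j hj) (hy0 : y (0, 0) = P c j hj) : x = y := by
  refine shift2_injective ((0, ((G.C c - 1 - j : ℕ) : ℤ)) : ℤ × ℤ) ?_
  refine corner_unique_of_last (shift2_mem_stratum hx _) (shift2_mem_stratum hy _)
    (c := c) (j := j + (G.C c - 1 - j)) (hj := by omega) (by omega) ?_ ?_
  · simpa [shift2] using segment_up hx.1 hx0 (G.C c - 1 - j) (by omega)
  · simpa [shift2] using segment_up hy.1 hy0 (G.C c - 1 - j) (by omega)

theorem exists_phase_row (hx : x ∈ G.stratum 1) {i : ℕ} {p : ℤ × ℤ} (h : phase (x p) = some i)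
    (y : ℤ) : ∃ i', i' < G.B ∧ phase (x ((G.B * p.1 + i + (y - p.2)) / G.B, y)) = some i' := by
  obtain ⟨v, rfl, hv⟩ := exists_phase (x := x) (μ := p.1) (y := p.2) h
  have := phase_add hx hv (y - p.2)
  rw [add_sub_cancel] at this
  exact ⟨_, phase_lt this, this⟩

theorem IsRow.phase_none {ρ : ℤ → G.Tile} (hρ : G.IsRow ρ) {μ j : ℤ} {i : ℕ}
    (hμ : phase (ρ μ) = some i) (hj : j ≠ μ) : phase (ρ j) = none := by
  rcases hj.lt_or_gt with hj | hj
  · exact hρ.not_M hμ hj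
  · rw [hρ.eq_e_of_phase hμ hj]
    rfl

theorem phase_congr (hx : x ∈ G.stratum 1) (hy : y ∈ G.stratum 1) {p : ℤ × ℤ} {i : ℕ}
    (hx0 : phase (x p) = some i) (hy0 : phase (y p) = some i) (q : ℤ × ℤ) :
    phase (x q) = phase (y q) := by
  obtain ⟨v, rfl, hv⟩ := exists_phase (x := x) (μ := p.1) (y := p.2) hx0
  obtain ⟨w, rfl, hw⟩ := exists_phase (x := y) (μ := p.1) (y := p.2) hy0
  have h1 := phase_add hx hv (q.2 - p.2)
  have h2 := phase_add hy hw (q.2 - p.2)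
  rw [add_sub_cancel] at h1 h2
  by_cases hq : q.1 = (G.B * p.1 + i + (q.2 - p.2)) / G.B
  · rw [← hq] at h1 h2
    exact h1.trans h2.symm
  · exact ((mem_space_iff.1 hx.1 q.2).1.phase_none h1 hq).trans
      ((mem_space_iff.1 hy.1 q.2).1.phase_none h2 hq).symm

theorem not_axis_of_phase (hx : x ∈ G.stratum 1) {p : ℤ × ℤ} {i : ℕ} (h : phase (x p) = some i)
    (q : ℤ × ℤ) : ¬ IsAxis (x q) := fun hq => axis_phase hx hq h

/-- Agreement on a row through a falling line. -/
theorem row_congr (hx : x ∈ G.stratum 1) (hy : y ∈ G.stratum 1) (hax : ∀ p, ¬ IsAxis (x p))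
    (hay : ∀ p, ¬ IsAxis (y p)) (hph : ∀ p, phase (x p) = phase (y p)) {c : ι} {j : ℕ}
    {hj : j < G.C c} {r : ZMod G.m} {q z : ℤ} (hxq : x (q, z) = L c j hj r)
    (hyq : y (q, z) = L c j hj r) (i : ℤ) : x (i, z) = y (i, z) := by
  have h1 := (mem_space_iff.1 hx.1 z).1
  have h2 := (mem_space_iff.1 hy.1 z).1
  rcases lt_or_ge i q with hi | hi
  · rw [h1.eq_a_left (Or.inr ⟨_, _, _, _, hxq⟩) (fun _ => hax _) hi,
      h2.eq_a_left (Or.inr ⟨_, _, _, _, hyq⟩) (fun _ => hay _) hi]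
  · exact h1.eq_right h2 (hxq.trans hyq.symm) (by rw [hxq]; simp [rk]) (fun _ _ => hph _) hi

theorem end_unique (hx : x ∈ G.stratum 1) (hy : y ∈ G.stratum 1) {c : Option ι} {r : ZMod G.m} {d : ι}
    (hx0 : x (0, 0) = N c r d) (hy0 : y (0, 0) = N c r d) : x = y := by
  have px : phase (x (0, 0)) = some 0 := by rw [hx0]; rfl
  have py : phase (y (0, 0)) = some 0 := by rw [hy0]; rfl
  have hax := not_axis_of_phase hx px
  have hay := not_axis_of_phase hy py
  have hph := phase_congr hx hy px py
  have hline : ∀ x ∈ G.stratum 1, (∀ p, ¬ IsAxis (x p)) → x (0, 0) = N c r d → ∀ t : ℕ,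
      OnLine x d (r - 1) (-1) t (1 + t) := by
    intro x hx ha h0 t
    have h1 := (hx.1 0 0).2.2.1
    rw [h0] at h1
    obtain ⟨-, hj, h1⟩ := h1
    have := (exists_onLine h1).add_nat hx.1 (fun p c k hk h => ha p (by rw [h]; trivial)) t
    simpa using this
  refine space_det hx.1 hy.1 fun i k hik => ?_
  rcases lt_trichotomy k 0 with hk | rfl | hk
  · obtain ⟨i', -, h1⟩ := exists_phase_row hx px k
    obtain ⟨i'', -, h2⟩ := exists_phase_row hy py k
    have hB : (0 : ℤ) < G.B := by exact_mod_cast G.B_pos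
    have h3 : ((G.B : ℤ) * 0 + (0 : ℕ) + (k - 0)) / G.B < i :=
      (Int.ediv_lt_of_lt_mul hB (by push_cast; omega)).trans (show (0 : ℤ) < i by omega)
    exact ((mem_space_iff.1 hx.1 k).1.eq_e_of_phase h1 h3).trans
      ((mem_space_iff.1 hy.1 k).1.eq_e_of_phase h2 h3).symm
  · have h1 := (mem_space_iff.1 hx.1 0).1
    have h2 := (mem_space_iff.1 hy.1 0).1
    rw [h1.eq_e_of_phase px (by omega), h2.eq_e_of_phase py (by omega)]
  · obtain ⟨t, rfl⟩ : ∃ t : ℕ, k = 1 + t := ⟨(k - 1).toNat, by omega⟩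
    obtain ⟨_, l1⟩ := hline x hx hax hx0 t
    obtain ⟨_, l2⟩ := hline y hy hay hy0 t
    exact row_congr hx hy hax hay hph l1 l2 i

theorem eq_of_stratum_two (hx : x ∈ G.stratum 2) (p : ℤ × ℤ) :
    (∀ i hi, x p ≠ S i hi) ∧ (∀ c j hj, x p ≠ P c j hj) ∧ ∀ c r d, x p ≠ N c r d := by
  have h := hx.2 p
  refine ⟨fun _ _ h' => ?_, fun _ _ _ h' => ?_, fun _ _ _ h' => ?_⟩ <;> rw [h'] at h <;>
    simp [level] at h

/-- A symbol that can only be below and above itself fills a column. -/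
theorem column_eq {s : G.Tile} {i j : ℤ} (h0 : x (i, j) = s)
    (hup : ∀ y, x (i, y) = s → x (i, y + 1) = s) (hdown : ∀ y, x (i, y + 1) = s → x (i, y) = s)
    (y : ℤ) : x (i, y) = s := by
  suffices ∀ t, x (i, j + t) = s by simpa using this (y - j)
  intro t
  induction t with
  | zero => simpa using h0
  | succ t ih => rw [← add_assoc]; exact hup _ ih
  | pred t ih =>
    refine hdown _ ?_
    rwa [show j + (-t - 1) + 1 = j + -t by ring]

theorem eq_of_K (hx : x ∈ G.stratum 2) (h0 : x (0, 0) = K) (p : ℤ × ℤ) :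
    x p = if p.1 < 0 then o else if p.1 = 0 then K else e := by
  have hc : ∀ y, x (0, y) = K := by
    refine column_eq h0 (fun y hy => ?_) fun y hy => ?_
    · have h := (hx.1 0 y).2.1
      rw [hy] at h
      exact h.resolve_right fun ⟨_, h⟩ => (eq_of_stratum_two hx _).1 _ _ h
    · have h := (hx.1 0 y).2.1
      rw [hy] at h
      exact h.below
  have hr := (mem_space_iff.1 hx.1 p.2).1
  rcases lt_trichotomy p.1 0 with hi | hi | hi
  · rw [if_pos hi]
    exact hr.eq_o (p := 0) (by rw [hc]; trivial) hi
  · rw [if_neg (by omega), if_pos hi, ← hc p.2, ← hi]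
  · rw [if_neg (by omega), if_neg (by omega)]
    refine hr.eq_e (p := 0 + 1) ?_ (by omega)
    have := (hx.1 0 p.2).1
    rw [hc] at this
    exact this

theorem eq_of_W (hx : x ∈ G.stratum 2) (h0 : x (0, 0) = W) (p : ℤ × ℤ) :
    x p = if p.1 < 0 then o else if p.1 = 0 then W else a := by
  have hc : ∀ y, x (0, y) = W := by
    refine column_eq h0 (fun y hy => ?_) fun y hy => ?_
    · have h := (hx.1 0 y).2.1
      rw [hy] at h
      exact h.resolve_right fun ⟨_, _, h⟩ => (eq_of_stratum_two hx _).2.1 _ _ _ h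
    · have h := (hx.1 0 y).2.1
      rw [hy] at h
      rcases h.below with h | ⟨_, _, _, _, h⟩ | ⟨_, h⟩
      · exact h
      · exact absurd h ((eq_of_stratum_two hx _).2.1 _ _ _)
      · exact absurd h ((eq_of_stratum_two hx _).1 _ _)
  have hr := fun y => (mem_space_iff.1 hx.1 y).1
  have step : ∀ i : ℤ, (∀ y, x (i, y) = W ∨ x (i, y) = a) → ∀ y, x (i + 1, y) = a := by
    intro i hi y
    have h := (hx.1 i y).1
    have h' : x (i + 1, y) = a ∨ ∃ c j hj r, x (i + 1, y) = L c j hj r := by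
      rcases hi y with hi | hi <;> rw [hi] at h <;> exact h
    refine h'.resolve_right ?_
    rintro ⟨c, j, hj, r, hL⟩
    have hup : ∀ k, ∀ hk : j + k < G.C c, x (i + 1, y + k) = L c (j + k) hk r := by
      intro k
      induction k with
      | zero => intro _; simpa using hL
      | succ k ih =>
        intro hk
        have := (hx.1 (i + 1) (y + k)).2.1
        rw [ih (by omega)] at this
        rcases this with ⟨_, this⟩ | ⟨this, -⟩
        · rw [Nat.cast_succ, ← add_assoc]
          exact this
        · omega
    have hw := (hx.1 (i + 1) (y + (G.C c - 1 - j : ℕ))).2.2.1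
    rw [hup _ (by omega), add_sub_cancel_right] at hw
    rcases hw with ⟨hw, -⟩ | ⟨-, ⟨_, hw⟩ | ⟨-, _, hw⟩⟩
    · omega
    · rcases hi (y + (G.C c - 1 - j : ℕ) + 1) with hi | hi <;> rw [hi] at hw <;> simp at hw
    · rcases hi (y + (G.C c - 1 - j : ℕ) + 1) with hi | hi <;> rw [hi] at hw <;> simp at hw
  have ha : ∀ t : ℕ, ∀ y, x (t + 1, y) = a := by
    intro t
    induction t with
    | zero => simpa using step 0 fun y => Or.inl (hc y)
    | succ t ih => simpa using step (t + 1) fun y => Or.inr (ih y)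
  rcases lt_trichotomy p.1 0 with hi | hi | hi
  · rw [if_pos hi]
    exact (hr p.2).eq_o (p := 0) (by rw [hc]; trivial) hi
  · rw [if_neg (by omega), if_pos hi, ← hc p.2, ← hi]
  · rw [if_neg (by omega), if_neg (by omega), ← ha (p.1 - 1).toNat p.2]
    congr 1
    ext
    · simp only
      omega
    · rfl

theorem not_axis_of_notMem (hx : x ∈ G.stratum 2) {q : ℤ × ℤ}
    (hq : x q ∉ ({o, K, e, W, a} : Set G.Tile)) (p : ℤ × ℤ) : ¬ IsAxis (x p) := by
  intro hp
  refine hq ?_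
  have hs := shift2_mem_stratum hx p
  have hq' : x q = shift2 p x (q - p) := by simp [shift2]
  have h2 := eq_of_stratum_two hx p
  have h0 : x p = K ∨ x p = W := by
    revert hp h2
    cases x p <;> simp [IsAxis]
    all_goals trivial
  rcases h0 with h0 | h0
  · rw [hq', eq_of_K hs (by simpa [shift2, show ((0, 0) : ℤ × ℤ) = 0 from rfl] using h0)]
    split_ifs <;> simp
  · rw [hq', eq_of_W hs (by simpa [shift2, show ((0, 0) : ℤ × ℤ) = 0 from rfl] using h0)]
    split_ifs <;> simp

theorem eq_of_h (hx : x ∈ G.stratum 2) {c r} (h0 : x (0, 0) = Tile.h c r) (p : ℤ × ℤ) :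
    x p = if p.2 < 0 then b else if p.2 = 0 then Tile.h c (r + (p.1 : ZMod G.m)) else a := by
  have hr := fun y => (mem_space_iff.1 hx.1 y).1
  have hax := not_axis_of_notMem hx (q := (0, 0)) (by simp [h0])
  have h1 : ∀ i : ℤ, x (i, 0) = Tile.h c (r + (i : ZMod G.m)) := by
    intro i
    rcases le_or_gt 0 i with hi | hi
    · have := (hr 0).eq_h (q := i + 1) h0 (fun j _ _ => (eq_of_stratum_two hx _).2.2) hi (by omega)
      simpa using this
    · have := (hr 0).eq_h_left (Or.inl h0) (fun _ => hax _) hi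
      simpa using this
  have hpos : ∀ t : ℕ, ∀ i, x (i, t + 1) = a := by
    intro t
    induction t with
    | zero =>
      intro i
      simpa using a_above hx.1 (i₀ := i - 1) (j := 0) (fun i _ => Or.inr ⟨_, _, h1 i⟩)
        (i := i) (by omega)
    | succ t ih =>
      intro i
      simpa using a_above hx.1 (i₀ := i - 1) (fun i _ => Or.inl (ih i)) (i := i) (by omega)
  have hneg : ∀ t : ℕ, ∀ i, x (i, -(t + 1 : ℤ)) = b := by
    intro t
    induction t with
    | zero =>
      intro i
      refine b_below hx.1 (i₀ := i - 1) (fun i _ => Or.inr ⟨c, r + (i : ZMod G.m), ?_⟩) (by omega)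
      simpa using h1 i
    | succ t ih =>
      intro i
      refine b_below hx.1 (i₀ := i - 1) (fun i _ => Or.inl ?_) (by omega)
      rw [← ih i]
      congr 2
  obtain ⟨i, k⟩ := p
  simp only
  rcases lt_trichotomy k 0 with hk | hk | hk
  · rw [if_pos hk, ← hneg (-k - 1).toNat i]
    congr 2
    omega
  · rw [if_neg (by omega), if_pos hk, hk, h1]
  · rw [if_neg (by omega), if_neg (by omega), ← hpos (k - 1).toNat i]
    congr 2
    omega

theorem phase_of_line (hx : x ∈ G.stratum 2) {p : ℤ × ℤ} {c j hj r} (h : x p = L c j hj r)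
    (q : ℤ × ℤ) : phase (x q) = none := by
  by_contra hq
  obtain ⟨i, hi⟩ := Option.ne_none_iff_exists'.1 hq
  have hx1 := stratum_anti (by norm_num : 1 ≤ 2) hx
  obtain ⟨v, -, hv⟩ := exists_phase (x := x) (μ := q.1) (y := q.2) hi
  set z := min (p.2 - j) (G.B * p.1 - v + q.2 - 1) with hz
  have h1 := phase_add hx1 hv (z - q.2)
  have hB : (0 : ℤ) < G.B := by exact_mod_cast G.B_pos
  have hC : (0 : ℤ) < G.C c := by exact_mod_cast G.C_pos c
  obtain ⟨_, h2⟩ := (exists_onLine (q := p.1) (y := p.2) h).add_int hx (z - p.2)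
  rw [add_sub_cancel] at h1 h2
  have h3 : (v + (z - q.2)) / G.B < p.1 := Int.ediv_lt_of_lt_mul hB (by rw [mul_comm]; omega)
  have h4 : (j + (z - p.2)) / (G.C c : ℤ) ≤ 0 :=
    (Int.ediv_le_ediv hC (by omega : (j : ℤ) + (z - p.2) ≤ 0)).trans_eq (Int.zero_ediv _)
  have := (mem_space_iff.1 hx.1 z).1.eq_e_of_phase h1 (j := p.1 - (j + (z - p.2)) / (G.C c : ℤ))
    (by omega)
  rw [this] at h2
  simp at h2

theorem line_unique (hx : x ∈ G.stratum 2) (hy : y ∈ G.stratum 2) {c : ι} {j : ℕ} {hj : j < G.C c}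
    {r : ZMod G.m} (hx0 : x (0, 0) = L c j hj r) (hy0 : y (0, 0) = L c j hj r) : x = y := by
  funext ⟨i, k⟩
  obtain ⟨_, h1⟩ := (exists_onLine hx0).add_int hx k
  obtain ⟨_, h2⟩ := (exists_onLine hy0).add_int hy k
  rw [zero_add] at h1 h2
  exact row_congr (stratum_anti one_le_two hx) (stratum_anti one_le_two hy)
    (not_axis_of_notMem hx (q := (0, 0)) (by simp [hx0]))
    (not_axis_of_notMem hy (q := (0, 0)) (by simp [hy0]))
    (fun p => (phase_of_line hx hx0 p).trans (phase_of_line hy hy0 p).symm) h1 h2 i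

theorem phase_unique (hx : x ∈ G.stratum 2) (hy : y ∈ G.stratum 2) {i : ℕ}
    (hx0 : phase (x (0, 0)) = some i) (hy0 : phase (y (0, 0)) = some i) : x = y := by
  have key : ∀ x ∈ G.stratum 2, phase (x (0, 0)) = some i → ∀ j z i', phase (x (j, z)) = some i' →
      (∀ l, l < j → x (l, z) = b) ∧ (∃ hi, x (j, z) = M i' hi) ∧ ∀ l, j < l → x (l, z) = e := by
    intro x hx h0 j z i' h
    have hx1 := stratum_anti one_le_two hx
    have hr := (mem_space_iff.1 hx.1 z).1
    have hM : ∃ hi, x (j, z) = M i' hi := by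
      have h2 := eq_of_stratum_two hx (j, z)
      revert h h2
      cases x (j, z) <;> simp [phase]
      · rintro rfl
        simp
        assumption
    refine ⟨fun l hl => ?_, hM, fun l hl => hr.eq_e_of_phase h hl⟩
    obtain ⟨_, hM⟩ := hM
    refine hr.eq_b_left (Or.inr ⟨_, _, hM⟩) (fun _ => not_axis_of_phase hx1 h0 _)
      (fun l c k hk r hL => ?_) hl
    have := phase_of_line hx hL (0, 0)
    rw [this] at h0
    simp at h0
  funext ⟨l, z⟩
  have hx1 := stratum_anti one_le_two hx
  have hy1 := stratum_anti one_le_two hy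
  obtain ⟨i', -, h1⟩ := exists_phase_row hx1 hx0 z
  have h2 := (phase_congr hx1 hy1 hx0 hy0 _).symm.trans h1
  obtain ⟨a1, ⟨_, a2⟩, a3⟩ := key x hx hx0 _ _ _ h1
  obtain ⟨b1, ⟨_, b2⟩, b3⟩ := key y hy hy0 _ _ _ h2
  rcases lt_trichotomy l (((G.B : ℤ) * (0, 0).1 + i + (z - (0, 0).2)) / G.B) with hl | rfl | hl
  · rw [a1 l hl, b1 l hl]
  · rw [a2, b2]
  · rw [a3 l hl, b3 l hl]

theorem eq_const_of_stratum_three (hx : x ∈ G.stratum 3) (p : ℤ × ℤ) : x p = x (0, 0) := by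
  have h3 : ∀ p, x p = o ∨ x p = e ∨ x p = a ∨ x p = b := by
    intro p
    have := hx.2 p
    revert this
    cases x p <;> simp [level]
  have hh : ∀ i j, x (i + 1, j) = x (i, j) := by
    intro i j
    have h1 := (hx.1 i j).1
    rcases h3 (i, j) with h | h | h | h <;> rcases h3 (i + 1, j) with h' | h' | h' | h' <;>
      rw [h, h'] at h1 ⊢ <;> simp [HRule, IsAxis] at h1
  have hv : ∀ i j, x (i, j + 1) = x (i, j) := by
    intro i j
    have h1 := (hx.1 i j).2.1
    rcases h3 (i, j) with h | h | h | h <;> rcases h3 (i, j + 1) with h' | h' | h' | h' <;>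
      rw [h, h'] at h1 ⊢ <;> simp [VRule, phase] at h1
  have h1 : ∀ i j, x (i, j) = x (0, j) := by
    intro i j
    induction i with
    | zero => rfl
    | succ i ih => rw [hh, ih]
    | pred i ih => rw [← ih, ← hh, sub_add_cancel]
  have h2 : ∀ j, x (0, j) = x (0, 0) := by
    intro j
    induction j with
    | zero => rfl
    | succ j ih => rw [hv, ih]
    | pred j ih => rw [← ih, ← hv, sub_add_cancel]
  exact (h1 p.1 p.2).trans (h2 p.2)

/-- A configuration of a stratum is determined by a symbol of the corresponding level. -/
theorem stratum_unique {k : ℕ} (hk : 1 ≤ k) (hx : x ∈ G.stratum k) (hy : y ∈ G.stratum k)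
    {p : ℤ × ℤ} (hxy : x p = y p) (hl : level (x p) = k) : x = y := by
  refine shift2_injective p ?_
  replace hx := shift2_mem_stratum hx p
  replace hy := shift2_mem_stratum hy p
  obtain ⟨s, hs⟩ : ∃ s, s = x p := ⟨_, rfl⟩
  have hx0 : shift2 p x (0, 0) = s := by simp [shift2, hs, show ((0, 0) : ℤ × ℤ) = 0 from rfl]
  have hy0 : shift2 p y (0, 0) = s := by
    simp [shift2, hs, hxy, show ((0, 0) : ℤ × ℤ) = 0 from rfl]
  rw [← hs] at hl
  subst hl
  generalize shift2 p x = x at *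
  generalize shift2 p y = y at *
  cases s
  case S => simp [level] at hk
  case P => exact corner_unique hx hy hx0 hy0
  case N => exact end_unique hx hy hx0 hy0
  case K => exact funext fun q => (eq_of_K hx hx0 q).trans (eq_of_K hy hy0 q).symm
  case W => exact funext fun q => (eq_of_W hx hx0 q).trans (eq_of_W hy hy0 q).symm
  case h => exact funext fun q => (eq_of_h hx hx0 q).trans (eq_of_h hy hy0 q).symm
  case L => exact line_unique hx hy hx0 hy0
  case M i hi => exact phase_unique hx hy (i := i) (by rw [hx0]; rfl) (by rw [hy0]; rfl)
  all_goals
    exact funext fun q => (eq_const_of_stratum_three hx q).trans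
      ((hx0.trans hy0.symm).trans (eq_const_of_stratum_three hy q).symm)

end Drawing
end Geometry

section Geometry

open Function Set Topology

namespace Drawing

open Tile

variable {ι : Type} {G : Drawing ι}

section shifts

variable {A : Type} [TopologicalSpace A]

/-- The shift as a homeomorphism. -/
def shiftHomeo (n : ℤ × ℤ) : (ℤ × ℤ → A) ≃ₜ (ℤ × ℤ → A) where
  toFun := shift2 n
  invFun := shift2 (-n)
  left_inv x := by funext m; simp [shift2]
  right_inv x := by funext m; simp [shift2]
  continuous_toFun := continuous_pi fun m => continuous_apply (n + m)
  continuous_invFun := continuous_pi fun m => continuous_apply (-n + m)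

theorem shift2_mem_cbD {X : Set (ℤ × ℤ → A)} (hX : ∀ x ∈ X, ∀ n, shift2 n x ∈ X) {o : Ordinal.{0}}
    {x : ℤ × ℤ → A} (hx : x ∈ cbD X o) (n : ℤ × ℤ) : shift2 n x ∈ cbD X o := by
  have h : shiftHomeo n '' X = X := by
    refine Subset.antisymm (image_subset_iff.2 fun x hx => hX x hx n) fun x hx => ?_
    exact ⟨shift2 (-n) x, hX x hx _, (shiftHomeo n).right_inv x⟩
  rw [← h, cbD_image_homeomorph]
  exact mem_image_of_mem _ hx

theorem exists_mem_cbD_add_one [CompactSpace A] [T1Space A] {X : Set (ℤ × ℤ → A)} (hX : ∀ x ∈ X, ∀ n, shift2 n x ∈ X)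
    (hcl : IsClosed X) {o : Ordinal.{0}} {x : ℤ × ℤ → A} (hx : x ∈ cbD X o) {v : ℕ → ℤ × ℤ}
    (hv : Injective fun k => shift2 (v k) x) {C : Set (ℤ × ℤ → A)} (hC : IsClosed C)
    (hxC : ∀ k, shift2 (v k) x ∈ C) : ∃ z ∈ C, z ∈ cbD X (o + 1) := by
  have hsub : range (fun k => shift2 (v k) x) ⊆ C ∩ cbD X o := by
    rintro _ ⟨k, rfl⟩
    exact ⟨hxC k, shift2_mem_cbD hX hx _⟩
  obtain ⟨z, hz, hacc⟩ := (infinite_range_of_injective hv).exists_accPt_of_subset_isCompact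
    (hC.inter (isClosed_cbD hcl o)).isCompact hsub
  refine ⟨z, hz.1, ?_⟩
  rw [cbD_add_one]
  refine ⟨hz.2, ?_⟩
  rw [accPt_principal_iff_clusterPt, ← mem_closure_iff_clusterPt] at hacc
  exact closure_mono (sdiff_subset_sdiff_left (hsub.trans inter_subset_right)) hacc

end shifts

theorem isClosed_space [TopologicalSpace G.Tile] [DiscreteTopology G.Tile] : IsClosed G.space := by
  have key (R : G.Tile → G.Tile → Prop) (p q : ℤ × ℤ) :
      IsClosed {x : ℤ × ℤ → G.Tile | R (x p) (x q)} := by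
    have h : Continuous fun x : ℤ × ℤ → G.Tile => (x p, x q) := by fun_prop
    exact IsClosed.preimage h (isClosed_discrete {t : G.Tile × G.Tile | R t.1 t.2})
  simp only [space, ofPred_forall, ofPred_and]
  exact isClosed_iInter fun i => isClosed_iInter fun j => (key _ _ _).inter
    ((key _ _ _).inter ((key _ _ _).inter (key _ _ _)))

theorem isClopen_cylinder {A : Type} [TopologicalSpace A] [DiscreteTopology A] (p : ℤ × ℤ)
    (Q : Set A) : IsClopen {x : ℤ × ℤ → A | x p ∈ Q} :=
  IsClopen.preimage (isClopen_discrete Q) (continuous_apply p : Continuous fun x : ℤ × ℤ → A => x p)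

theorem seed_down {x : ℤ × ℤ → G.Tile} (hx : x ∈ G.space) {p q : ℤ} (i : ℕ) {hi}
    (h : x (p, q) = S i hi) : x (p, q - i) = S 0 (Nat.zero_le _) := by
  induction i generalizing q with
  | zero => simpa using h
  | succ i ih =>
    have h1 := (hx p (q - 1)).2.1
    rw [sub_add_cancel, h] at h1
    obtain ⟨_, h1⟩ := h1.below
    rw [← ih h1]
    congr 2
    push_cast
    ring

theorem K_below_seed {x : ℤ × ℤ → G.Tile} (hx : x ∈ G.space) {p q : ℤ}
    (h : x (p, q) = S 0 (Nat.zero_le _)) (k : ℕ) : x (p, q - (k + 1)) = K := by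
  induction k with
  | zero =>
    have h1 := (hx p (q - 1)).2.1
    rw [sub_add_cancel, h] at h1
    simpa using h1.below
  | succ k ih =>
    have h1 := (hx p (q - (k + 1) - 1)).2.1
    rw [sub_add_cancel, ih] at h1
    rw [Nat.cast_succ, ← sub_sub _ _ (1 : ℤ)]
    exact h1.below

theorem shift2_injective_of_ne {A : Type} {x : ℤ × ℤ → A} {v : ℕ → ℤ × ℤ}
    (h : ∀ k l, k < l → x (v l - v k) ≠ x 0) : Injective fun k => shift2 (v k) x := by
  have key : ∀ k l, k < l → shift2 (v k) x ≠ shift2 (v l) x := fun k l hkl heq => by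
    have := congrFun heq (-v k)
    simp only [shift2, add_neg_cancel, ← sub_eq_add_neg] at this
    exact h k l hkl this.symm
  intro k l hkl
  by_contra hne
  rcases lt_or_gt_of_ne hne with hlt | hlt
  · exact key k l hlt hkl
  · exact key l k hlt hkl.symm

variable [Finite ι] [TopologicalSpace ι] [DiscreteTopology ι] [TopologicalSpace G.Tile]
  [DiscreteTopology G.Tile] {o : Ordinal.{0}}

theorem cbD_add_one_subset (hcomp : IsCompact {σ | G.Valid σ})
    (h1 : cbD {σ | G.Valid σ} (o + 1) = ∅) : cbD G.space (o + 1) ⊆ G.stratum 1 := by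
  have hX : ∀ x ∈ G.space, ∀ n, shift2 n x ∈ G.space := fun x hx n => shift2_mem_space hx n
  have hsub : cbD G.space (o + 1) ⊆ G.space := by simpa [cbD_zero] using cbD_antitone G.space zero_le
  intro x hx
  refine ⟨hsub hx, fun p => Nat.one_le_iff_ne_zero.2 fun hp => ?_⟩
  obtain ⟨i, hi, hS⟩ : ∃ i hi, x p = S i hi := by
    revert hp
    cases x p <;> simp [level]
    assumption
  have h0 := seed_down (hsub hx) (p := p.1) (q := p.2) i hS
  have hmem : shift2 (p.1, p.2 - i) x ∈ cbD G.space (o + 1) ∩ {x | x (0, 0) = S 0 (Nat.zero_le _)} :=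
    ⟨shift2_mem_cbD hX hx _, by simpa [shift2] using h0⟩
  have hopen : IsOpen {x : ℤ × ℤ → G.Tile | x (0, 0) = S 0 (Nat.zero_le _)} :=
    (isClopen_cylinder (0, 0) {S 0 (Nat.zero_le _)}).isOpen
  rw [← cbD_inter_open _ hopen, ← image_cfg, cbD_image_of_isCompact hcomp cfg_injOn
    continuous_cfg.continuousOn, h1, image_empty] at hmem
  exact hmem

omit [Finite ι] [TopologicalSpace ι] [DiscreteTopology ι] in
theorem cbD_succ_subset {k : ℕ} (hk : 1 ≤ k) (h : cbD G.space (o + k) ⊆ G.stratum k) :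
    cbD G.space (o + (k + 1 : ℕ)) ⊆ G.stratum (k + 1) := by
  intro x hx
  rw [Nat.cast_succ, ← add_assoc, cbD_add_one] at hx
  refine ⟨(h hx.1).1, fun p => lt_of_le_of_ne ((h hx.1).2 p) fun hp => ?_⟩
  have hopen : IsOpen {y : ℤ × ℤ → G.Tile | y p = x p} :=
    (isClopen_cylinder p {x p}).isOpen
  obtain ⟨y, hy, hyx, hne⟩ := mem_closure_iff.1 hx.2 _ hopen rfl
  exact hne (stratum_unique hk (h hx.1) (h hyx) (Eq.symm hy) hp.symm).symm

theorem cbD_add_subset (hcomp : IsCompact {σ | G.Valid σ})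
    (h1 : cbD {σ | G.Valid σ} (o + 1) = ∅) (k : ℕ) :
    cbD G.space (o + (k + 1 : ℕ)) ⊆ G.stratum (k + 1) := by
  induction k with
  | zero => simpa using cbD_add_one_subset hcomp h1
  | succ k ih => exact cbD_succ_subset (by omega) ih

theorem cbRank_space (hcomp : IsCompact {σ | G.Valid σ}) (h0 : (cbD {σ | G.Valid σ} o).Nonempty)
    (h1 : cbD {σ | G.Valid σ} (o + 1) = ∅) : cbRank G.space = o + 4 ∧ G.space.Countable := by
  have hX : ∀ x ∈ G.space, ∀ n, shift2 n x ∈ G.space := fun x hx n => shift2_mem_space hx n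
  have hsub := cbD_add_subset hcomp h1
  have hempty : cbD G.space (o + 3 + 1) = ∅ := by
    refine subset_empty_iff.1 fun x hx => ?_
    have h4 := (hsub 3 (by simpa [add_assoc, show (3 : Ordinal) + 1 = 4 by norm_num] using hx)).2 0
    exact absurd (level_lt (x 0)) (by omega)
  refine ⟨?_, countable_of_cbD_eq_empty hempty⟩
  rw [show o + 4 = o + 3 + 1 by rw [add_assoc]; norm_num]
  refine cbRank_eq_add_one ?_ hempty
  have hclosed (Q : Set G.Tile) : IsClosed {x : ℤ × ℤ → G.Tile | x (0, 0) ∈ Q} :=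
    (isClopen_cylinder (0, 0) Q).isClosed
  obtain ⟨σ, hσ⟩ := h0
  have hσV : G.Valid σ := by simpa [cbD_zero] using cbD_antitone {σ | G.Valid σ} zero_le hσ
  have hxX : G.cfg σ ∈ G.space := cfg_mem hσV
  have hx : G.cfg σ ∈ cbD G.space o := by
    have hopen : IsOpen {x : ℤ × ℤ → G.Tile | x (0, 0) = S 0 (Nat.zero_le _)} :=
      (isClopen_cylinder (0, 0) {S 0 (Nat.zero_le _)}).isOpen
    have : G.cfg σ ∈ cbD (G.cfg '' {σ | G.Valid σ}) o := by
      rw [cbD_image_of_isCompact hcomp cfg_injOn continuous_cfg.continuousOn]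
      exact mem_image_of_mem _ hσ
    rw [image_cfg, cbD_inter_open _ hopen] at this
    exact this.1
  have hxs : G.cfg σ (0, 0) = S 0 (Nat.zero_le _) := cfg_seed σ
  have hinj : Injective fun k => shift2 (0, ((G.B * G.num σ (k + 1) : ℕ) : ℤ)) (G.cfg σ) := by
    refine shift2_injective_of_ne fun k l hkl heq => ?_
    have h1 : (0 : ℕ) < G.B * G.num σ (l + 1) - G.B * G.num σ (k + 1) :=
      Nat.sub_pos_of_lt (Nat.mul_lt_mul_of_pos_left (num_strictMono hσV (by omega)) G.B_pos)
    obtain ⟨n, hn⟩ := Nat.exists_eq_add_one.2 h1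
    have h2 : G.cfg σ (0, (n : ℤ) + 1) = S 0 (Nat.zero_le _) := by
      rw [← hxs, ← show (0 : ℤ × ℤ) = (0, 0) from rfl, ← heq]
      congr 1
      ext
      · simp
      · simp only [Prod.snd_sub]
        omega
    have h3 := K_below_seed hxX h2 n
    rw [sub_self, hxs] at h3
    cases h3
  obtain ⟨z, ⟨c, j, hj, hjC, hz0⟩, hz⟩ := exists_mem_cbD_add_one hX isClosed_space hx hinj
    (hclosed {s | ∃ c j hj, j + 1 = G.C c ∧ s = P c j hj}) fun k => by
      refine ⟨σ k, _, Nat.sub_lt (G.C_pos _) one_pos, Nat.sub_add_cancel (G.C_pos _), ?_⟩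
      simp only [shift2, Prod.mk_add_mk, cfg, add_zero, Nat.cast_mul]
      rw [cfgRow_num hσV]
      simp [horRow, axis]
  have hz1 : z ∈ G.stratum 1 := hsub 0 (by simpa using hz)
  have hzW := above_corner hz1 hjC hz0
  have hinj' : Injective fun k : ℕ => shift2 (0, (k : ℤ) + 1) z := by
    refine shift2_injective_of_ne fun k l hkl heq => ?_
    obtain ⟨n, rfl⟩ := Nat.exists_eq_add_of_lt hkl
    have h2 : z (0, (n : ℤ) + 1) = z (0, 0) := by
      rw [← show (0 : ℤ × ℤ) = (0, 0) from rfl, ← heq]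
      congr 1
      ext
      · simp
      · simp only [Prod.snd_sub]
        push_cast
        ring
    rw [(hzW n).1, hz0] at h2
    cases h2
  obtain ⟨w, hwC, hw⟩ := exists_mem_cbD_add_one hX isClosed_space hz hinj' (hclosed {W})
    fun k => by simp [shift2, hzW k]
  have hw2 : w ∈ G.stratum 2 :=
    hsub 1 (by simpa [add_assoc, show (1 : Ordinal) + 1 = 2 by norm_num] using hw)
  have hww := eq_of_W hw2 hwC
  have hinj'' : Injective fun k : ℕ => shift2 ((k : ℤ), 0) w := by
    refine shift2_injective_of_ne fun k l hkl heq => ?_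
    rw [hww, hww] at heq
    have h1 : (l : ℤ) - k ≠ 0 := by omega
    have h2 : ¬ (l : ℤ) < k := by omega
    simp [h1, h2] at heq
  obtain ⟨u, -, hu⟩ := exists_mem_cbD_add_one hX isClosed_space hw hinj'' isClosed_univ
    fun _ => mem_univ _
  exact ⟨u, by simpa [add_assoc, show (1 : Ordinal) + (1 + 1) = 3 by norm_num] using hu⟩

end Drawing
end Geometry

section Conway

open Function Set Topology

namespace RegMachine

open Nat (fermatNumber)

/-- The code of the contents of the first `N` registers. -/
def encode (N : ℕ) (v : ℕ → ℕ) : ℕ := ∏ r ∈ Finset.range N, fermatNumber r ^ v r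

theorem encode_pos (N : ℕ) (v : ℕ → ℕ) : 0 < encode N v :=
  Finset.prod_pos fun r _ => Nat.pow_pos (by have := Nat.three_le_fermatNumber r; omega)

theorem encode_mul (N : ℕ) (v w : ℕ → ℕ) : encode N v * encode N w = encode N (v + w) := by
  simp only [encode, ← Finset.prod_mul_distrib, Pi.add_apply, pow_add]

theorem encode_congr {N : ℕ} {v w : ℕ → ℕ} (h : ∀ r < N, v r = w r) : encode N v = encode N w :=
  Finset.prod_congr rfl fun r hr => by rw [h r (Finset.mem_range.1 hr)]

theorem fermatNumber_dvd_encode {N r : ℕ} (hr : r < N) (v : ℕ → ℕ) :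
    fermatNumber r ∣ encode N v ↔ 0 < v r := by
  constructor
  · intro hdvd
    by_contra! h0
    have hcop : Nat.Coprime (fermatNumber r) (encode N v) := by
      refine Nat.Coprime.prod_right fun s _ => ?_
      rcases eq_or_ne r s with rfl | hrs
      · simp [Nat.le_zero.1 h0]
      · exact (Nat.coprime_fermatNumber_fermatNumber hrs).pow_right _
    have h1 := hcop.eq_one_of_dvd hdvd
    have := Nat.three_le_fermatNumber r
    omega
  · exact fun h => (dvd_pow_self _ h.ne').trans
      (Finset.dvd_prod_of_mem (fun r => fermatNumber r ^ v r) (Finset.mem_range.2 hr))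

variable {Q ι : Type} (M : RegMachine Q ι)

/-- The tests of a rule in terms of the code of the registers. -/
def CodeGuard (i : ι) (n : ℕ) : Prop :=
  (∀ r ∈ M.zero i, ¬ fermatNumber r ∣ n) ∧ ∀ r ∈ M.dec i, fermatNumber r ∣ n

/-- What can be told about the code of the registers after using a rule. -/
def CodePost (j : ι) (n : ℕ) : Prop :=
  ∀ r, (r ∈ M.zero j → M.add j r = 0 → ¬ fermatNumber r ∣ n) ∧ (0 < M.add j r → fermatNumber r ∣ n)

/-- The rules which may follow each other, depending on the code of the registers. The register `d`
counts the steps. -/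
def CodeStep (d : ℕ) (q : Q) (n : ℕ) (i : ι) : Option ι → Prop
  | none => ¬ fermatNumber d ∣ n ∧ M.src i = q ∧ M.CodeGuard i n
  | some j => fermatNumber d ∣ n ∧ M.src i = M.tgt j ∧ M.CodePost j n ∧ M.CodeGuard i n

variable {M}

theorem BackDet.codeStep_unique (hM : M.BackDet) {d : ℕ} {q : Q} {n : ℕ} {i : ι} {a b : Option ι}
    (ha : M.CodeStep d q n i a) (hb : M.CodeStep d q n i b) : a = b := by
  rcases a with _ | j <;> rcases b with _ | j'
  · rfl
  · exact absurd hb.1 ha.1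
  · exact absurd ha.1 hb.1
  · by_contra hne
    obtain ⟨r, ⟨hz, h0, hp⟩ | ⟨hz, h0, hp⟩⟩ := hM j j' (by simpa using hne) (ha.2.1.symm.trans hb.2.1)
    · exact (ha.2.2.1 r).1 hz h0 ((hb.2.2.1 r).2 hp)
    · exact (hb.2.2.1 r).1 hz h0 ((ha.2.2.1 r).2 hp)

variable (M) in
/-- The exponents of the numerator of the fraction by which a rule multiplies the code. -/
def numer (d : ℕ) (i : ι) (r : ℕ) : ℕ :=
  if r = d then 1 else (if r ∈ M.dec i then 0 else 1) + M.add i r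

theorem encode_denom (d : ℕ) :
    encode (d + 1) (fun r => if r = d then 0 else 1) = fermatNumber d - 2 := by
  rw [← Nat.prod_fermatNumber, encode, Finset.prod_range_succ, if_pos rfl, pow_zero, mul_one]
  exact Finset.prod_congr rfl fun r hr => by rw [if_neg (Finset.mem_range.1 hr).ne, pow_one]

theorem fermatNumber_le_encode_numer (d : ℕ) (i : ι) :
    fermatNumber d ≤ encode (d + 1) (M.numer d i) :=
  Nat.le_of_dvd (encode_pos _ _) ((fermatNumber_dvd_encode d.lt_succ_self _).2 (by simp [numer]))

/-- The drawing associated with a register machine. -/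
noncomputable def drawing (hM : M.BackDet) (d : ℕ) (hd : 0 < d) (q : Q) (v : ℕ →₀ ℕ) (hv : v ≠ 0)
    (hvd : ∀ r, v r ≠ 0 → r < d) : Drawing ι where
  B := fermatNumber d - 2
  seed := encode (d + 1) v
  m := encode (d + 1) 1
  C i := encode (d + 1) (M.numer d i) - (fermatNumber d - 2)
  T a ρ i := M.CodeStep d q ρ.val i a
  two_le_B := by
    have h1 := Nat.fermatNumber_strictMono hd
    have h2 := Nat.three_le_fermatNumber 0
    omega
  two_le_seed := by
    obtain ⟨r, hr⟩ := Finsupp.ne_iff.1 hv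
    have h1 := Nat.le_of_dvd (encode_pos (d + 1) v)
      ((fermatNumber_dvd_encode (by have := hvd r hr; omega) _).2 (Nat.pos_of_ne_zero hr))
    have h2 := Nat.three_le_fermatNumber r
    omega
  two_le_C i := by
    have h1 := fermatNumber_le_encode_numer (M := M) d i
    have h2 := Nat.three_le_fermatNumber d
    omega
  m_pos := encode_pos _ _
  T_unique ha hb := hM.codeStep_unique ha hb

section simulation

variable {hM : M.BackDet} {d : ℕ} {hd : 0 < d} {q : Q} {v : ℕ →₀ ℕ} {hv : v ≠ 0}
  {hvd : ∀ r, v r ≠ 0 → r < d}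

theorem fermatNumber_dvd_val {r : ℕ} (hr : r < d + 1) (w : ℕ → ℕ) :
    fermatNumber r ∣ ((encode (d + 1) w : ℕ) : ZMod (encode (d + 1) 1)).val ↔ 0 < w r := by
  rw [ZMod.val_natCast, Nat.dvd_mod_iff ((fermatNumber_dvd_encode hr 1).2 one_pos),
    fermatNumber_dvd_encode hr]

/-- The contents of the registers, with the number of steps in the register `d`. -/
def withClock (d k : ℕ) (w : ℕ → ℕ) (r : ℕ) : ℕ := if r = d then k else w r

variable (ch : ι → Option Bool) (σ : ℕ → ι)

theorem codeGuard_iff (hz : ∀ i, ∀ r ∈ M.zero i, r < d) (hdec : ∀ i, ∀ r ∈ M.dec i, r < d)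
    (i : ι) (k : ℕ) (w : ℕ → ℕ) :
    M.CodeGuard i ((encode (d + 1) (withClock d k w) : ℕ) : ZMod (encode (d + 1) 1)).val ↔
      (∀ r ∈ M.zero i, w r = 0) ∧ ∀ r ∈ M.dec i, 0 < w r := by
  have key : ∀ r < d, fermatNumber r ∣
      ((encode (d + 1) (withClock d k w) : ℕ) : ZMod (encode (d + 1) 1)).val ↔ 0 < w r := by
    intro r hr
    rw [fermatNumber_dvd_val (by omega), withClock, if_neg hr.ne]
  refine and_congr (forall₂_congr fun r hr => ?_) (forall₂_congr fun r hr => key r (hdec i r hr))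
  rw [key r (hz i r hr)]
  omega

theorem encode_step {i : ι} {w : ℕ → ℕ} (k : ℕ)
    (hi : ∀ r ∈ M.dec i, 0 < w r) :
    (fermatNumber d - 2) * encode (d + 1)
      (withClock d (k + 1) fun r => w r - (if r ∈ M.dec i then 1 else 0) + M.add i r) =
    encode (d + 1) (M.numer d i) * encode (d + 1) (withClock d k w) := by
  rw [← encode_denom, encode_mul, encode_mul]
  refine encode_congr fun r _ => ?_
  simp only [Pi.add_apply, withClock, numer]
  split_ifs with h1 h2
  · omega
  · have := hi r h2
    omega
  · omega

theorem num_drawing {k : ℕ}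
    (h : ∀ l < k, (M.system ch (q, v)).enabled ((M.system ch (q, v)).trace σ l).1 (σ l)) :
    (M.drawing hM d hd q v hv hvd).num σ k =
      encode (d + 1) (withClock d k ((M.system ch (q, v)).trace σ k).1.2) := by
  induction k with
  | zero =>
    refine encode_congr fun r _ => ?_
    rw [withClock]
    split_ifs with hr
    · by_contra h0
      exact absurd (hvd r h0) (by omega)
    · rfl
  | succ k ih =>
    rw [Drawing.num, ih fun l hl => h l (by omega)]
    refine Nat.div_eq_of_eq_mul_right (M.drawing hM d hd q v hv hvd).B_pos ?_
    have h1 := fermatNumber_le_encode_numer (M := M) d (σ k)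
    change (fermatNumber d - 2 + (encode (d + 1) (M.numer d (σ k)) - (fermatNumber d - 2))) * _ = _
    rw [Nat.add_sub_cancel' (by omega)]
    exact (encode_step k (h k (by omega)).2.2).symm

theorem valid_drawing_iff (hz : ∀ i, ∀ r ∈ M.zero i, r < d) (hdec : ∀ i, ∀ r ∈ M.dec i, r < d)
    (hadd : ∀ i, ∀ r, M.add i r ≠ 0 → r < d) :
    (M.drawing hM d hd q v hv hvd).Valid σ ↔ σ ∈ (M.system ch (q, v)).runs := by
  have key : ∀ k,
      (∀ l < k, (M.system ch (q, v)).enabled ((M.system ch (q, v)).trace σ l).1 (σ l)) →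
      ((M.drawing hM d hd q v hv hvd).T (Drawing.prev σ k)
        ((M.drawing hM d hd q v hv hvd).num σ k) (σ k) ↔
      (M.system ch (q, v)).enabled ((M.system ch (q, v)).trace σ k).1 (σ k)) := by
    intro k hk
    rw [num_drawing ch σ hk]
    change M.CodeStep d q ((encode (d + 1) _ : ℕ) : ZMod (encode (d + 1) 1)).val _ _ ↔ _
    rcases k with _ | k
    · have h1 : ¬ fermatNumber d ∣ ((encode (d + 1) (withClock d 0
          ((M.system ch (q, v)).trace σ 0).1.2) : ℕ) : ZMod (encode (d + 1) 1)).val := by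
        rw [fermatNumber_dvd_val d.lt_succ_self, withClock, if_pos rfl]
        exact lt_irrefl 0
      simp only [Drawing.prev, CodeStep, h1, not_false_eq_true, true_and, codeGuard_iff hz hdec]
      rfl
    · have h1 : fermatNumber d ∣ ((encode (d + 1) (withClock d (k + 1)
          ((M.system ch (q, v)).trace σ (k + 1)).1.2) : ℕ) : ZMod (encode (d + 1) 1)).val := by
        rw [fermatNumber_dvd_val d.lt_succ_self, withClock, if_pos rfl]
        exact Nat.succ_pos k
      have h2 : M.CodePost (σ k) ((encode (d + 1) (withClock d (k + 1)
          ((M.system ch (q, v)).trace σ (k + 1)).1.2) : ℕ) : ZMod (encode (d + 1) 1)).val := by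
        have hen := hk k (by omega)
        refine fun r => ⟨fun hr h0 => ?_, fun hr => ?_⟩
        · have hrd := hz _ r hr
          have hw := hen.2.1 r hr
          rw [fermatNumber_dvd_val (by omega), withClock, if_neg hrd.ne]
          change ¬ 0 < ((M.system ch (q, v)).trace σ k).1.2 r - _ + M.add (σ k) r
          omega
        · have hrd := hadd _ r hr.ne'
          rw [fermatNumber_dvd_val (by omega), withClock, if_neg hrd.ne]
          change 0 < ((M.system ch (q, v)).trace σ k).1.2 r - _ + M.add (σ k) r
          omega
      simp only [Drawing.prev, CodeStep, h1, h2, true_and, codeGuard_iff hz hdec]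
      rfl
  constructor
  · intro h k
    induction k using Nat.strong_induction_on with
    | _ k ih => exact (key k ih).1 (h k).2
  · refine fun h k => ⟨?_, (key k fun l _ => h l).2 (h k)⟩
    rw [num_drawing ch σ fun l _ => h l, num_drawing ch σ fun l _ => h l]
    have h1 := fermatNumber_le_encode_numer (M := M) d (σ k)
    change _ = (fermatNumber d - 2 + (encode (d + 1) (M.numer d (σ k)) - (fermatNumber d - 2))) * _
    rw [Nat.add_sub_cancel' (by omega)]
    exact encode_step k (h k).2.2

end simulation

theorem exists_bound [Finite ι] (M : RegMachine Q ι) (v : ℕ →₀ ℕ) : ∃ d, 0 < d ∧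
    (∀ r, v r ≠ 0 → r < d) ∧ (∀ i, ∀ r ∈ M.zero i, r < d) ∧ (∀ i, ∀ r ∈ M.dec i, r < d) ∧
    ∀ i r, M.add i r ≠ 0 → r < d := by
  have := Fintype.ofFinite ι
  let F := v.support ∪ Finset.univ.biUnion fun i => M.zero i ∪ M.dec i ∪ (M.add i).support
  have hF : ∀ r ∈ F, r < F.sup id + 1 := fun r hr => Nat.lt_succ_of_le (Finset.le_sup (f := id) hr)
  refine ⟨F.sup id + 1, Nat.succ_pos _, fun r hr => hF r ?_, fun i r hr => hF r ?_,
    fun i r hr => hF r ?_, fun i r hr => hF r ?_⟩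
  · simp [F, hr]
  all_goals
    simp only [F, Finset.mem_union, Finset.mem_biUnion, Finset.mem_univ, true_and]
    exact Or.inr ⟨i, by simp [hr]⟩

end RegMachine

end Conway

/-- For every countable Π⁰₁ set `S ⊆ {0,1}^ℕ` there is a countable
two-dimensional SFT, deterministic in some direction and with the P-property, whose
Cantor–Bendixson rank equals `rank(S) + 4`. -/
theorem rank_of_pi01_set (S : Set (ℕ → Bool)) (hcnt : S.Countable)
    (hPi : ∃ e : ℕ → Option (List Bool), Computable e ∧
      S = {x | ∀ l : List Bool, (∃ k, e k = some l) →
        ¬ ∀ i : Fin l.length, x (i : ℕ) = l.get i}) :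
    ∃ (A : Type) (_ : Fintype A) (X : Set (ℤ × ℤ → A)),
      IsSFT2 X ∧ X.Countable ∧ DetSomeDir X ∧ PProperty X ∧
      (letI : TopologicalSpace A := ⊥
       cbRank X = cbRank S + 4) := by
  obtain ⟨e, he, rfl⟩ := hPi
  change (avoids e).Countable at hcnt
  obtain ⟨χ, hχ, hχ'⟩ := exists_primrec_test (computable_prependWords he)
  have h1 : χ 1 = 0 := (hχ' _).1 (zero_mem_avoids e) 0
  obtain ⟨Q, ι, _, M, ch, q, v, hv, hM, hΦ⟩ := exists_regMachine hχ h1 hχ'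
  obtain ⟨d, hd, hvd, hz, hdec, hadd⟩ := M.exists_bound v
  let G := M.drawing hM d hd q v hv hvd
  let : TopologicalSpace ι := ⊥
  have : DiscreteTopology ι := ⟨rfl⟩
  let : TopologicalSpace G.Tile := ⊥
  have : DiscreteTopology G.Tile := ⟨rfl⟩
  obtain ⟨Φ, hcont, hinj, himg⟩ := hΦ
  have hruns : {σ | G.Valid σ} = Φ '' avoids (prependWords e) := by
    rw [himg]
    exact Set.ext fun σ => RegMachine.valid_drawing_iff ch σ hz hdec hadd
  have hcomp : IsCompact (avoids (prependWords e)) := (isClosed_avoids _).isCompact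
  have hcb : ∀ o, cbD {σ | G.Valid σ} o = Φ '' cbD (avoids (prependWords e)) o := fun o => by
    rw [hruns, cbD_image_of_isCompact hcomp hinj hcont]
  obtain ⟨hrank, hcount⟩ := Drawing.cbRank_space (G := G) (o := cbRank (avoids e))
    (hruns ▸ hcomp.image_of_continuousOn hcont)
    (by rw [hcb]; exact ⟨_, Set.mem_image_of_mem _ (zero_mem_cbD_prependWords e le_rfl)⟩)
    (by rw [hcb, cbD_prependWords_add_one e hcnt, Set.image_empty])
  exact ⟨G.Tile, Fintype.ofFinite _, G.space, Drawing.isSFT2_space, hcount,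
    Drawing.detSomeDir_space, Drawing.pProperty_space, hrank⟩
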